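/- For every integer m ≥ 3, φ(m) > m · (log log m) / (e^γ (log log m)² + 3), where γ is the Euler–Mascheroni constant. -/

import Mathlib

namespace TotientBound

open Complex Metric Set Filter Topology

/-- An entire function not vanishing identically factors globally at any point. -/
lemma exists_factor_at {f : ℂ → ℂ} (hf : Differentiable ℂ f) {u : ℂ}
    (hu : analyticOrderAt f u ≠ ⊤) :
    ∃ g : ℂ → ℂ, Differentiable ℂ g ∧ (∀ z, f z = (z - u) ^ analyticOrderNatAt f u * g z) ∧
      g u ≠ 0 := by
  have hfa : AnalyticAt ℂ f u := hf.analyticAt u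
  obtain ⟨p, hp⟩ := id hfa
  have hp0 : p ≠ 0 := fun h => hu (analyticOrderAt_eq_top.2 (hp.locally_zero_iff.2 h))
  have hd : ∀ n : ℕ, Differentiable ℂ ((Function.swap dslope u)^[n] f) := by
    intro n
    induction n with
    | zero => simpa using hf
    | succ n ih =>
      rw [Function.iterate_succ_apply']
      have := (Complex.differentiableOn_dslope (c := u) (s := univ) univ_mem).2
        ih.differentiableOn
      exact differentiableOn_univ.1 this
  have hord : analyticOrderNatAt f u = p.order := by
    rw [hfa.analyticOrderNatAt_eq_iff hu]
    exact ⟨_, (hd p.order).analyticAt u, hp.iterate_dslope_fslope_ne_zero hp0,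
      Eventually.of_forall fun z => hp.eq_pow_order_mul_iterate_dslope z⟩
  refine ⟨(Function.swap dslope u)^[p.order] f, hd _, fun z => ?_,
    hp.iterate_dslope_fslope_ne_zero hp0⟩
  rw [hord]
  exact hp.eq_pow_order_mul_iterate_dslope z

/-- Orders of vanishing are finite for entire functions that do not vanish identically. -/
lemma analyticOrderAt_ne_top_of_entire {f : ℂ → ℂ} (hf : Differentiable ℂ f) {z₀ : ℂ}
    (h0 : f z₀ ≠ 0) (u : ℂ) : analyticOrderAt f u ≠ ⊤ := by
  have hfa : AnalyticOnNhd ℂ f univ := fun z _ => hf.analyticAt z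
  refine AnalyticOnNhd.analyticOrderAt_ne_top_of_isPreconnected hfa isPreconnected_univ
    (mem_univ z₀) (mem_univ u) ?_
  rw [(hf.analyticAt z₀).analyticOrderAt_eq_zero.2 h0]
  simp

lemma analyticOrderNatAt_eq_zero_iff {f : ℂ → ℂ} (hf : Differentiable ℂ f) {z₀ : ℂ}
    (h0 : f z₀ ≠ 0) (u : ℂ) : analyticOrderNatAt f u = 0 ↔ f u ≠ 0 := by
  rw [← (hf.analyticAt u).analyticOrderAt_eq_zero,
    ← Nat.cast_analyticOrderNatAt (analyticOrderAt_ne_top_of_entire hf h0 u)]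
  simp

/-- The zeros of a nonzero entire function in a ball form a finite set. -/
lemma finite_zeros_closedBall {f : ℂ → ℂ} (hf : Differentiable ℂ f) {z₀ : ℂ} (h0 : f z₀ ≠ 0)
    (R : ℝ) : {u | f u = 0 ∧ ‖u‖ ≤ R}.Finite := by
  have hfa : AnalyticOnNhd ℂ f univ := fun z _ => hf.analyticAt z
  by_contra hinf
  obtain ⟨x, -, hx⟩ := Set.Infinite.exists_accPt_of_subset_isCompact hinf
    (isCompact_closedBall (0 : ℂ) R) (fun u hu => by simpa using hu.2)
  have hx' : ∃ᶠ z in 𝓝[≠] x, f z = 0 :=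
    (accPt_iff_frequently_nhdsNE.1 hx).mono fun z hz => hz.1
  exact h0 (hfa.eqOn_zero_of_preconnected_of_frequently_eq_zero isPreconnected_univ
    (mem_univ x) hx' (mem_univ z₀))

/-- Simultaneous factorisation of an entire function at finitely many points. -/
lemma exists_factor_finset {f : ℂ → ℂ} (hf : Differentiable ℂ f) {z₀ : ℂ} (h0 : f z₀ ≠ 0)
    (S : Finset ℂ) :
    ∃ g : ℂ → ℂ, Differentiable ℂ g ∧
      (∀ z, f z = (∏ u ∈ S, (z - u) ^ analyticOrderNatAt f u) * g z) ∧ ∀ u ∈ S, g u ≠ 0 := by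
  classical
  induction S using Finset.induction_on with
  | empty => exact ⟨f, hf, by simp, by simp⟩
  | insert u S hu ih =>
    obtain ⟨g, hg, hfg, hgS⟩ := ih
    have hgz : g z₀ ≠ 0 := fun h => h0 (by rw [hfg, h, mul_zero])
    have hgt := analyticOrderAt_ne_top_of_entire hg hgz u
    obtain ⟨g₁, hg₁, hgg, hgu⟩ := exists_factor_at hg hgt
    have hP : Differentiable ℂ fun z => ∏ w ∈ S, (z - w) ^ analyticOrderNatAt f w := by
      fun_prop
    have hPu : (∏ w ∈ S, (u - w) ^ analyticOrderNatAt f w) ≠ 0 := by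
      refine Finset.prod_ne_zero_iff.2 fun w hw => pow_ne_zero _ (sub_ne_zero.2 ?_)
      rintro rfl
      exact hu hw
    have hord : analyticOrderNatAt f u = analyticOrderNatAt g u := by
      have : f = (fun z => ∏ w ∈ S, (z - w) ^ analyticOrderNatAt f w) * g := funext hfg
      have h2 : analyticOrderAt f u = analyticOrderAt g u := by
        conv_lhs => rw [this]
        rw [analyticOrderAt_mul (hP.analyticAt u) (hg.analyticAt u),
          (hP.analyticAt u).analyticOrderAt_eq_zero.2 hPu, zero_add]
      simp only [analyticOrderNatAt, h2]
    refine ⟨g₁, hg₁, fun z => ?_, fun w hw => ?_⟩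
    · rw [Finset.prod_insert hu, hord, hfg z, hgg z]
      ring
    · rcases Finset.mem_insert.1 hw with rfl | hw
      · exact hgu
      · intro h
        exact hgS w hw (by rw [hgg, h, mul_zero])

/-- A finset of the zeros in the closed ball. -/
noncomputable def zerosIn (f : ℂ → ℂ) (R : ℝ) : Finset ℂ :=
  open Classical in
  if h : {u | f u = 0 ∧ ‖u‖ ≤ R}.Finite then h.toFinset else ∅

lemma mem_zerosIn {f : ℂ → ℂ} (hf : Differentiable ℂ f) {z₀ : ℂ} (h0 : f z₀ ≠ 0) {R : ℝ}
    {u : ℂ} : u ∈ zerosIn f R ↔ f u = 0 ∧ ‖u‖ ≤ R := by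
  rw [zerosIn, dif_pos (finite_zeros_closedBall hf h0 R)]
  simp

section local_bound

variable {f : ℂ → ℂ} {R E : ℝ}

/-- Division by Blaschke-type factors: the zero-free part on a ball. -/
lemma exists_blaschke (hf : Differentiable ℂ f) (h0 : f 0 = 1) (hR : 0 < R)
    (hE : ∀ z, ‖z‖ ≤ R → ‖f z‖ ≤ Real.exp E) :
    ∃ g : ℂ → ℂ, Differentiable ℂ g ∧
      (∀ z, f z = (∏ u ∈ zerosIn f R, (z - u) ^ analyticOrderNatAt f u) * g z) ∧
      (∀ z, ‖z‖ ≤ R → g z ≠ 0) ∧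
      (∀ z, ‖z‖ ≤ R →
        ‖g z * ∏ u ∈ zerosIn f R, (((R : ℂ) ^ 2 - (starRingEnd ℂ) u * z) / R) ^
          analyticOrderNatAt f u‖ ≤ Real.exp E) := by
  have hf0 : f 0 ≠ 0 := by simp [h0]
  obtain ⟨g, hg, hfg, hgS⟩ := exists_factor_finset hf hf0 (zerosIn f R)
  refine ⟨g, hg, hfg, fun z hz h => ?_, fun z hz => ?_⟩
  · exact hgS z ((mem_zerosIn hf hf0).2 ⟨by rw [hfg, h, mul_zero], hz⟩) h
  · set G : ℂ → ℂ := fun z => g z * ∏ u ∈ zerosIn f R, (((R : ℂ) ^ 2 - (starRingEnd ℂ) u * z) / R) ^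
          analyticOrderNatAt f u with hG
    have hGd : Differentiable ℂ G := by
      rw [hG]; fun_prop
    have := Complex.norm_le_of_forall_mem_frontier_norm_le (U := ball (0 : ℂ) R) (f := G)
      isBounded_ball hGd.diffContOnCl (C := Real.exp E) ?_ (z := z) ?_
    · exact this
    · intro w hw
      rw [frontier_ball _ hR.ne', mem_sphere_zero_iff_norm] at hw
      have hE' := hE w hw.le
      rw [hfg] at hE'
      convert hE' using 1
      rw [hG]
      simp only [norm_mul, norm_prod, norm_pow, norm_div]
      rw [mul_comm]
      congr 1
      refine Finset.prod_congr rfl fun u _ => ?_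
      congr 1
      have h1 : (R : ℂ) ^ 2 = (starRingEnd ℂ) w * w := by
        rw [mul_comm, Complex.mul_conj, Complex.normSq_eq_norm_sq, hw]; push_cast; ring
      rw [h1, ← sub_mul, ← map_sub, norm_mul, RCLike.norm_conj, hw, Complex.norm_real,
        Real.norm_of_nonneg hR.le]
      field_simp
    · rw [closure_ball _ hR.ne']; simpa using hz

/-- Zero counting by Jensen's inequality. -/
lemma zero_count_le (hf : Differentiable ℂ f) (h0 : f 0 = 1) (hR : 0 < R)
    (hE : ∀ z, ‖z‖ ≤ 2 * R → ‖f z‖ ≤ Real.exp E) :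
    (∑ u ∈ zerosIn f R, (analyticOrderNatAt f u : ℝ)) * Real.log 2 ≤ E := by
  have hf0 : f 0 ≠ 0 := by simp [h0]
  obtain ⟨g, hg, hfg, hg0, hb⟩ := exists_blaschke hf h0 (by positivity : 0 < 2 * R) hE
  have h1 := hb 0 (by simp; positivity)
  have h2 : (1 : ℝ) = ‖f 0‖ := by simp [h0]
  have hsub : zerosIn f R ⊆ zerosIn f (2 * R) := fun u hu => by
    rw [mem_zerosIn hf hf0] at hu ⊢
    exact ⟨hu.1, by linarith [hu.2]⟩
  have key : (2 : ℝ) ^ (∑ u ∈ zerosIn f R, analyticOrderNatAt f u) ≤ Real.exp E := by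
    refine le_trans ?_ h1
    rw [norm_mul, norm_prod]
    have hne : ∀ u ∈ zerosIn f (2 * R), u ≠ 0 := by
      rintro u hu rfl
      exact hf0 ((mem_zerosIn hf hf0).1 hu).1
    have h3 : ‖g 0‖ * ∏ u ∈ zerosIn f (2 * R), ‖u‖ ^ analyticOrderNatAt f u = 1 := by
      rw [h2, hfg 0, norm_mul, norm_prod]
      simp [mul_comm]
    have hg00 : ‖g 0‖ = ∏ u ∈ zerosIn f (2 * R), (1 / ‖u‖) ^ analyticOrderNatAt f u := by
      refine mul_right_cancel₀ (b := ∏ u ∈ zerosIn f (2 * R), ‖u‖ ^ analyticOrderNatAt f u)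
        (right_ne_zero_of_mul (h3.symm ▸ one_ne_zero)) ?_
      rw [h3, ← Finset.prod_mul_distrib, eq_comm]
      refine Finset.prod_eq_one fun u hu => ?_
      rw [← mul_pow, one_div, inv_mul_cancel₀ (norm_ne_zero_iff.2 (hne u hu)), one_pow]
    have hterm : ∀ u ∈ zerosIn f (2 * R), (1 / ‖u‖) ^ analyticOrderNatAt f u *
        ‖((((2 * R : ℝ) : ℂ) ^ 2 - (starRingEnd ℂ) u * 0) / ((2 * R : ℝ) : ℂ)) ^
          analyticOrderNatAt f u‖ = ((2 * R) / ‖u‖) ^ analyticOrderNatAt f u := by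
      intro u hu
      rw [norm_pow, ← mul_pow]
      congr 1
      rw [mul_zero, sub_zero, sq, mul_div_assoc, norm_mul, norm_div, Complex.norm_real,
        Real.norm_of_nonneg (by positivity)]
      field_simp
    rw [hg00, ← Finset.prod_mul_distrib, Finset.prod_congr rfl hterm, ← Finset.prod_pow_eq_pow_sum]
    refine (Finset.prod_le_prod (fun _ _ => by positivity) fun u hu => ?_).trans
      (Finset.prod_le_prod_of_subset_of_one_le hsub (fun _ _ => by positivity) fun u hu _ => ?_)
    · have hu' := ((mem_zerosIn hf hf0).1 hu)
      have : 0 < ‖u‖ := norm_pos_iff.2 (hne u (hsub hu))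
      gcongr
      rw [le_div_iff₀ this]
      linarith [hu'.2]
    · have hu' := ((mem_zerosIn hf hf0).1 hu)
      have : 0 < ‖u‖ := norm_pos_iff.2 (hne u hu)
      exact one_le_pow₀ ((one_le_div this).2 hu'.2)
  have := Real.log_le_log (by positivity) key
  rw [Real.log_exp, Real.log_pow] at this
  exact_mod_cast this

/-- Local partial fraction expansion of the logarithmic derivative with remainder. -/
lemma logDeriv_sub_sum_le (hf : Differentiable ℂ f) (h0 : f 0 = 1) (hR : 0 < R)
    (hE0 : 0 < E) (hE : ∀ z, ‖z‖ ≤ 2 * R → ‖f z‖ ≤ Real.exp E) {z : ℂ} (hz : ‖z‖ ≤ R / 4)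
    (hfz : f z ≠ 0) :
    ‖logDeriv f z - ∑ u ∈ zerosIn f R, (analyticOrderNatAt f u : ℂ) / (z - u)‖ ≤ 11 * E / R := by
  have hf0 : f 0 ≠ 0 := by simp [h0]
  obtain ⟨g, hg, hfg, hg0, hb⟩ := exists_blaschke hf h0 hR (E := E)
    (fun z hz => hE z (by linarith))
  set m := analyticOrderNatAt f with hm
  set G : ℂ → ℂ := fun z => g z * ∏ u ∈ zerosIn f R,
    (((R : ℂ) ^ 2 - (starRingEnd ℂ) u * z) / R) ^ m u with hG
  have hGd : Differentiable ℂ G := by rw [hG]; fun_prop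
  have hRc : (R : ℂ) ≠ 0 := by exact_mod_cast hR.ne'
  have hfac : ∀ u ∈ zerosIn f R, ∀ w : ℂ, ‖w‖ < R → (R : ℂ) ^ 2 - (starRingEnd ℂ) u * w ≠ 0 := by
    intro u hu w hw h
    have hu' := ((mem_zerosIn hf hf0).1 hu).2
    have h1 : ‖(starRingEnd ℂ) u * w‖ = R ^ 2 := by
      rw [← sub_eq_zero.1 h, norm_pow, Complex.norm_real, Real.norm_of_nonneg hR.le]
    rw [norm_mul, RCLike.norm_conj] at h1
    nlinarith [norm_nonneg u, norm_nonneg w]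
  have hGne : ∀ w ∈ ball (0 : ℂ) R, G w ≠ 0 := by
    intro w hw
    rw [mem_ball_zero_iff] at hw
    refine mul_ne_zero (hg0 w hw.le) (Finset.prod_ne_zero_iff.2 fun u hu => pow_ne_zero _ ?_)
    exact div_ne_zero (hfac u hu w hw) hRc
  -- a holomorphic logarithm of `G`
  have hLd : DifferentiableOn ℂ (logDeriv G) (ball 0 R) := by
    have : DifferentiableOn ℂ (deriv G) (ball 0 R) := (hGd.differentiableOn).deriv isOpen_ball
    exact this.div hGd.differentiableOn hGne
  obtain ⟨H, hH⟩ := hLd.isExactOn_ball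
  have hH0 : ∀ w ∈ ball (0 : ℂ) R, HasDerivAt (fun w => H w - H 0) (logDeriv G w) w :=
    fun w hw => (hH w hw).sub_const _
  have hexp : ∀ w ∈ ball (0 : ℂ) R, G w = G 0 * Complex.exp (H w - H 0) := by
    have hconst : ∀ w ∈ ball (0 : ℂ) R, HasDerivWithinAt
        (fun w => G w * Complex.exp (-(H w - H 0))) 0 (ball 0 R) w := by
      intro w hw
      have h1 := ((hGd w).hasDerivAt.mul ((hH0 w hw).neg.cexp))
      refine h1.hasDerivWithinAt.congr_deriv ?_
      rw [logDeriv_apply]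
      have := hGne w hw
      field_simp
      simp
    intro w hw
    have := (convex_ball (0 : ℂ) R).is_const_of_fderivWithin_eq_zero (𝕜 := ℂ)
      (f := fun w => G w * Complex.exp (-(H w - H 0)))
      (fun w hw => (hconst w hw).differentiableWithinAt)
      (fun w hw => by
        rw [(hconst w hw).hasFDerivWithinAt.fderivWithin
          (isOpen_ball.uniqueDiffWithinAt hw)]
        simp) (mem_ball_self hR) hw
    simp only [sub_self, neg_zero, Complex.exp_zero, mul_one] at this
    rw [this, mul_assoc, ← Complex.exp_add]
    simp
  have hG0 : 1 ≤ ‖G 0‖ := by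
    have h2 : (1 : ℝ) = ‖f 0‖ := by simp [h0]
    rw [h2, hfg 0, hG]
    simp only [norm_mul, norm_prod, norm_pow, norm_div]
    rw [mul_comm]
    refine mul_le_mul_of_nonneg_left (Finset.prod_le_prod (fun _ _ => by positivity)
      fun u hu => ?_) (norm_nonneg _)
    have hu' := ((mem_zerosIn hf hf0).1 hu).2
    gcongr
    rw [mul_zero, sub_zero, norm_pow, Complex.norm_real, Real.norm_of_nonneg hR.le, sq,
      mul_div_assoc, div_self hR.ne', mul_one, zero_sub, norm_neg]
    exact hu'
  have hre : MapsTo (fun w => H w - H 0) (ball 0 R) {w | w.re ≤ E} := by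
    intro w hw
    have h1 := hb w (mem_ball_zero_iff.1 hw).le
    have h2 := hexp w hw
    have h3 : ‖G w‖ ≤ Real.exp E := h1
    rw [h2, norm_mul, Complex.norm_exp] at h3
    have h4 : Real.exp (H w - H 0).re ≤ Real.exp E := by
      nlinarith [Real.exp_pos (H w - H 0).re]
    exact Real.exp_le_exp.1 h4
  have hbc : ∀ w, ‖w‖ ≤ R / 2 → ‖H w - H 0‖ ≤ 2 * E := by
    intro w hw
    have h1 := borelCaratheodory_zero hE0
      (fun w hw => (hH0 w hw).differentiableAt.differentiableWithinAt)
      hre hR (show w ∈ ball (0 : ℂ) R by rw [mem_ball_zero_iff]; linarith) (by simp)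
    refine h1.trans ?_
    rw [div_le_iff₀ (by linarith)]
    nlinarith [norm_nonneg w]
  have hzb : z ∈ ball (0 : ℂ) R := by rw [mem_ball_zero_iff]; linarith
  have hder : ‖logDeriv G z‖ ≤ 8 * E / R := by
    have h1 := Complex.norm_deriv_le_of_forall_mem_sphere_norm_le (c := z) (R := R / 4)
      (C := 2 * E) (f := fun w => H w - H 0) (by linarith) ?_ ?_
    · rw [(hH0 z hzb).deriv] at h1
      refine h1.trans (le_of_eq ?_)
      field_simp
      ring
    · have hsub : closure (ball z (R / 4)) ⊆ ball 0 R := by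
        rw [closure_ball _ (by linarith)]
        intro w hw
        rw [mem_closedBall, dist_eq_norm] at hw
        rw [mem_ball_zero_iff]
        have : ‖w‖ ≤ ‖w - z‖ + ‖z‖ := by simpa using norm_add_le (w - z) z
        linarith
      have hd : DifferentiableOn ℂ (fun w => H w - H 0) (closure (ball z (R / 4))) :=
        fun w hw => (hH0 w (hsub hw)).differentiableAt.differentiableWithinAt
      exact hd.diffContOnCl
    · intro w hw
      apply hbc
      rw [mem_sphere, dist_eq_norm] at hw
      have : ‖w‖ ≤ ‖w - z‖ + ‖z‖ := by simpa using norm_add_le (w - z) z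
      linarith
  have hgz : g z ≠ 0 := hg0 z (by linarith)
  have hne : ∀ u ∈ zerosIn f R, z - u ≠ 0 := by
    intro u hu h
    rw [sub_eq_zero] at h
    exact hfz (h ▸ ((mem_zerosIn hf hf0).1 hu).1)
  have hlf : logDeriv f z = (∑ u ∈ zerosIn f R, (m u : ℂ) / (z - u)) + logDeriv g z := by
    have : f = fun z => (∏ u ∈ zerosIn f R, (z - u) ^ m u) * g z := funext hfg
    conv_lhs => rw [this]
    rw [logDeriv_mul (f := fun z => ∏ u ∈ zerosIn f R, (z - u) ^ m u) z
      (Finset.prod_ne_zero_iff.2 fun u hu => pow_ne_zero _ (hne u hu)) hgz (by fun_prop) (hg z)]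
    congr 1
    rw [logDeriv_prod (f := fun u z => (z - u) ^ m u) (fun u hu => pow_ne_zero _ (hne u hu))
      (fun u hu => by fun_prop)]
    refine Finset.sum_congr rfl fun u hu => ?_
    rw [logDeriv_fun_pow (by fun_prop), logDeriv_apply]
    simp [div_eq_mul_inv]
  have hlG : logDeriv G z = logDeriv g z + ∑ u ∈ zerosIn f R,
      (m u : ℂ) * (-(starRingEnd ℂ) u / ((R : ℂ) ^ 2 - (starRingEnd ℂ) u * z)) := by
    have hn : ∀ u ∈ zerosIn f R, ((R : ℂ) ^ 2 - (starRingEnd ℂ) u * z) / R ≠ 0 :=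
      fun u hu => div_ne_zero (hfac u hu z (mem_ball_zero_iff.1 hzb)) hRc
    rw [hG, logDeriv_mul z hgz (Finset.prod_ne_zero_iff.2 fun u hu => pow_ne_zero _ (hn u hu))
      (hg z) (by fun_prop)]
    congr 1
    rw [logDeriv_prod (f := fun u z => (((R : ℂ) ^ 2 - (starRingEnd ℂ) u * z) / R) ^ m u)
      (fun u hu => pow_ne_zero _ (hn u hu)) (fun u hu => by fun_prop)]
    refine Finset.sum_congr rfl fun u hu => ?_
    rw [logDeriv_fun_pow (by fun_prop), logDeriv_apply]
    congr 1
    have hd : HasDerivAt (fun w : ℂ => ((R : ℂ) ^ 2 - (starRingEnd ℂ) u * w) / R)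
        (-(starRingEnd ℂ) u / R) z := by
      have := (((hasDerivAt_id z).const_mul ((starRingEnd ℂ) u)).const_sub ((R : ℂ) ^ 2)).div_const
        (R : ℂ)
      simpa using this
    rw [hd.deriv, div_div_div_cancel_right₀ hRc]
  have heq : logDeriv f z - ∑ u ∈ zerosIn f R, (m u : ℂ) / (z - u) =
      logDeriv G z - ∑ u ∈ zerosIn f R,
        (m u : ℂ) * (-(starRingEnd ℂ) u / ((R : ℂ) ^ 2 - (starRingEnd ℂ) u * z)) := by
    rw [hlf, hlG]; ring
  have hcount := zero_count_le hf h0 hR hE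
  have hsum : ‖∑ u ∈ zerosIn f R,
        (m u : ℂ) * (-(starRingEnd ℂ) u / ((R : ℂ) ^ 2 - (starRingEnd ℂ) u * z))‖
        ≤ (∑ u ∈ zerosIn f R, (m u : ℝ)) * (4 / (3 * R)) := by
    rw [Finset.sum_mul]
    refine (norm_sum_le _ _).trans (Finset.sum_le_sum fun u hu => ?_)
    have hu' := ((mem_zerosIn hf hf0).1 hu).2
    rw [norm_mul, Complex.norm_natCast]
    gcongr
    rw [norm_div, norm_neg, RCLike.norm_conj]
    have h1 : R ^ 2 * (3 / 4) ≤ ‖(R : ℂ) ^ 2 - (starRingEnd ℂ) u * z‖ := by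
      have h2 := norm_sub_norm_le ((R : ℂ) ^ 2) ((starRingEnd ℂ) u * z)
      rw [norm_mul, RCLike.norm_conj, norm_pow, Complex.norm_real, Real.norm_of_nonneg hR.le] at h2
      nlinarith [norm_nonneg u, norm_nonneg z, mul_le_mul hu' hz (norm_nonneg z) hR.le]
    rw [div_le_div_iff₀ (by nlinarith) (by positivity)]
    nlinarith
  have hl2 := Real.log_two_gt_d9
  have hN : (∑ u ∈ zerosIn f R, (m u : ℝ)) * (4 / (3 * R)) ≤ 3 * E / R := by
    have hs : 0 ≤ ∑ u ∈ zerosIn f R, (m u : ℝ) := by positivity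
    have : (∑ u ∈ zerosIn f R, (m u : ℝ)) * (4 / (3 * R)) =
      ((∑ u ∈ zerosIn f R, (m u : ℝ)) * (4 / 3)) / R := by field_simp
    rw [this]
    refine div_le_div_of_nonneg_right ?_ hR.le
    nlinarith
  rw [heq]
  calc _ ≤ 8 * E / R + 3 * E / R := (norm_sub_le _ _).trans (add_le_add hder (hsum.trans hN))
    _ = 11 * E / R := by ring

end local_bound

/-- Entire functions of minimal exponential type: the logarithmic derivative is the limit
of the partial fraction sums over balls. -/
theorem tendsto_sum_zeros {f : ℂ → ℂ} (hf : Differentiable ℂ f) (h0 : f 0 = 1)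
    (hgrowth : ∀ ε > 0, ∀ᶠ R : ℝ in atTop, ∀ z, ‖z‖ ≤ R → ‖f z‖ ≤ Real.exp (ε * R))
    {z : ℂ} (hfz : f z ≠ 0) :
    Tendsto (fun R : ℝ => ∑ u ∈ zerosIn f R, (analyticOrderNatAt f u : ℂ) / (z - u)) atTop
      (𝓝 (logDeriv f z)) := by
  rw [Metric.tendsto_nhds]
  intro ε hε
  have h2 : Tendsto (fun R : ℝ => 2 * R) atTop atTop := tendsto_id.const_mul_atTop (by norm_num)
  filter_upwards [h2.eventually (hgrowth (ε / 44) (by positivity)), eventually_ge_atTop (4 * ‖z‖),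
    eventually_gt_atTop 0] with R hR hzR hR0
  have := logDeriv_sub_sum_le hf h0 hR0 (by positivity) hR (z := z) (by linarith) hfz
  rw [dist_comm, dist_eq_norm]
  refine this.trans_lt ?_
  rw [div_lt_iff₀ hR0]
  nlinarith

/-- The multiplicities of the zeros divided by their moduli are summable when the zeros lie in a
sector in the left half plane. -/
lemma summable_zeros {f : ℂ → ℂ} (hf : Differentiable ℂ f) (h0 : f 0 = 1)
    (hgrowth : ∀ ε > 0, ∀ᶠ R : ℝ in atTop, ∀ z, ‖z‖ ≤ R → ‖f z‖ ≤ Real.exp (ε * R))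
    {C : ℝ} (hsec : ∀ u, f u = 0 → ‖u‖ ≤ C * -u.re) :
    Summable fun u : ℂ => (analyticOrderNatAt f u : ℝ) / ‖u‖ := by
  have hf0 : f 0 ≠ 0 := by simp [h0]
  have hlim := (Complex.continuous_re.tendsto _).comp (tendsto_sum_zeros hf h0 hgrowth hf0)
  have hne : ∀ u, f u = 0 → u ≠ 0 := by
    rintro u hu rfl
    exact hf0 hu
  have hterm : ∀ u, f u = 0 → (analyticOrderNatAt f u : ℝ) / ‖u‖ ≤
      C * ((analyticOrderNatAt f u : ℂ) / (0 - u)).re := by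
    intro u hu
    have hu0 := norm_pos_iff.2 (hne u hu)
    have h1 : ((analyticOrderNatAt f u : ℂ) / (0 - u)).re =
        (analyticOrderNatAt f u : ℝ) * (-u.re) / ‖u‖ ^ 2 := by
      rw [zero_sub, div_eq_mul_inv, ← Complex.ofReal_natCast, Complex.re_ofReal_mul,
        Complex.inv_re, Complex.normSq_neg, Complex.normSq_eq_norm_sq, Complex.neg_re,
        mul_div_assoc]
    rw [h1, ← mul_div_assoc, div_le_div_iff₀ hu0 (by positivity)]
    have := mul_le_mul_of_nonneg_left (hsec u hu)
      (by positivity : (0 : ℝ) ≤ (analyticOrderNatAt f u : ℝ) * ‖u‖)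
    nlinarith
  have hfin : ∀ R : ℝ, ∑ u ∈ zerosIn f R, (analyticOrderNatAt f u : ℝ) / ‖u‖ ≤
      C * (∑ u ∈ zerosIn f R, (analyticOrderNatAt f u : ℂ) / (0 - u)).re := by
    intro R
    rw [Complex.re_sum, Finset.mul_sum]
    exact Finset.sum_le_sum fun u hu => hterm u ((mem_zerosIn hf hf0).1 hu).1
  refine summable_of_sum_le (c := C * (logDeriv f 0).re) (fun u => by positivity) fun s => ?_
  refine ge_of_tendsto (hlim.const_mul C) ?_
  obtain ⟨B, hB⟩ := (s.image (fun u => ‖u‖)).bddAbove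
  filter_upwards [eventually_ge_atTop B] with R hR
  refine le_trans ?_ (hfin R)
  rw [← Finset.sum_filter_ne_zero]
  refine Finset.sum_le_sum_of_subset_of_nonneg (fun u hu => ?_) (fun _ _ _ => by positivity)
  rw [Finset.mem_filter] at hu
  rw [mem_zerosIn hf hf0]
  refine ⟨?_, (hB (by simpa using ⟨u, hu.1, rfl⟩)).trans hR⟩
  by_contra h
  exact hu.2 (by rw [(analyticOrderNatAt_eq_zero_iff hf hf0 u).2 h]; simp)

lemma norm_div_sub_le {z u : ℂ} (k : ℕ) (h : 2 * ‖z‖ ≤ ‖u‖) :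
    ‖(k : ℂ) / (z - u)‖ ≤ 2 * ((k : ℝ) / ‖u‖) := by
  rw [norm_div, Complex.norm_natCast]
  rcases eq_or_ne u 0 with rfl | hu
  · have : ‖z‖ = 0 := by
      rw [norm_zero] at h
      linarith [norm_nonneg z]
    simp [norm_eq_zero.1 this]
  · have hu0 := norm_pos_iff.2 hu
    have h1 : ‖u‖ / 2 ≤ ‖z - u‖ := by
      have := norm_sub_norm_le u z
      rw [norm_sub_rev] at this
      linarith
    rw [← mul_div_assoc, div_le_div_iff₀ (by linarith) hu0]
    have : (0 : ℝ) ≤ k := by positivity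
    nlinarith

/-- Hadamard's partial fraction expansion for functions of minimal exponential type whose zeros
lie in a sector. -/
theorem hasSum_zeros {f : ℂ → ℂ} (hf : Differentiable ℂ f) (h0 : f 0 = 1)
    (hgrowth : ∀ ε > 0, ∀ᶠ R : ℝ in atTop, ∀ z, ‖z‖ ≤ R → ‖f z‖ ≤ Real.exp (ε * R))
    {C : ℝ} (hsec : ∀ u, f u = 0 → ‖u‖ ≤ C * -u.re) {z : ℂ} (hfz : f z ≠ 0) :
    HasSum (fun u : ℂ => (analyticOrderNatAt f u : ℂ) / (z - u)) (logDeriv f z) := by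
  classical
  have hf0 : f 0 ≠ 0 := by simp [h0]
  have hsum := summable_zeros hf h0 hgrowth hsec
  set F : ℂ → ℂ := fun u => (analyticOrderNatAt f u : ℂ) / (z - u) with hF
  have hS : Summable F := by
    refine Summable.of_norm_bounded_eventually (hsum.mul_left 2) ?_
    refine Filter.eventually_cofinite.2
      ((finite_zeros_closedBall hf hf0 (2 * ‖z‖)).subset fun u hu => ?_)
    rw [Set.mem_ofPred_eq] at hu
    refine ⟨?_, ?_⟩
    · by_contra h
      exact hu (by simp [hF, (analyticOrderNatAt_eq_zero_iff hf hf0 u).2 h])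
    · by_contra! h
      exact hu (norm_div_sub_le _ h.le)
  have hlim := tendsto_sum_zeros hf h0 hgrowth hfz
  have hz : ∀ u, f u ≠ 0 → F u = 0 := fun u hu => by
    simp [hF, (analyticOrderNatAt_eq_zero_iff hf hf0 u).2 hu]
  have hlim2 : Tendsto (fun R : ℝ => ∑' u, if u ∈ zerosIn f R then F u else 0) atTop
      (𝓝 (∑' u, F u)) := by
    refine tendsto_tsum_of_dominated_convergence hS.norm (fun u => ?_)
      (Eventually.of_forall fun R u => ?_)
    · refine tendsto_const_nhds.congr' ?_
      filter_upwards [eventually_ge_atTop ‖u‖] with R hR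
      split_ifs with h
      · rfl
      · refine hz u fun h' => h ((mem_zerosIn hf hf0).2 ⟨h', hR⟩)
    · split_ifs
      · exact le_rfl
      · simp
  have hlim3 : Tendsto (fun R : ℝ => ∑' u, if u ∈ zerosIn f R then F u else 0) atTop
      (𝓝 (logDeriv f z)) := by
    refine hlim.congr fun R => ?_
    rw [tsum_eq_sum (s := zerosIn f R) (fun u hu => by simp [hu])]
    exact Finset.sum_congr rfl fun u hu => by simp [hu, hF]
  rw [← tendsto_nhds_unique hlim2 hlim3]
  exact hS.hasSum

end TotientBound

namespace TotientBound

open Complex Metric Set Filter Topology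

lemma sqrt_sq_eq (w : ℂ) : (w ^ (1 / 2 : ℂ)) ^ 2 = w := by
  have := Complex.cpow_nat_inv_pow w (n := 2) two_ne_zero
  rw [one_div]
  exact_mod_cast this

/-- An even entire function factors through squaring. -/
lemma differentiable_comp_sqrt {e : ℂ → ℂ} (he : Differentiable ℂ e) (heven : ∀ z, e (-z) = e z) :
    Differentiable ℂ fun w => e (w ^ (1 / 2 : ℂ)) := by
  have hsq : ∀ a b : ℂ, a ^ 2 = b ^ 2 → e a = e b := by
    intro a b h
    rcases sq_eq_sq_iff_eq_or_eq_neg.1 h with h | h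
    · rw [h]
    · rw [h, heven]
  have hd : DifferentiableOn ℂ (fun w => e (w ^ (1 / 2 : ℂ))) (univ \ {0}) := by
    intro w hw
    have hw0 : w ≠ 0 := by simpa using hw.2
    refine DifferentiableAt.differentiableWithinAt ?_
    by_cases hs : w ∈ slitPlane
    · exact (he _).comp w ((differentiableAt_id).cpow_const hs)
    · have hs' : -w ∈ slitPlane := by
        rw [Complex.mem_slitPlane_iff] at hs ⊢
        push Not at hs
        left
        rw [Complex.neg_re]
        rcases hs.1.lt_or_eq with h | h
        · linarith
        · exact absurd (Complex.ext h hs.2) hw0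
      have heq : (fun w => e (w ^ (1 / 2 : ℂ))) = fun w => e (I * (-w) ^ (1 / 2 : ℂ)) := by
        funext w
        apply hsq
        rw [mul_pow, sqrt_sq_eq, sqrt_sq_eq, I_sq]
        ring
      rw [heq]
      have h1 : DifferentiableAt ℂ (fun w : ℂ => I * (-w) ^ (1 / 2 : ℂ)) w :=
        ((differentiableAt_id.neg).cpow_const hs').const_mul I
      exact (he _).comp w h1
  have hc : ContinuousAt (fun w => e (w ^ (1 / 2 : ℂ))) 0 := by
    have h1 : ContinuousAt (fun w : ℂ => w ^ (1 / 2 : ℂ)) 0 :=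
      Complex.continuousAt_cpow_const_of_re_pos (by simp) (by norm_num)
    exact ContinuousAt.comp (f := fun w : ℂ => w ^ (1 / 2 : ℂ)) he.continuous.continuousAt h1
  exact differentiableOn_univ.1
    ((differentiableOn_compl_singleton_and_continuousAt_iff univ_mem).1 ⟨hd, hc⟩)

/-- The entire function `ξ(s) = s (s - 1) π^{-s/2} Γ(s/2) ζ(s)`. -/
noncomputable def xi (s : ℂ) : ℂ := 1 + s * (s - 1) * completedRiemannZeta₀ s

lemma differentiable_xi : Differentiable ℂ xi := by
  have := differentiable_completedZeta₀
  unfold xi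
  fun_prop

lemma xi_one_sub (s : ℂ) : xi (1 - s) = xi s := by
  rw [xi, xi, completedRiemannZeta₀_one_sub]
  ring

lemma xi_eq {s : ℂ} (h0 : s ≠ 0) (h1 : s ≠ 1) : xi s = s * (s - 1) * completedRiemannZeta s := by
  have : (1 - s) ≠ 0 := sub_ne_zero.2 h1.symm
  rw [xi, completedRiemannZeta_eq]
  field_simp
  ring

/-- The function `F` with `F (s (s - 1)) = ξ(s)`. -/
noncomputable def xiQ (v : ℂ) : ℂ := xi (1 / 2 + (v + 1 / 4) ^ (1 / 2 : ℂ))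

lemma differentiable_xiQ : Differentiable ℂ xiQ := by
  have h := differentiable_comp_sqrt (e := fun z => xi (1 / 2 + z))
    (differentiable_xi.comp (by fun_prop)) (fun z => by
      rw [← xi_one_sub]; congr 1; ring)
  exact h.comp (f := fun v : ℂ => v + 1 / 4) (by fun_prop)

lemma xiQ_mul_sub_one (s : ℂ) : xiQ (s * (s - 1)) = xi s := by
  have h : s * (s - 1) + 1 / 4 = (s - 1 / 2) ^ 2 := by ring
  rw [xiQ]
  have h2 : ((s * (s - 1) + 1 / 4) ^ (1 / 2 : ℂ)) ^ 2 = (s - 1 / 2) ^ 2 := by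
    rw [sqrt_sq_eq, h]
  rcases sq_eq_sq_iff_eq_or_eq_neg.1 h2 with h3 | h3
  · rw [h3]; congr 1; ring
  · rw [h3, ← xi_one_sub]; congr 1; ring

lemma xiQ_zero : xiQ 0 = 1 := by
  have := xiQ_mul_sub_one 0
  simpa [xi] using this

/-- The preferred root `s` of `s (s - 1) = v`. -/
noncomputable def rootOf (v : ℂ) : ℂ := 1 / 2 + (v + 1 / 4) ^ (1 / 2 : ℂ)

lemma rootOf_mul (v : ℂ) : rootOf v * (rootOf v - 1) = v := by
  have := sqrt_sq_eq (v + 1 / 4)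
  rw [rootOf]
  linear_combination this

lemma half_le_re_rootOf (v : ℂ) : 1 / 2 ≤ (rootOf v).re := by
  have h : 0 ≤ ((v + 1 / 4) ^ (1 / 2 : ℂ)).re := by
    rcases eq_or_ne (v + 1 / 4) 0 with h | h
    · rw [h, Complex.zero_cpow (by norm_num), Complex.zero_re]
    · rw [Complex.cpow_def_of_ne_zero h, Complex.exp_re]
      refine mul_nonneg (Real.exp_pos _).le (Real.cos_nonneg_of_mem_Icc ?_)
      have : (Complex.log (v + 1 / 4) * (1 / 2)).im = (v + 1 / 4).arg / 2 := by
        rw [show (1 / 2 : ℂ) = ((1 / 2 : ℝ) : ℂ) by push_cast; rfl, Complex.im_mul_ofReal,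
          Complex.log_im]
        ring
      rw [this]
      have := Complex.arg_le_pi (v + 1 / 4)
      have := Complex.neg_pi_lt_arg (v + 1 / 4)
      constructor <;> linarith
  rw [rootOf, Complex.add_re]
  norm_num
  exact_mod_cast h

lemma xiQ_eq_xi_rootOf (v : ℂ) : xiQ v = xi (rootOf v) := rfl

/-! ### Growth -/

lemma norm_Gamma_le {s : ℂ} (hs : 0 < s.re) : ‖Complex.Gamma s‖ ≤ Real.Gamma s.re := by
  rw [Complex.Gamma_eq_integral hs, Real.Gamma_eq_integral hs, Complex.GammaIntegral]
  refine (MeasureTheory.norm_integral_le_integral_norm _).trans (le_of_eq ?_)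
  refine MeasureTheory.setIntegral_congr_fun measurableSet_Ioi fun x hx => ?_
  rw [mem_Ioi] at hx
  simp only [norm_mul]
  rw [Complex.norm_cpow_eq_rpow_re_of_pos hx, Complex.norm_real,
    Real.norm_of_nonneg (Real.exp_pos _).le]
  simp

/-- The completed zeta function is bounded on vertical strips. -/
lemma exists_bound_completedZeta₀ :
    ∃ C : ℝ, ∀ s : ℂ, 0 ≤ s.re → s.re ≤ 2 → ‖completedRiemannZeta₀ s‖ ≤ C := by
  set P := HurwitzZeta.hurwitzEvenFEPair 0
  have hm : ∀ s : ℂ, MellinConvergent P.f_modif s := fun s =>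
    (P.isStrongFEPair_toStrongFEPair.hasMellin s).1
  have hi : ∀ σ : ℝ, MeasureTheory.IntegrableOn (fun t : ℝ => t ^ (σ - 1) * ‖P.f_modif t‖)
      (Ioi 0) := by
    intro σ
    refine MeasureTheory.IntegrableOn.congr_fun (MeasureTheory.Integrable.norm (hm σ))
      (fun t ht => ?_) measurableSet_Ioi
    rw [mem_Ioi] at ht
    simp only [norm_smul]
    rw [Complex.norm_cpow_eq_rpow_re_of_pos ht]
    simp
  refine ⟨(∫ t in Ioi (0 : ℝ), (t ^ ((0 : ℝ) - 1) * ‖P.f_modif t‖ +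
    t ^ ((1 : ℝ) - 1) * ‖P.f_modif t‖)) / 2, fun s h0 h2 => ?_⟩
  have : completedRiemannZeta₀ s = (P.Λ₀ (s / 2)) / 2 := rfl
  rw [this, norm_div, WeakFEPair.Λ₀, mellin]
  simp only [RCLike.norm_ofNat]
  refine div_le_div_of_nonneg_right ?_ (by norm_num)
  refine MeasureTheory.norm_integral_le_of_norm_le ((hi 0).add (hi 1)) ?_
  refine (MeasureTheory.ae_restrict_iff' measurableSet_Ioi).2 (Eventually.of_forall fun t ht => ?_)
  rw [mem_Ioi] at ht
  rw [norm_smul, Complex.norm_cpow_eq_rpow_re_of_pos ht, ← add_mul]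
  refine mul_le_mul_of_nonneg_right ?_ (norm_nonneg _)
  have hre : (s / 2 - 1).re = s.re / 2 - 1 := by simp
  rw [hre]
  rcases le_total t 1 with h | h
  · have := Real.rpow_le_rpow_of_exponent_ge ht h (show (0 : ℝ) - 1 ≤ s.re / 2 - 1 by linarith)
    exact this.trans (le_add_of_nonneg_right (Real.rpow_nonneg ht.le _))
  · have := Real.rpow_le_rpow_of_exponent_le h (show s.re / 2 - 1 ≤ (1 : ℝ) - 1 by linarith)
    exact this.trans (le_add_of_nonneg_left (Real.rpow_nonneg ht.le _))

lemma norm_zeta_le_zeta_two {s : ℂ} (hs : 2 ≤ s.re) : ‖riemannZeta s‖ ≤ 2 := by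
  rw [zeta_eq_tsum_one_div_nat_cpow (by linarith)]
  have h2 := (hasSum_zeta_two)
  have hle : ∀ n : ℕ, ‖1 / (n : ℂ) ^ s‖ ≤ 1 / (n : ℝ) ^ 2 := by
    intro n
    rcases Nat.eq_zero_or_pos n with rfl | hn
    · have : s ≠ 0 := by rintro rfl; simp at hs; linarith
      simp [this]
    · have hn1 : (1 : ℝ) ≤ n := by exact_mod_cast hn
      rw [norm_div, norm_one, Complex.norm_natCast_cpow_of_pos hn]
      gcongr
      rw [← Real.rpow_natCast]
      exact Real.rpow_le_rpow_of_exponent_le hn1 (by simpa using hs)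
  refine (tsum_of_norm_bounded h2 hle).trans ?_
  nlinarith [Real.pi_lt_d2, Real.pi_pos]

lemma Gamma_le_exp {x X : ℝ} (hx : 1 ≤ x) (hX : x + 2 ≤ X) :
    Real.Gamma x ≤ Real.exp (2 * X ^ (3 / 2 : ℝ)) := by
  have hX0 : 0 < X := by linarith
  set n := ⌈x⌉₊ + 1 with hn
  have hxn : x + 1 ≤ n := by
    rw [hn]; push_cast
    linarith [Nat.le_ceil x]
  have hnX : (n : ℝ) ≤ X := by
    rw [hn]; push_cast
    linarith [Nat.ceil_lt_add_one (show 0 ≤ x by linarith)]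
  have h1 : Real.Gamma x ≤ n.factorial := by
    have h2 : Real.Gamma (x + 1) ≤ Real.Gamma (n + 1) :=
      Real.Gamma_strictMonoOn_Ici.monotoneOn (by simp; linarith) (by simp; linarith) (by linarith)
    rw [Real.Gamma_nat_eq_factorial, Real.Gamma_add_one (by linarith)] at h2
    have := Real.Gamma_pos_of_pos (show 0 < x by linarith)
    nlinarith
  refine h1.trans ?_
  have h2 : (n.factorial : ℝ) ≤ X ^ (n : ℝ) := by
    rw [Real.rpow_natCast]
    have : (n.factorial : ℝ) ≤ (n : ℝ) ^ n := by exact_mod_cast Nat.factorial_le_pow n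
    refine this.trans ?_
    gcongr
  refine h2.trans ?_
  rw [Real.rpow_def_of_pos hX0]
  refine Real.exp_le_exp.2 ?_
  have h3 : Real.log X ≤ 2 * X ^ (1 / 2 : ℝ) := by
    have := Real.log_le_rpow_div hX0.le (show (0 : ℝ) < 1 / 2 by norm_num)
    linarith
  have h4 : X ^ (3 / 2 : ℝ) = X * X ^ (1 / 2 : ℝ) := by
    rw [← Real.rpow_one_add' hX0.le (by norm_num)]
    norm_num
  have h5 : 0 ≤ X ^ (1 / 2 : ℝ) := by positivity
  rw [h4]
  have hn0 : (0 : ℝ) ≤ n := by positivity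
  nlinarith

/-- Growth of `ξ` in the right half plane. -/
lemma exists_bound_xi : ∃ C : ℝ, 0 < C ∧ ∀ (s : ℂ) (X : ℝ), 1 / 2 ≤ s.re → ‖s‖ + 3 ≤ X →
    ‖xi s‖ ≤ C * X ^ 2 * Real.exp (2 * X ^ (3 / 2 : ℝ)) := by
  obtain ⟨C₀, hC₀⟩ := exists_bound_completedZeta₀
  refine ⟨2 + |C₀|, by positivity, fun s X hs hX => ?_⟩
  have hX3 : 3 ≤ X := by linarith [norm_nonneg s]
  have hexp1 : 1 ≤ Real.exp (2 * X ^ (3 / 2 : ℝ)) := Real.one_le_exp (by positivity)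
  have hn : ‖s * (s - 1)‖ ≤ X ^ 2 := by
    rw [norm_mul]
    have : ‖s - 1‖ ≤ ‖s‖ + 1 := by simpa using norm_sub_le s 1
    nlinarith [norm_nonneg s, norm_nonneg (s - 1)]
  rcases le_total s.re 2 with h | h
  · have hz := hC₀ s (by linarith) h
    have h1 : ‖xi s‖ ≤ 1 + X ^ 2 * |C₀| := by
      rw [xi]
      refine (norm_add_le _ _).trans ?_
      rw [norm_one, norm_mul]
      gcongr
      exact hz.trans (le_abs_self _)
    refine h1.trans ?_
    have : 1 + X ^ 2 * |C₀| ≤ (2 + |C₀|) * X ^ 2 := by nlinarith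
    exact this.trans (le_mul_of_one_le_right (by positivity) hexp1)
  · have h0 : s ≠ 0 := by rintro rfl; simp at h; linarith
    have h1 : s ≠ 1 := by rintro rfl; norm_num at h
    have hg : Gammaℝ s ≠ 0 := Gammaℝ_ne_zero_of_re_pos (by linarith)
    have hL : completedRiemannZeta s = Gammaℝ s * riemannZeta s := by
      rw [riemannZeta_def_of_ne_zero h0]
      field_simp
    rw [xi_eq h0 h1, hL, norm_mul, norm_mul (Gammaℝ s)]
    have hG : ‖Gammaℝ s‖ ≤ Real.exp (2 * X ^ (3 / 2 : ℝ)) := by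
      rw [Gammaℝ_def, norm_mul, Complex.norm_cpow_eq_rpow_re_of_pos Real.pi_pos]
      have hre : (s / 2).re = s.re / 2 := by simp
      have h2 := norm_Gamma_le (s := s / 2) (by rw [hre]; linarith)
      rw [hre] at h2
      have h3 := Gamma_le_exp (x := s.re / 2) (X := X) (by linarith)
        (by have := Complex.re_le_norm s; linarith)
      have h4 : Real.pi ^ (-s / 2).re ≤ 1 := by
        apply Real.rpow_le_one_of_one_le_of_nonpos
        · linarith [Real.pi_gt_three]
        · simp; linarith
      calc _ ≤ 1 * Real.exp (2 * X ^ (3 / 2 : ℝ)) := by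
            gcongr
            exact h2.trans h3
        _ = _ := one_mul _
    have hz := norm_zeta_le_zeta_two h
    calc _ ≤ X ^ 2 * (Real.exp (2 * X ^ (3 / 2 : ℝ)) * 2) := by gcongr
      _ ≤ _ := by
        have : 0 ≤ X ^ 2 * Real.exp (2 * X ^ (3 / 2 : ℝ)) := by positivity
        nlinarith [abs_nonneg C₀]

lemma xiQ_growth : ∀ ε > 0, ∀ᶠ R : ℝ in atTop, ∀ z, ‖z‖ ≤ R → ‖xiQ z‖ ≤ Real.exp (ε * R) := by
  intro ε hε
  obtain ⟨C, hC, hb⟩ := exists_bound_xi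
  -- `C X² exp (2 X^{3/2}) ≤ exp ((ε/16) X²)` for large `X`
  have key : ∀ᶠ X : ℝ in atTop, C * X ^ 2 * Real.exp (2 * X ^ (3 / 2 : ℝ)) ≤
      Real.exp (ε / 36 * X ^ 2) := by
    have h1 : ∀ᶠ X : ℝ in atTop, C * X ^ 2 ≤ Real.exp (1 * X) := by
      have := (isLittleO_pow_exp_pos_mul_atTop (b := 1) 2 one_pos).bound (inv_pos.2 hC)
      filter_upwards [this] with X hX
      rw [Real.norm_of_nonneg (by positivity), Real.norm_of_nonneg (by positivity)] at hX
      rwa [← le_inv_mul_iff₀ hC]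
    have h2 : Tendsto (fun X : ℝ => X ^ (1 / 2 : ℝ)) atTop atTop :=
      tendsto_rpow_atTop (by norm_num)
    filter_upwards [h1, h2.eventually_ge_atTop (144 / ε), eventually_ge_atTop 1,
      eventually_ge_atTop (72 / ε)] with X hX hX2 hX1 hX3
    have hX0 : 0 < X := by linarith
    refine (mul_le_mul_of_nonneg_right hX (Real.exp_pos _).le).trans ?_
    rw [← Real.exp_add]
    refine Real.exp_le_exp.2 ?_
    have h4 : X ^ (3 / 2 : ℝ) * X ^ (1 / 2 : ℝ) = X ^ 2 := by
      rw [← Real.rpow_add hX0]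
      norm_num
    have h5 : 0 ≤ X ^ (3 / 2 : ℝ) := by positivity
    rw [div_le_iff₀ hε] at hX2 hX3
    have h6 : 144 * X ^ (3 / 2 : ℝ) ≤ ε * X ^ 2 := by
      rw [← h4]; nlinarith
    nlinarith
  have hX : Tendsto (fun R : ℝ => 6 * R ^ (1 / 2 : ℝ)) atTop atTop :=
    (tendsto_rpow_atTop (by norm_num)).const_mul_atTop (by norm_num)
  filter_upwards [hX.eventually key, eventually_ge_atTop 1] with R hR hR1 z hz
  have hR0 : 0 ≤ R := by linarith
  have hsq : (R ^ (1 / 2 : ℝ)) ^ 2 = R := by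
    rw [← Real.rpow_natCast, ← Real.rpow_mul hR0]; norm_num
  have hr1 : 1 ≤ R ^ (1 / 2 : ℝ) := Real.one_le_rpow hR1 (by norm_num)
  have hn : ‖rootOf z‖ + 3 ≤ 6 * R ^ (1 / 2 : ℝ) := by
    have h1 : ‖(z + 1 / 4) ^ (1 / 2 : ℂ)‖ ^ 2 ≤ R + 1 / 4 := by
      rw [← norm_pow, sqrt_sq_eq]
      refine (norm_add_le _ _).trans ?_
      norm_num
      linarith
    have h2 : ‖(z + 1 / 4) ^ (1 / 2 : ℂ)‖ ≤ R ^ (1 / 2 : ℝ) + 1 / 2 := by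
      apply le_of_sq_le_sq _ (by positivity)
      nlinarith
    have h3 : ‖rootOf z‖ ≤ 1 / 2 + ‖(z + 1 / 4) ^ (1 / 2 : ℂ)‖ := by
      rw [rootOf]
      refine (norm_add_le _ _).trans ?_
      norm_num
    linarith
  refine (hb _ _ (half_le_re_rootOf z) hn).trans (hR.trans (Real.exp_le_exp.2 ?_))
  rw [mul_pow, hsq]
  linarith

/-! ### Zeros -/

/-- A zero of `xiQ` gives a zero of zeta to the right of the critical line. -/
lemma zeta_rootOf_eq_zero {v : ℂ} (hv : xiQ v = 0) : riemannZeta (rootOf v) = 0 := by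
  have hv0 : v ≠ 0 := by rintro rfl; simp [xiQ_zero] at hv
  have h0 : rootOf v ≠ 0 := fun h => hv0 (by rw [← rootOf_mul v, h, zero_mul])
  have h1 : rootOf v ≠ 1 := fun h => hv0 (by rw [← rootOf_mul v, h, sub_self, mul_zero])
  rw [xiQ_eq_xi_rootOf, xi_eq h0 h1] at hv
  rw [riemannZeta_def_of_ne_zero h0]
  rcases mul_eq_zero.1 hv with h | h
  · exact absurd h (mul_ne_zero h0 (sub_ne_zero.2 h1))
  · rw [h, zero_div]

lemma re_rootOf_lt_one {v : ℂ} (hv : xiQ v = 0) : (rootOf v).re < 1 := by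
  by_contra! h
  exact riemannZeta_ne_zero_of_one_le_re h (zeta_rootOf_eq_zero hv)

end TotientBound

namespace TotientBound

open Complex Metric Set Filter Topology

/-- Multiplicity of `v` as a zero of `xiQ`. -/
noncomputable def mult (v : ℂ) : ℕ := analyticOrderNatAt xiQ v

lemma xiQ_zero_ne : xiQ 0 ≠ 0 := by simp [xiQ_zero]

lemma mult_eq_zero_iff (v : ℂ) : mult v = 0 ↔ xiQ v ≠ 0 :=
  analyticOrderNatAt_eq_zero_iff differentiable_xiQ xiQ_zero_ne v

lemma re_rootOf_formula (v : ℂ) :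
    v.re = (rootOf v).re ^ 2 - (rootOf v).im ^ 2 - (rootOf v).re := by
  have := congrArg Complex.re (rootOf_mul v)
  simp at this
  rw [← this]; ring

lemma im_rootOf_formula (v : ℂ) : v.im = (rootOf v).im * (2 * (rootOf v).re - 1) := by
  have := congrArg Complex.im (rootOf_mul v)
  simp at this
  rw [← this]; ring

lemma neg_re_pos {v : ℂ} (hv : xiQ v = 0) : 0 < -v.re := by
  have h1 := half_le_re_rootOf v
  have h2 := re_rootOf_lt_one hv
  rw [re_rootOf_formula v]
  nlinarith [sq_nonneg (rootOf v).im]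

lemma im_sq_le {v : ℂ} (hv : xiQ v = 0) : v.im ^ 2 ≤ -v.re := by
  have h1 := half_le_re_rootOf v
  have h2 := re_rootOf_lt_one hv
  rw [re_rootOf_formula v, im_rootOf_formula v]
  have h3 : (2 * (rootOf v).re - 1) ^ 2 ≤ 1 := by nlinarith
  have := mul_le_mul_of_nonneg_left h3 (sq_nonneg (rootOf v).im)
  nlinarith

lemma norm_sq_le {v : ℂ} (hv : xiQ v = 0) : ‖v‖ ^ 2 ≤ (-v.re) ^ 2 + -v.re := by
  rw [← Complex.normSq_eq_norm_sq, Complex.normSq_apply]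
  nlinarith [im_sq_le hv]

lemma ne_zero_of_zero {v : ℂ} (hv : xiQ v = 0) : v ≠ 0 := by
  rintro rfl
  exact xiQ_zero_ne hv

lemma exists_sector : ∃ C : ℝ, ∀ u, xiQ u = 0 → ‖u‖ ≤ C * -u.re := by
  have hc : ∀ᶠ u in 𝓝 (0 : ℂ), xiQ u ≠ 0 :=
    differentiable_xiQ.continuous.continuousAt.eventually_ne xiQ_zero_ne
  obtain ⟨δ, hδ, hball⟩ := Metric.eventually_nhds_iff.1 hc
  set d := min δ 1 with hd
  have hd0 : 0 < d := by positivity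
  have hd1 : d ≤ 1 := min_le_right _ _
  refine ⟨1 + 2 / d ^ 2, fun u hu => ?_⟩
  have h1 : d ≤ ‖u‖ := by
    by_contra! h
    exact hball (by rw [dist_zero_right]; exact h.trans_le (min_le_left _ _)) hu
  have h2 := norm_sq_le hu
  have h3 := neg_re_pos hu
  have h4 : d ^ 2 / 2 ≤ -u.re := by
    by_contra! h
    have e1 : d ^ 2 ≤ ‖u‖ ^ 2 := by gcongr
    have e2 : d ^ 2 ≤ 1 := by nlinarith
    nlinarith
  have h5 : 1 ≤ 2 / d ^ 2 * -u.re := by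
    rw [div_mul_eq_mul_div, one_le_div (by positivity)]
    linarith
  refine le_of_sq_le_sq ?_ (by positivity)
  nlinarith [mul_nonneg (show 0 ≤ 2 / d ^ 2 by positivity) h3.le]

lemma summable_mult_div_norm : Summable fun v : ℂ => (mult v : ℝ) / ‖v‖ := by
  obtain ⟨C, hC⟩ := exists_sector
  exact summable_zeros differentiable_xiQ xiQ_zero xiQ_growth hC

lemma hasSum_mult {z : ℂ} (hz : xiQ z ≠ 0) :
    HasSum (fun v : ℂ => (mult v : ℂ) / (z - v)) (logDeriv xiQ z) := by
  obtain ⟨C, hC⟩ := exists_sector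
  exact hasSum_zeros differentiable_xiQ xiQ_zero xiQ_growth hC hz

/-- The logarithmic derivative of `ξ`. -/
noncomputable def Zsum (s : ℂ) : ℂ := ∑' v : ℂ, (mult v : ℂ) * ((2 * s - 1) / (s * (s - 1) - v))

lemma xi_ne_zero {s : ℂ} (hs : 1 < s.re) : xi s ≠ 0 := by
  have h0 : s ≠ 0 := by rintro rfl; norm_num at hs
  have h1 : s ≠ 1 := by rintro rfl; norm_num at hs
  have h2 : completedRiemannZeta s ≠ 0 := by
    intro h
    have := riemannZeta_ne_zero_of_one_lt_re hs
    rw [riemannZeta_def_of_ne_zero h0, h, zero_div] at this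
    exact this rfl
  rw [xi_eq h0 h1]
  exact mul_ne_zero (mul_ne_zero h0 (sub_ne_zero.2 h1)) h2

lemma logDeriv_xi (s : ℂ) : logDeriv xi s = logDeriv xiQ (s * (s - 1)) * (2 * s - 1) := by
  have h : xi = xiQ ∘ fun s => s * (s - 1) := funext fun s => (xiQ_mul_sub_one s).symm
  conv_lhs => rw [h]
  rw [logDeriv_comp (differentiable_xiQ _) (by fun_prop)]
  congr 1
  have : HasDerivAt (fun s : ℂ => s * (s - 1)) (1 * (s - 1) + s * 1) s :=
    (hasDerivAt_id s).mul ((hasDerivAt_id s).sub_const 1)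
  rw [this.deriv]
  ring

lemma hasSum_Zsum {s : ℂ} (hs : xi s ≠ 0) :
    HasSum (fun v : ℂ => (mult v : ℂ) * ((2 * s - 1) / (s * (s - 1) - v))) (logDeriv xi s) := by
  rw [logDeriv_xi]
  refine ((hasSum_mult (z := s * (s - 1)) (by rwa [xiQ_mul_sub_one])).mul_right
    (2 * s - 1)).congr fun _ => Finset.sum_congr rfl fun v _ => ?_
  ring

lemma Zsum_eq {s : ℂ} (hs : xi s ≠ 0) : Zsum s = logDeriv xi s := (hasSum_Zsum hs).tsum_eq

lemma logDeriv_Gammaℝ {s : ℂ} (hs : 0 < s.re) :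
    logDeriv Gammaℝ s = -(Real.log Real.pi : ℂ) / 2 + digamma (s / 2) / 2 := by
  have hpi : (Real.pi : ℂ) ≠ 0 := by exact_mod_cast Real.pi_ne_zero
  have hne : ∀ m : ℕ, s / 2 ≠ -m := by
    intro m h
    have := congrArg Complex.re h
    simp at this
    have hm : (0 : ℝ) ≤ m := by positivity
    linarith
  have h1 : HasDerivAt (fun s : ℂ => (Real.pi : ℂ) ^ (-s / 2))
      ((Real.pi : ℂ) ^ (-s / 2) * Complex.log Real.pi * (-1 / 2)) s :=
    ((hasDerivAt_id s).neg.div_const 2).const_cpow (Or.inl hpi)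
  have h2 : HasDerivAt (fun s : ℂ => Complex.Gamma (s / 2)) (deriv Gamma (s / 2) * (1 / 2)) s :=
    HasDerivAt.comp s (differentiableAt_Gamma _ hne).hasDerivAt ((hasDerivAt_id s).div_const 2)
  have hcp : (Real.pi : ℂ) ^ (-s / 2) ≠ 0 := by simp [Complex.cpow_eq_zero_iff, hpi]
  have hG : Gamma (s / 2) ≠ 0 := Gamma_ne_zero hne
  have hfun : Gammaℝ = fun s : ℂ => (Real.pi : ℂ) ^ (-s / 2) * Complex.Gamma (s / 2) :=
    funext fun s => Gammaℝ_def s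
  rw [hfun, logDeriv_mul (f := fun s : ℂ => (Real.pi : ℂ) ^ (-s / 2))
    (g := fun s : ℂ => Complex.Gamma (s / 2)) s hcp hG h1.differentiableAt h2.differentiableAt,
    logDeriv_apply, logDeriv_apply, h1.deriv, h2.deriv, digamma_def, logDeriv_apply,
    Complex.ofReal_log Real.pi_pos.le]
  field_simp

/-- `ζ'/ζ` in terms of the zeros. -/
theorem logDeriv_zeta_eq {s : ℂ} (hs : 1 < s.re) :
    logDeriv riemannZeta s =
      Zsum s - 1 / (s - 1) + Real.log Real.pi / 2 - digamma (s / 2 + 1) / 2 := by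
  have h0 : s ≠ 0 := by rintro rfl; norm_num at hs
  have h1 : s ≠ 1 := by rintro rfl; norm_num at hs
  have hne : ∀ m : ℕ, s / 2 ≠ -m := by
    intro m h
    have := congrArg Complex.re h
    simp at this
    have hm : (0 : ℝ) ≤ m := by positivity
    linarith
  have hxi : xi =ᶠ[𝓝 s] fun s => (s * (s - 1)) * (Gammaℝ s * riemannZeta s) := by
    have ho : {s : ℂ | 1 < s.re} ∈ 𝓝 s :=
      (isOpen_lt continuous_const Complex.continuous_re).mem_nhds hs
    filter_upwards [ho] with w hw
    have h0 : w ≠ 0 := by rintro rfl; norm_num at hw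
    have h1 : w ≠ 1 := by rintro rfl; norm_num at hw
    rw [xi_eq h0 h1, riemannZeta_def_of_ne_zero h0,
      mul_div_cancel₀ _ (Gammaℝ_ne_zero_of_re_pos (by linarith))]
  have hG : Gammaℝ s ≠ 0 := Gammaℝ_ne_zero_of_re_pos (by linarith)
  have hz := riemannZeta_ne_zero_of_one_lt_re hs
  have hGd : DifferentiableAt ℂ Gammaℝ s := by
    have := (differentiable_Gammaℝ_inv s).inv (inv_ne_zero hG)
    rwa [show (fun s => (Gammaℝ s)⁻¹)⁻¹ = Gammaℝ by ext; simp] at this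
  have hzd := differentiableAt_riemannZeta h1
  have hp : HasDerivAt (fun s : ℂ => s * (s - 1)) (1 * (s - 1) + s * 1) s :=
    (hasDerivAt_id s).mul ((hasDerivAt_id s).sub_const 1)
  rw [Zsum_eq (xi_ne_zero hs), (logDeriv_congr_nhds hxi).eq_of_nhds,
    logDeriv_mul (f := fun s : ℂ => s * (s - 1)) (g := fun s => Gammaℝ s * riemannZeta s) s
      (mul_ne_zero h0 (sub_ne_zero.2 h1)) (mul_ne_zero hG hz) hp.differentiableAt
      (hGd.mul hzd), logDeriv_mul s hG hz hGd hzd, logDeriv_Gammaℝ (by linarith),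
    digamma_apply_add_one _ hne, logDeriv_apply (fun s : ℂ => s * (s - 1)), hp.deriv]
  have : s - 1 ≠ 0 := sub_ne_zero.2 h1
  field_simp
  ring

/-- The value at zero of the partial fraction expansion. -/
theorem hasSum_mult_div :
    HasSum (fun v : ℂ => (mult v : ℝ) * (-v.re / ‖v‖ ^ 2))
      ((Real.eulerMascheroniConstant - Real.log (4 * Real.pi)) / 2 + 1) := by
  have h := Complex.hasSum_re (hasSum_mult xiQ_zero_ne)
  have hval : logDeriv xiQ 0 = completedRiemannZeta₀ 1 := by
    have h1 := logDeriv_xi 1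
    have h2 : HasDerivAt xi (completedRiemannZeta₀ 1) 1 := by
      have hd := (differentiable_completedZeta₀ 1).hasDerivAt
      have hp : HasDerivAt (fun s : ℂ => s * (s - 1)) (1 * ((1 : ℂ) - 1) + 1 * 1) 1 :=
        (hasDerivAt_id (1 : ℂ)).mul ((hasDerivAt_id (1 : ℂ)).sub_const 1)
      refine ((hp.mul hd).const_add 1).congr_deriv ?_
      simp
    have h3 : xi 1 = 1 := by simp [xi]
    rw [logDeriv_apply, h2.deriv, h3] at h1
    norm_num at h1
    exact h1.symm
  rw [hval, completedRiemannZeta₀_one] at h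
  have hre : (((Real.eulerMascheroniConstant : ℂ) - Complex.log (4 * Real.pi)) / 2 + 1).re =
      (Real.eulerMascheroniConstant - Real.log (4 * Real.pi)) / 2 + 1 := by
    rw [show (4 * Real.pi : ℂ) = ((4 * Real.pi : ℝ) : ℂ) by push_cast; rfl,
      ← Complex.ofReal_log (by positivity)]
    norm_cast
  rw [hre] at h
  convert h using 2 with v
  rw [zero_sub, div_eq_mul_inv (mult v : ℂ), div_eq_mul_inv, ← Complex.ofReal_natCast, Complex.re_ofReal_mul,
    Complex.inv_re, Complex.normSq_neg, Complex.normSq_eq_norm_sq, Complex.neg_re,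
    div_eq_mul_inv]

end TotientBound

namespace TotientBound

open Complex Metric Set Filter Topology

lemma ne_neg_nat_of_re_pos {z : ℂ} (hz : 0 < z.re) (m : ℕ) : z ≠ -m := by
  intro h
  have := congrArg Complex.re h
  simp at this
  have hm : (0 : ℝ) ≤ m := by positivity
  linarith

lemma deriv_log_Gamma_add_one {x : ℝ} (hx : 0 < x) :
    deriv (Real.log ∘ Real.Gamma) (x + 1) = deriv (Real.log ∘ Real.Gamma) x + 1 / x := by
  have hd : ∀ {x : ℝ}, 0 < x → DifferentiableAt ℝ (Real.log ∘ Real.Gamma) x := fun {x} hx =>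
    (Real.differentiableAt_Gamma fun m => by
      have : (0 : ℝ) ≤ m := by positivity
      linarith).log (Real.Gamma_pos_of_pos hx).ne'
  have h : (fun t => (Real.log ∘ Real.Gamma) (t + 1)) =ᶠ[𝓝 x]
      fun t => (Real.log ∘ Real.Gamma) t + Real.log t := by
    filter_upwards [lt_mem_nhds hx] with t ht
    simp only [Function.comp_apply]
    rw [Real.Gamma_add_one ht.ne', Real.log_mul ht.ne' (Real.Gamma_pos_of_pos ht).ne', add_comm]
  have h2 := h.deriv_eq
  rw [deriv_comp_add_const] at h2
  rw [h2]
  have := (hd hx).hasDerivAt.add (Real.hasDerivAt_log hx.ne')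
  rw [one_div, ← this.deriv]
  rfl

lemma digamma_ofReal {x : ℝ} (hx : 0 < x) :
    digamma x = (deriv (Real.log ∘ Real.Gamma) x : ℝ) := by
  have hne : ∀ m : ℕ, x ≠ -m := fun m => by
    have : (0 : ℝ) ≤ m := by positivity
    linarith
  have h1 : HasDerivAt Real.Gamma (deriv Complex.Gamma x).re x := by
    have :=
      (differentiableAt_Gamma (x : ℂ) (ne_neg_nat_of_re_pos (by simpa))).hasDerivAt.real_of_complex
    simpa [Complex.Gamma_ofReal] using this
  have h3 : (deriv Complex.Gamma x).im = 0 := by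
    have h :=
      (differentiableAt_Gamma (x : ℂ) (ne_neg_nat_of_re_pos (by simpa))).hasDerivAt.comp_ofReal
    have h' : HasDerivAt (fun y : ℝ => ((Real.Gamma y : ℝ) : ℂ)) ((deriv Real.Gamma x : ℝ) : ℂ) x :=
      (Real.differentiableAt_Gamma hne).hasDerivAt.ofReal_comp
    simp only [Complex.Gamma_ofReal] at h
    rw [h.unique h']
    simp
  have h4 : ((deriv Complex.Gamma x).re : ℂ) = deriv Complex.Gamma x := by
    apply Complex.ext <;> simp [h3]
  have h5 := h1.log (Real.Gamma_pos_of_pos hx).ne'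
  have h6 : deriv (Real.log ∘ Real.Gamma) x = (deriv Complex.Gamma x).re / Real.Gamma x := h5.deriv
  rw [h6, digamma_def, logDeriv_apply, Complex.Gamma_ofReal]
  push_cast
  rw [h4]

/-- The summand of the digamma series. -/
noncomputable def digammaTerm (n : ℕ) (z : ℂ) : ℂ := 1 / (n + 1) - 1 / (n + z)

lemma norm_natCast_add_ge {z : ℂ} (hz : 1 < z.re) (n : ℕ) : (n : ℝ) + 1 ≤ ‖(n : ℂ) + z‖ := by
  refine le_trans ?_ (Complex.re_le_norm _)
  simp
  exact hz.le

lemma norm_digammaTerm_le {z : ℂ} (hz : 1 < z.re) (n : ℕ) :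
    ‖digammaTerm n z‖ ≤ ‖z - 1‖ * (1 / ((n : ℝ) + 1) ^ 2) := by
  have h1 := norm_natCast_add_ge hz n
  have hn : (0 : ℝ) < n + 1 := by positivity
  have h2 : (n : ℂ) + z ≠ 0 := norm_pos_iff.1 (hn.trans_le h1)
  have h3 : (n : ℂ) + 1 ≠ 0 := Nat.cast_add_one_ne_zero n
  have h4 : digammaTerm n z = (z - 1) / ((n + 1) * (n + z)) := by
    rw [digammaTerm]; field_simp; ring
  have h5 : ‖(n : ℂ) + 1‖ = n + 1 := by
    rw [← Nat.cast_add_one, Complex.norm_natCast]; push_cast; rfl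
  rw [h4, norm_div, norm_mul, h5, mul_one_div, sq]
  gcongr

lemma summable_one_div_sq_succ : Summable fun n : ℕ => 1 / ((n : ℝ) + 1) ^ 2 := by
  have := (summable_nat_add_iff 1).2 (Real.summable_one_div_nat_pow.2 (one_lt_two))
  simpa using this

lemma summable_digammaTerm {z : ℂ} (hz : 1 < z.re) : Summable fun n => digammaTerm n z :=
  .of_norm_bounded (summable_one_div_sq_succ.mul_left _) fun n => norm_digammaTerm_le hz n

lemma sum_digammaTerm (z : ℂ) (N : ℕ) :
    ∑ n ∈ Finset.range N, digammaTerm n z =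
      (harmonic N : ℂ) - ∑ n ∈ Finset.range N, 1 / ((n : ℂ) + z) := by
  simp only [digammaTerm, Finset.sum_sub_distrib, harmonic]
  push_cast
  simp [one_div]

/-- The digamma series on the real axis. -/
lemma tsum_digammaTerm_ofReal {x : ℝ} (hx : 1 < x) :
    ∑' n, digammaTerm n x = digamma x + Real.eulerMascheroniConstant := by
  set f := Real.log ∘ Real.Gamma with hf
  have hd : ∀ {x : ℝ}, 0 < x → DifferentiableAt ℝ f x := fun {x} hx =>
    (Real.differentiableAt_Gamma fun m => by
      have : (0 : ℝ) ≤ m := by positivity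
      linarith).log (Real.Gamma_pos_of_pos hx).ne'
  have hx0 : 0 < x := by linarith
  have hmono : MonotoneOn (deriv f) (Ioi 0) :=
    Real.convexOn_log_Gamma.monotoneOn_deriv fun y hy => hd hy
  have hrec : ∀ N : ℕ, deriv f (x + N) = deriv f x + ∑ n ∈ Finset.range N, 1 / (n + x) := by
    intro N
    induction N with
    | zero => simp
    | succ N ih =>
      rw [Finset.sum_range_succ, ← add_assoc, ← ih, Nat.cast_succ, ← add_assoc,
        deriv_log_Gamma_add_one (by positivity), add_comm x]
  have hnat : ∀ N : ℕ, deriv f (N + 1) = -Real.eulerMascheroniConstant + harmonic N := by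
    intro N
    have : deriv f (N + 1) = deriv Real.Gamma (N + 1) / Real.Gamma (N + 1) :=
      ((Real.differentiableAt_Gamma fun m => by
        have : (0 : ℝ) ≤ m := by positivity
        have : (0 : ℝ) ≤ N := by positivity
        linarith).hasDerivAt.log (Real.Gamma_pos_of_pos (by positivity)).ne').deriv
    rw [this, Real.deriv_Gamma_nat, Real.Gamma_nat_eq_factorial]
    field_simp
  obtain ⟨K, hK⟩ := exists_nat_ge x
  have hlim : Tendsto (fun N : ℕ => deriv f (x + N) - deriv f ((N : ℝ) + 1)) atTop (𝓝 0) := by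
    have hup : ∀ N : ℕ, deriv f (x + N) - deriv f ((N : ℝ) + 1) ≤ K * (1 / ((N : ℝ) + 1)) := by
      intro N
      have h1 : deriv f (x + N) ≤ deriv f ((N + K : ℕ) + 1 : ℝ) := by
        apply hmono
        · exact (by positivity : (0 : ℝ) < x + N)
        · exact (by positivity : (0 : ℝ) < (N + K : ℕ) + 1)
        · push_cast; linarith
      rw [hnat] at h1 ⊢
      have h2 : ∀ K : ℕ, (harmonic (N + K) : ℝ) ≤ harmonic N + K * (1 / ((N : ℝ) + 1)) := by
        intro K
        induction K with
        | zero => simp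
        | succ K ih =>
          rw [← add_assoc, harmonic_succ]
          push_cast
          have : ((N : ℝ) + K + 1)⁻¹ ≤ 1 / ((N : ℝ) + 1) := by
            rw [one_div]
            apply inv_anti₀ (by positivity)
            have : (0 : ℝ) ≤ K := by positivity
            linarith
          linarith
      linarith [h2 K]
    refine squeeze_zero (fun N => ?_) hup ?_
    · rw [sub_nonneg]
      apply hmono
      · exact (by positivity : (0 : ℝ) < N + 1)
      · exact (by positivity : (0 : ℝ) < x + N)
      · linarith
    · simpa using (tendsto_one_div_add_atTop_nhds_zero_nat (𝕜 := ℝ)).const_mul (K : ℝ)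
  have h1 := (summable_digammaTerm (z := x) (by simpa)).hasSum.tendsto_sum_nat
  refine tendsto_nhds_unique h1 ?_
  have h2 : (fun N => ∑ n ∈ Finset.range N, digammaTerm n x) = fun N : ℕ =>
      (digamma x + Real.eulerMascheroniConstant) -
        ((deriv f (x + N) - deriv f ((N : ℝ) + 1) : ℝ) : ℂ) := by
    ext N
    rw [sum_digammaTerm, digamma_ofReal hx0, hrec, hnat]
    push_cast
    ring
  rw [h2]
  have := ((Complex.continuous_ofReal.tendsto 0).comp hlim).const_sub
    (digamma x + Real.eulerMascheroniConstant)
  simpa using this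

/-- The digamma series. -/
theorem hasSum_digamma {z : ℂ} (hz : 1 < z.re) :
    HasSum (fun n => digammaTerm n z) (digamma z + Real.eulerMascheroniConstant) := by
  rw [(summable_digammaTerm hz).hasSum_iff, eq_comm]
  set R := ‖z‖ + 3
  set U : Set ℂ := {w | 1 < w.re} ∩ ball 0 R with hU
  have hUo : IsOpen U := (isOpen_lt continuous_const Complex.continuous_re).inter isOpen_ball
  have hUc : IsPreconnected U :=
    ((convex_halfSpace_re_gt 1).inter (convex_ball _ _)).isPreconnected
  have hS : DifferentiableOn ℂ (fun w => ∑' n, digammaTerm n w) U := by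
    refine differentiableOn_tsum_of_summable_norm
      (summable_one_div_sq_succ.mul_left (R + 1)) (fun n w hw => ?_) hUo fun n w hw => ?_
    · have h1 := norm_natCast_add_ge hw.1 n
      have hn : (0 : ℝ) < n + 1 := by positivity
      have h2 : (n : ℂ) + w ≠ 0 := norm_pos_iff.1 (hn.trans_le h1)
      unfold digammaTerm
      exact (by fun_prop (disch := assumption) :
        DifferentiableAt ℂ (fun w : ℂ => 1 / ((n : ℂ) + 1) - 1 / (n + w)) w).differentiableWithinAt
    · refine (norm_digammaTerm_le hw.1 n).trans ?_
      gcongr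
      have := hw.2
      rw [mem_ball_zero_iff] at this
      have h := norm_sub_le w 1
      rw [norm_one] at h
      linarith
  have hD : DifferentiableOn ℂ (fun w => digamma w + Real.eulerMascheroniConstant) U := by
    have hG : DifferentiableOn ℂ Gamma U := fun w hw =>
      (differentiableAt_Gamma w (ne_neg_nat_of_re_pos
        (zero_lt_one.trans hw.1))).differentiableWithinAt
    have : digamma = fun w => deriv Gamma w / Gamma w := by
      ext w; rw [digamma_def, logDeriv_apply]
    rw [this]
    exact ((hG.deriv hUo).div hG fun w hw =>
      Gamma_ne_zero (ne_neg_nat_of_re_pos (zero_lt_one.trans hw.1))).add_const _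
  have h2U : (2 : ℂ) ∈ U := by
    refine ⟨by norm_num, ?_⟩
    rw [mem_ball_zero_iff]
    have : (0 : ℝ) ≤ ‖z‖ := norm_nonneg z
    simp [R]
    linarith
  have hfreq : ∃ᶠ w in 𝓝[≠] (2 : ℂ), digamma w + Real.eulerMascheroniConstant =
      ∑' n, digammaTerm n w := by
    have ht : Tendsto (fun n : ℕ => ((2 + 1 / ((n : ℝ) + 1) : ℝ) : ℂ)) atTop (𝓝[≠] 2) := by
      refine tendsto_nhdsWithin_iff.2 ⟨?_, Eventually.of_forall fun n => ?_⟩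
      · have := (Complex.continuous_ofReal.tendsto _).comp
          ((tendsto_one_div_add_atTop_nhds_zero_nat (𝕜 := ℝ)).const_add 2)
        simpa [Function.comp_def] using this
      · rw [mem_compl_singleton_iff]
        have : ((2 : ℝ) + 1 / ((n : ℝ) + 1)) ≠ 2 := by
          have : (0 : ℝ) < 1 / ((n : ℝ) + 1) := by positivity
          linarith
        exact_mod_cast this
    refine ht.frequently (Frequently.of_forall fun n => ?_)
    have : (0 : ℝ) < 1 / ((n : ℝ) + 1) := by positivity
    exact (tsum_digammaTerm_ofReal (by linarith)).symm
  have hzU : z ∈ U := ⟨hz, by rw [mem_ball_zero_iff]; simp [R]⟩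
  exact (hD.analyticOnNhd hUo).eqOn_of_preconnected_of_frequently_eq (hS.analyticOnNhd hUo)
    hUc h2U hfreq hzU

lemma re_digamma_ofReal_le {x y : ℝ} (hx : 0 < x) (hxy : x ≤ y) :
    (digamma x).re ≤ (digamma y).re := by
  rw [digamma_ofReal hx, digamma_ofReal (hx.trans_le hxy), ofReal_re, ofReal_re]
  refine Real.convexOn_log_Gamma.monotoneOn_deriv (fun y hy => ?_) hx (hx.trans_le hxy) hxy
  exact (Real.differentiableAt_Gamma fun m => by
      have : (0 : ℝ) ≤ m := by positivity
      have : 0 < y := hy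
      linarith).log (Real.Gamma_pos_of_pos hy).ne'

lemma re_digamma_ofReal_le_log {x : ℝ} (hx : 0 < x) : (digamma x).re ≤ Real.log x := by
  rw [digamma_ofReal hx, ofReal_re]
  have hd : DifferentiableAt ℝ (Real.log ∘ Real.Gamma) x :=
    (Real.differentiableAt_Gamma fun m => by
      have : (0 : ℝ) ≤ m := by positivity
      linarith).log (Real.Gamma_pos_of_pos hx).ne'
  have hx1 : 0 < x + 1 := by positivity
  have := Real.convexOn_log_Gamma.deriv_le_slope hx hx1 (by linarith) hd
  rwa [slope_def_field, add_sub_cancel_left, div_one, Function.comp_apply, Function.comp_apply,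
    Real.Gamma_add_one hx.ne', Real.log_mul hx.ne' (Real.Gamma_pos_of_pos hx).ne',
    add_sub_cancel_right] at this

lemma digamma_two : digamma 2 = 1 - Real.eulerMascheroniConstant := by
  have := digamma_apply_add_one 1 (ne_neg_nat_of_re_pos (by simp))
  rw [digamma_one] at this
  norm_num at this
  rw [this]; ring

/-- An upper bound for the real part of the digamma function. -/
theorem re_digamma_le {z : ℂ} (hz : 1 < z.re) :
    (digamma z).re ≤ Real.log (z.re ^ 2 + z.im ^ 2) / 2 + 1 / (z.re + |z.im| - 1 / 2) := by
  rw [← sq_abs z.im]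
  set x := z.re with hx
  set y := |z.im| with hy
  have hi : 0 ≤ y := abs_nonneg _
  have hterm : ∀ n : ℕ, (1 / ((n : ℂ) + z)).re = (n + x) / ((n + x) ^ 2 + y ^ 2) := by
    intro n
    rw [one_div, inv_re, normSq_apply]
    rw [hy, sq_abs]
    simp [x]
    ring_nf
  have h1 : Tendsto (fun N : ℕ => (harmonic N : ℝ) -
      ∑ n ∈ Finset.range N, (n + x) / ((n + x) ^ 2 + y ^ 2)) atTop
      (𝓝 ((digamma z).re + Real.eulerMascheroniConstant)) := by
    have := (Complex.continuous_re.tendsto _).comp (hasSum_digamma hz).tendsto_sum_nat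
    convert this using 2 with N
    · simp only [Function.comp_apply, sum_digammaTerm, sub_re, re_sum, hterm]
      norm_cast
    · simp
  have h2 := h1.sub Real.tendsto_harmonic_sub_log
  rw [add_sub_cancel_right] at h2
  have hlogstep : ∀ n : ℕ, Real.log ((n + 1 + x) ^ 2 + y ^ 2) / 2 ≤
      Real.log ((n + x) ^ 2 + y ^ 2) / 2 + (n + x) / ((n + x) ^ 2 + y ^ 2) +
      (1 / (n + x + y - 1 / 2) - 1 / (n + 1 + x + y - 1 / 2)) := by
    intro n
    have hn : (0 : ℝ) ≤ n := by positivity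
    set t := (n : ℝ) + x with ht
    have ht1 : 1 < t := by linarith
    have e1 : (n : ℝ) + 1 + x = t + 1 := by rw [ht]; ring
    have hp : 0 < t ^ 2 + y ^ 2 := by positivity
    have hp' : 0 < (t + 1) ^ 2 + y ^ 2 := by positivity
    have h3 := Real.log_le_sub_one_of_pos (div_pos hp' hp)
    rw [Real.log_div hp'.ne' hp.ne'] at h3
    have h4 : ((t + 1) ^ 2 + y ^ 2) / (t ^ 2 + y ^ 2) - 1 =
        2 * (t / (t ^ 2 + y ^ 2)) + 1 / (t ^ 2 + y ^ 2) := by field_simp; ring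
    have h5 : 1 / (t ^ 2 + y ^ 2) ≤ 2 * (1 / (t + y - 1 / 2) - 1 / (t + 1 + y - 1 / 2)) := by
      have : 1 / (t + y - 1 / 2) - 1 / (t + 1 + y - 1 / 2) = 1 / ((t + y) ^ 2 - 1 / 4) := by
        have : t + y - 1 / 2 ≠ 0 := by linarith
        have : t + 1 + y - 1 / 2 ≠ 0 := by linarith
        rw [show (t + y) ^ 2 - 1 / 4 = (t + y - 1 / 2) * (t + 1 + y - 1 / 2) by ring,
          div_sub_div _ _ ‹_› ‹_›]
        congr 1
        ring
      rw [this, mul_one_div, div_le_div_iff₀ hp (by nlinarith)]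
      nlinarith [sq_nonneg (t - y)]
    rw [e1]
    linarith
  have h3 : ∀ N : ℕ, Real.log ((N + x) ^ 2 + y ^ 2) / 2 ≤ Real.log (x ^ 2 + y ^ 2) / 2 +
      ∑ n ∈ Finset.range N, (n + x) / ((n + x) ^ 2 + y ^ 2) +
      (1 / (x + y - 1 / 2) - 1 / (N + x + y - 1 / 2)) := by
    intro N
    induction N with
    | zero => simp
    | succ N ih =>
      rw [Finset.sum_range_succ]
      push_cast
      linarith [hlogstep N]
  refine le_of_tendsto h2 ?_
  filter_upwards [eventually_ge_atTop 1] with N hN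
  have hN' : (1 : ℝ) ≤ N := by exact_mod_cast hN
  have h4 : Real.log N ≤ Real.log ((N + x) ^ 2 + y ^ 2) / 2 := by
    have : Real.log ((N : ℝ) ^ 2) ≤ Real.log ((N + x) ^ 2 + y ^ 2) :=
      Real.log_le_log (by positivity) (by nlinarith)
    rw [Real.log_pow] at this
    push_cast at this
    linarith
  have h5 : 0 ≤ 1 / (N + x + y - 1 / 2) := one_div_nonneg.2 (by linarith)
  linarith [h3 N]

end TotientBound

namespace TotientBound

open Filter Topology

lemma log_one_add_le_of_nonneg {x : ℝ} (hx : 0 ≤ x) :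
    Real.log (1 + x) ≤ x * (x + 2) / (2 * (x + 1)) := by
  have h : ∀ y ∈ interior (Set.Ici (0 : ℝ)), HasDerivAt
      (fun x : ℝ => x * (x + 2) / (2 * (x + 1)) - Real.log (1 + x))
      (y ^ 2 / (2 * (1 + y) ^ 2)) y := by
    intro y hy
    rw [interior_Ici, Set.mem_Ioi] at hy
    have h1 : HasDerivAt (fun x : ℝ => x * (x + 2) / (2 * (x + 1)))
        (((1 * (y + 2) + y * 1) * (2 * (y + 1)) - y * (y + 2) * (2 * 1)) / (2 * (y + 1)) ^ 2) y :=
      ((hasDerivAt_id y).mul ((hasDerivAt_id y).add_const 2)).div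
        (((hasDerivAt_id y).add_const 1).const_mul 2) (by positivity)
    have h2 : HasDerivAt (fun x : ℝ => Real.log (1 + x)) (1 / (1 + y)) y :=
      ((hasDerivAt_id y).const_add 1).log (by simp; positivity)
    refine (h1.sub h2).congr_deriv ?_
    field_simp
    ring
  have hc : ContinuousOn (fun x : ℝ => x * (x + 2) / (2 * (x + 1)) - Real.log (1 + x))
      (Set.Ici 0) := by
    refine ContinuousOn.sub (ContinuousOn.div (by fun_prop) (by fun_prop) fun y hy => ?_)
      (ContinuousOn.log (by fun_prop) fun y hy => ?_)
    all_goals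
      have : (0 : ℝ) ≤ y := hy
      positivity
  have := monotoneOn_of_deriv_nonneg (convex_Ici 0) hc
    (fun y hy => (h y hy).differentiableAt.differentiableWithinAt)
    (fun y hy => by rw [(h y hy).deriv]; positivity)
  have h0 := this (Set.mem_Ici.2 le_rfl) (Set.mem_Ici.2 hx) hx
  simp at h0
  exact h0

lemma harmonic_forty : (harmonic 40 : ℚ) = 2078178381193813 / 485721041551200 := by
  rw [harmonic]
  simp only [Finset.sum_range_succ, Finset.sum_range_zero]
  norm_num

lemma eulerMascheroni_lt : Real.eulerMascheroniConstant < 0.5773 := by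
  have hanti : Antitone fun n : ℕ => (harmonic n : ℝ) - Real.log (n + 1 / 2) := by
    refine antitone_nat_of_succ_le fun n => ?_
    rw [harmonic_succ]
    push_cast
    have hn : (0 : ℝ) ≤ n := by positivity
    have h := Real.le_log_one_add_of_nonneg (x := 1 / ((n : ℝ) + 1 / 2)) (by positivity)
    rw [show 1 + 1 / ((n : ℝ) + 1 / 2) = (n + 1 + 1 / 2) / (n + 1 / 2) by field_simp; ring,
      Real.log_div (by positivity) (by positivity)] at h
    have e : 2 * (1 / ((n : ℝ) + 1 / 2)) / (1 / ((n : ℝ) + 1 / 2) + 2) = ((n : ℝ) + 1)⁻¹ := by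
      field_simp
      ring
    rw [e] at h
    linarith
  have hlim : Tendsto (fun n : ℕ => (harmonic n : ℝ) - Real.log (n + 1 / 2)) atTop
      (𝓝 Real.eulerMascheroniConstant) := by
    refine tendsto_of_tendsto_of_tendsto_of_le_of_le' Real.tendsto_harmonic_sub_log_add_one
      Real.tendsto_harmonic_sub_log ?_ ?_
    · filter_upwards with n
      have : Real.log ((n : ℝ) + 1 / 2) ≤ Real.log (n + 1) :=
        Real.log_le_log (by positivity) (by linarith)
      linarith
    · filter_upwards [eventually_gt_atTop 0] with n hn
      have hn : (0 : ℝ) < n := by exact_mod_cast hn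
      have : Real.log (n : ℝ) ≤ Real.log (n + 1 / 2) := Real.log_le_log hn (by linarith)
      linarith
  have h := hanti.le_of_tendsto hlim 40
  rw [harmonic_forty, show (((40 : ℕ) : ℝ) + 1 / 2) = 3 ^ 4 / 2 by norm_num,
    Real.log_div (by norm_num) (by norm_num), Real.log_pow] at h
  have h2 := Real.log_two_lt_d9
  have h3 := Real.log_three_gt_d9
  push_cast at h
  norm_num at h h2 h3 ⊢
  linarith

lemma lt_eulerMascheroni : 0.5771 < Real.eulerMascheroniConstant := by
  have hmono : Monotone fun n : ℕ =>
      (harmonic (n + 1) : ℝ) - Real.log ((n : ℝ) + 1) - 1 / (2 * ((n : ℝ) + 1)) := by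
    refine monotone_nat_of_le_succ fun n => ?_
    rw [harmonic_succ (n + 1)]
    push_cast
    have hn : (0 : ℝ) ≤ n := by positivity
    have h := log_one_add_le_of_nonneg (x := 1 / ((n : ℝ) + 1)) (by positivity)
    rw [show 1 + 1 / ((n : ℝ) + 1) = (n + 1 + 1) / (n + 1) by field_simp,
      Real.log_div (by positivity) (by positivity)] at h
    have e : 1 / ((n : ℝ) + 1) * (1 / (n + 1) + 2) / (2 * (1 / (n + 1) + 1)) =
        (1 / (2 * ((n : ℝ) + 1)) + 1 / (2 * (n + 1 + 1))) := by
      field_simp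
      ring
    have e2 : ((n : ℝ) + 1 + 1)⁻¹ = 2 * (1 / (2 * (n + 1 + 1))) := by field_simp
    rw [e] at h
    rw [e2]
    linarith
  have hlim : Tendsto (fun n : ℕ => (harmonic (n + 1) : ℝ) - Real.log ((n : ℝ) + 1) -
      1 / (2 * ((n : ℝ) + 1))) atTop (𝓝 Real.eulerMascheroniConstant) := by
    have h1 := Real.tendsto_harmonic_sub_log.comp (tendsto_add_atTop_nat 1)
    have h2 := (tendsto_one_div_add_atTop_nhds_zero_nat (𝕜 := ℝ)).const_mul (1 / 2)
    have := h1.sub h2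
    rw [mul_zero, sub_zero] at this
    refine this.congr fun n => ?_
    simp only [Function.comp_apply]
    push_cast
    congr 1
    field_simp
  have h := hmono.ge_of_tendsto hlim 39
  rw [harmonic_forty, show (((39 : ℕ) : ℝ) + 1) = 2 ^ 3 * 5 by norm_num,
    Real.log_mul (by norm_num) (by norm_num), Real.log_pow] at h
  have h2 := Real.log_two_lt_d9
  have h3 := Real.log_five_lt_d9
  push_cast at h
  norm_num at h h2 h3 ⊢
  linarith

lemma log_pi_gt : 1.1447 < Real.log Real.pi := by
  have h := Real.le_log_one_add_of_nonneg (x := 3.141592 / 3.125 - 1) (by norm_num)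
  rw [show (1 : ℝ) + (3.141592 / 3.125 - 1) = 3.141592 * 2 ^ 3 / 5 ^ 2 by norm_num,
    Real.log_div (by norm_num) (by norm_num), Real.log_mul (by norm_num) (by norm_num),
    Real.log_pow, Real.log_pow] at h
  have h1 := Real.log_le_log (by norm_num) Real.pi_gt_d6.le
  have h2 := Real.log_two_lt_d9
  have h3 := Real.log_five_gt_d9
  norm_num at h h1 h2 h3 ⊢
  linarith

end TotientBound

namespace TotientBound

open Complex Metric Set Filter Topology

lemma sum_mult_div_const_le :
    (Real.eulerMascheroniConstant - Real.log (4 * Real.pi)) / 2 + 1 ≤ 0.0234 := by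
  rw [Real.log_mul (by norm_num) (by positivity), Real.log_four_eq]
  have h1 := eulerMascheroni_lt
  have h2 := log_pi_gt
  have h3 := Real.log_two_gt_d9
  norm_num at *
  linarith

lemma one_le_mult {v : ℂ} (hv : xiQ v = 0) : 1 ≤ mult v := by
  by_contra! h
  exact (mult_eq_zero_iff v).1 (by omega) hv

lemma one_div_neg_re_add_one_le {v : ℂ} (hv : xiQ v = 0) :
    1 / (-v.re + 1) ≤ -v.re / ‖v‖ ^ 2 := by
  have h1 := neg_re_pos hv
  have h2 := norm_sq_le hv
  have h3 : 0 < ‖v‖ ^ 2 := by have := norm_pos_iff.2 (ne_zero_of_zero hv); positivity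
  rw [div_le_div_iff₀ (by linarith) h3]
  nlinarith

/-- There are no zeros of small height. -/
lemma neg_re_ge {v : ℂ} (hv : xiQ v = 0) : 41 ≤ -v.re := by
  have h1 := neg_re_pos hv
  have h2 : (mult v : ℝ) * (-v.re / ‖v‖ ^ 2) ≤ 0.0234 := by
    refine le_trans (le_hasSum hasSum_mult_div v fun w _ => ?_) sum_mult_div_const_le
    by_cases hw : xiQ w = 0
    · have := neg_re_pos hw
      positivity
    · rw [(mult_eq_zero_iff w).2 hw]; simp
  have h3 : (1 : ℝ) ≤ mult v := by exact_mod_cast one_le_mult hv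
  have h4 : 1 / (-v.re + 1) ≤ 0.0234 := by
    refine (one_div_neg_re_add_one_le hv).trans (le_trans ?_ h2)
    exact le_mul_of_one_le_left (by positivity) h3
  rw [div_le_iff₀ (by linarith)] at h4
  norm_num at h4
  linarith

lemma re_one_div_sub {s ρ : ℂ} : (1 / (s - ρ)).re =
    (s.re - ρ.re) / ((s.re - ρ.re) ^ 2 + (s.im - ρ.im) ^ 2) := by
  rw [one_div, inv_re, normSq_apply]
  simp
  ring_nf

lemma re_one_div_sub_nonneg {s ρ : ℂ} (h : ρ.re ≤ s.re) : 0 ≤ (1 / (s - ρ)).re := by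
  rw [re_one_div_sub]
  have : 0 ≤ s.re - ρ.re := by linarith
  positivity

lemma zsum_term_eq {s v : ℂ} (hs : 1 < s.re) (hv : xiQ v = 0) :
    (2 * s - 1) / (s * (s - 1) - v) = 1 / (s - rootOf v) + 1 / (s - (1 - rootOf v)) := by
  have h1 := half_le_re_rootOf v
  have h2 := re_rootOf_lt_one hv
  have h3 : s - rootOf v ≠ 0 := fun h => by
    have := congrArg Complex.re h
    simp at this
    linarith
  have h4 : s - (1 - rootOf v) ≠ 0 := fun h => by
    have := congrArg Complex.re h
    simp at this
    linarith
  rw [div_add_div _ _ h3 h4]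
  congr 1
  · ring
  · linear_combination rootOf_mul v

lemma re_zsum_term_nonneg {s : ℂ} (hs : 1 < s.re) (v : ℂ) :
    0 ≤ ((mult v : ℂ) * ((2 * s - 1) / (s * (s - 1) - v))).re := by
  by_cases hv : xiQ v = 0
  · rw [← Complex.ofReal_natCast, Complex.re_ofReal_mul, zsum_term_eq hs hv, add_re]
    have h1 := half_le_re_rootOf v
    have h2 := re_rootOf_lt_one hv
    refine mul_nonneg (by positivity) (add_nonneg (re_one_div_sub_nonneg (by linarith))
      (re_one_div_sub_nonneg ?_))
    simp
    linarith
  · rw [(mult_eq_zero_iff v).2 hv]; simp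

lemma hasSum_re_Zsum {s : ℂ} (hs : 1 < s.re) :
    HasSum (fun v : ℂ => ((mult v : ℂ) * ((2 * s - 1) / (s * (s - 1) - v))).re) (Zsum s).re := by
  have h := hasSum_Zsum (xi_ne_zero hs)
  rw [← Zsum_eq (xi_ne_zero hs)] at h
  exact Complex.hasSum_re h

lemma re_Zsum_nonneg {s : ℂ} (hs : 1 < s.re) : 0 ≤ (Zsum s).re :=
  (hasSum_re_Zsum hs).nonneg (re_zsum_term_nonneg hs)

lemma re_Zsum_ge {s v : ℂ} (hs : 1 < s.re) (hv : xiQ v = 0) (him : s.im = (rootOf v).im) :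
    1 / (s.re - (rootOf v).re) ≤ (Zsum s).re := by
  refine le_trans ?_ (le_hasSum (hasSum_re_Zsum hs) v fun w _ => re_zsum_term_nonneg hs w)
  have h1 := half_le_re_rootOf v
  have h2 := re_rootOf_lt_one hv
  rw [← Complex.ofReal_natCast, Complex.re_ofReal_mul, zsum_term_eq hs hv, add_re]
  have h3 : (1 : ℝ) ≤ mult v := by exact_mod_cast one_le_mult hv
  have h4 : (1 / (s - rootOf v)).re = 1 / (s.re - (rootOf v).re) := by
    rw [re_one_div_sub, him]
    have : s.re - (rootOf v).re ≠ 0 := by linarith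
    field_simp
    ring
  have h5 : 0 ≤ (1 / (s - (1 - rootOf v))).re := re_one_div_sub_nonneg (by simp; linarith)
  have h6 : 0 ≤ (1 / (s - rootOf v)).re := re_one_div_sub_nonneg (by linarith)
  rw [← h4]
  exact le_trans (by linarith) (le_mul_of_one_le_left (by linarith) h3)

lemma hasSum_re_neg_logDeriv_zeta {s : ℂ} (hs : 1 < s.re) :
    HasSum (fun n : ℕ => (ArithmeticFunction.vonMangoldt n : ℝ) * (n : ℝ) ^ (-s.re) *
      Real.cos (s.im * Real.log n)) (-logDeriv riemannZeta s).re := by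
  have h1 := (ArithmeticFunction.LSeriesSummable_vonMangoldt hs).LSeriesHasSum
  rw [ArithmeticFunction.LSeries_vonMangoldt_eq_deriv_riemannZeta_div hs] at h1
  have h2 := Complex.hasSum_re h1
  rw [neg_div, ← logDeriv_apply] at h2
  convert h2 using 2 with n
  rcases Nat.eq_zero_or_pos n with rfl | hn
  · simp
  have hn' : (0 : ℝ) < n := by exact_mod_cast hn
  rw [LSeries.term_of_ne_zero hn.ne', div_eq_mul_inv, ← Complex.cpow_neg, Complex.re_ofReal_mul,
    Complex.cpow_def_of_ne_zero (by exact_mod_cast hn.ne'), ← Complex.natCast_log,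
    Complex.exp_re, mul_assoc, Real.rpow_def_of_pos hn']
  simp only [Complex.re_ofReal_mul, Complex.im_ofReal_mul, neg_re, neg_im, mul_neg, Real.cos_neg]
  rw [mul_comm s.im]

lemma three_four_one {σ t : ℝ} (hσ : 1 < σ) :
    0 ≤ 3 * (-logDeriv riemannZeta σ).re + 4 * (-logDeriv riemannZeta (σ + t * I)).re +
      (-logDeriv riemannZeta (σ + (2 * t : ℝ) * I)).re := by
  have hre : ∀ u : ℝ, (σ + u * I : ℂ).re = σ := fun u => by simp
  have him : ∀ u : ℝ, (σ + u * I : ℂ).im = u := fun u => by simp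
  have h0 := hasSum_re_neg_logDeriv_zeta (s := σ) (by simpa)
  have h1 := hasSum_re_neg_logDeriv_zeta (s := σ + t * I) (by rwa [hre])
  have h2 := hasSum_re_neg_logDeriv_zeta (s := σ + (2 * t : ℝ) * I) (by rwa [hre])
  refine HasSum.nonneg (fun n => ?_) (((h0.mul_left 3).add (h1.mul_left 4)).add h2)
  rw [hre, hre, him, him, ofReal_re, ofReal_im, zero_mul, Real.cos_zero,
    show 2 * t * Real.log n = 2 * (t * Real.log n) by ring, Real.cos_two_mul]
  have h3 : 0 ≤ (ArithmeticFunction.vonMangoldt n : ℝ) * (n : ℝ) ^ (-σ) :=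
    mul_nonneg ArithmeticFunction.vonMangoldt_nonneg (by positivity)
  nlinarith [mul_nonneg h3 (sq_nonneg (Real.cos (t * Real.log n) + 1))]

lemma re_neg_logDeriv_zeta {s : ℂ} (hs : 1 < s.re) :
    (-logDeriv riemannZeta s).re = -(Zsum s).re + (1 / (s - 1)).re - Real.log Real.pi / 2 +
      (digamma (s / 2 + 1)).re / 2 := by
  rw [logDeriv_zeta_eq hs]
  have h1 : ((Real.log Real.pi : ℂ) / 2).re = Real.log Real.pi / 2 := by
    rw [show (Real.log Real.pi : ℂ) / 2 = ((Real.log Real.pi / 2 : ℝ) : ℂ) by push_cast; rfl]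
    exact ofReal_re _
  have h2 : (digamma (s / 2 + 1) / 2).re = (digamma (s / 2 + 1)).re / 2 := by
    rw [show (2 : ℂ) = ((2 : ℝ) : ℂ) by norm_num]
    exact Complex.div_ofReal_re _ _
  simp only [neg_re, sub_re, add_re, h1, h2]
  ring

/-- The scale of the zero-free region. -/
noncomputable def zeroFreeScale (v : ℂ) : ℝ := 5 / 4 * Real.log (1 + -v.re / 42)

lemma zero_free_aux {v : ℂ} (hv : xiQ v = 0) {η : ℝ} (h0 : 0 < η) (h1 : η ≤ 0.6) :
    4 / (η + (1 - (rootOf v).re)) ≤ 3 / η + zeroFreeScale v := by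
  set β := (rootOf v).re with hβ
  set t := (rootOf v).im with ht
  set a := -v.re with ha
  have hb1 : 1 / 2 ≤ β := half_le_re_rootOf v
  have hb2 : β < 1 := re_rootOf_lt_one hv
  have ha40 : 41 ≤ a := neg_re_ge hv
  have hat : a = t ^ 2 + β * (1 - β) := by rw [ha, re_rootOf_formula v]; ring
  have ht1 : t ^ 2 ≤ a := by nlinarith
  have ht2 : a - 1 / 4 ≤ t ^ 2 := by nlinarith [sq_nonneg (β - 1 / 2)]
  have ht3 : 6.3 ≤ |t| := by
    refine abs_le_of_sq_le_sq' ?_ (abs_nonneg t) |>.2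
    rw [sq_abs]; norm_num; linarith
  have hσ : 1 < 1 + η := by linarith
  have hre : ∀ u : ℝ, (((1 + η : ℝ) : ℂ) + u * I).re = 1 + η := fun u => by simp
  have him : ∀ u : ℝ, (((1 + η : ℝ) : ℂ) + u * I).im = u := fun u => by simp
  have hdre : ∀ u : ℝ, ((((1 + η : ℝ) : ℂ) + u * I) / 2 + 1).re = (3 + η) / 2 := fun u => by
    simp; ring
  have hdim : ∀ u : ℝ, ((((1 + η : ℝ) : ℂ) + u * I) / 2 + 1).im = u / 2 := fun u => by simp
  have h := three_four_one (t := t) hσ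
  rw [re_neg_logDeriv_zeta (by simpa), re_neg_logDeriv_zeta (by rwa [hre]),
    re_neg_logDeriv_zeta (by rwa [hre])] at h
  have z0 := re_Zsum_nonneg (s := ((1 + η : ℝ) : ℂ)) (by simpa)
  have z1 := re_Zsum_ge (s := ((1 + η : ℝ) : ℂ) + t * I) (by rwa [hre]) hv (him t)
  have z2 := re_Zsum_nonneg (s := ((1 + η : ℝ) : ℂ) + (2 * t : ℝ) * I) (by rwa [hre])
  rw [hre, ← hβ] at z1
  have p0 : (1 / (((1 + η : ℝ) : ℂ) - 1)).re = 1 / η := by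
    rw [re_one_div_sub]; simp; field_simp
  have p1 : (1 / (((1 + η : ℝ) : ℂ) + t * I - 1)).re ≤ 151 / 10000 := by
    rw [re_one_div_sub, hre, him, one_re, one_im, div_le_iff₀ (by nlinarith)]
    norm_num
    nlinarith
  have p2 : (1 / (((1 + η : ℝ) : ℂ) + (2 * t : ℝ) * I - 1)).re ≤ 151 / 10000 := by
    rw [re_one_div_sub, hre, him, one_re, one_im, div_le_iff₀ (by nlinarith)]
    norm_num
    nlinarith
  have d0 : (digamma (((1 + η : ℝ) : ℂ) / 2 + 1)).re ≤ 423 / 1000 := by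
    have e1 : ((1 + η : ℝ) : ℂ) / 2 + 1 = (((3 + η) / 2 : ℝ) : ℂ) := by push_cast; ring
    rw [e1]
    refine (re_digamma_ofReal_le (y := 2) (by linarith) (by linarith)).trans ?_
    rw [show ((2 : ℝ) : ℂ) = 2 by norm_num, digamma_two]
    have := lt_eulerMascheroni
    simp
    norm_num at this ⊢
    linarith
  have hL0 : 0 < 1 + a / 42 := by positivity
  have hx : ((3 + η) / 2) ^ 2 ≤ 4 := by nlinarith
  have d1 : (digamma ((((1 + η : ℝ) : ℂ) + t * I) / 2 + 1)).re ≤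
      (Real.log (1 + a / 42) + Real.log (21 / 2)) / 2 + 241 / 1000 := by
    refine (re_digamma_le (by rw [hdre]; linarith)).trans ?_
    rw [hdre, hdim, abs_div, abs_two, ← Real.log_mul hL0.ne' (by norm_num)]
    refine add_le_add ?_ ?_
    · gcongr
      rw [div_pow t]
      linarith
    · rw [div_le_iff₀ (by linarith)]
      norm_num at ht3 ⊢
      linarith
  have d2 : (digamma ((((1 + η : ℝ) : ℂ) + (2 * t : ℝ) * I) / 2 + 1)).re ≤
      (Real.log (1 + a / 42) + Real.log 42) / 2 + 14 / 100 := by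
    refine (re_digamma_le (by rw [hdre]; linarith)).trans ?_
    rw [hdre, hdim, mul_div_cancel_left₀ _ (two_ne_zero), ← Real.log_mul hL0.ne' (by norm_num)]
    refine add_le_add ?_ ?_
    · gcongr
      linarith
    · rw [div_le_iff₀ (by linarith)]
      norm_num at ht3 ⊢
      linarith
  rw [p0] at h
  have hlog : Real.log (21 / 2) + Real.log 42 / 4 + 1.27 ≤ 4 * Real.log Real.pi := by
    have e1 : Real.log 7 ≤ (Real.log 2 + 2 * Real.log 5) / 2 := by
      have : Real.log (7 ^ 2) ≤ Real.log (2 * 5 ^ 2) :=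
        Real.log_le_log (by norm_num) (by norm_num)
      rw [Real.log_pow, Real.log_mul (by norm_num) (by norm_num), Real.log_pow] at this
      push_cast at this
      linarith
    have e2 : Real.log (21 / 2) = Real.log 3 + Real.log 7 - Real.log 2 := by
      rw [show (21 : ℝ) = 3 * 7 by norm_num, Real.log_div (by norm_num) (by norm_num),
        Real.log_mul (by norm_num) (by norm_num)]
    have e3 : Real.log 42 = Real.log 2 + Real.log 3 + Real.log 7 := by
      rw [show (42 : ℝ) = 2 * 3 * 7 by norm_num, Real.log_mul (by norm_num) (by norm_num),
        Real.log_mul (by norm_num) (by norm_num)]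
    have e4 := log_pi_gt
    have e5 := Real.log_two_gt_d9
    have e6 := Real.log_three_lt_d9
    have e7 := Real.log_five_lt_d9
    norm_num at e4 e5 e6 e7 ⊢
    linarith
  rw [show 1 + η - β = η + (1 - β) by ring] at z1
  rw [zeroFreeScale, ← ha]
  have e6 : 4 / (η + (1 - β)) = 4 * (1 / (η + (1 - β))) := by ring
  have e7 : 3 / η = 3 * (1 / η) := by ring
  rw [e6, e7]
  norm_num at hlog
  linarith

/-- The zero-free region. -/
theorem zero_free {v : ℂ} (hv : xiQ v = 0) :
    1 / (1 - (rootOf v).re) ≤ 13.93 * zeroFreeScale v := by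
  have hb2 : (rootOf v).re < 1 := re_rootOf_lt_one hv
  set d := 1 - (rootOf v).re with hd
  have hd0 : 0 < d := by linarith
  have ha40 : 41 ≤ -v.re := neg_re_ge hv
  set L := zeroFreeScale v with hL
  have hL1 : 0.8 ≤ L := by
    rw [hL, zeroFreeScale]
    have := Real.le_log_one_add_of_nonneg (x := 41 / 42) (by norm_num)
    have h2 : Real.log (1 + 41 / 42) ≤ Real.log (1 + -v.re / 42) :=
      Real.log_le_log (by norm_num) (by linarith)
    norm_num at this h2 ⊢
    linarith
  have hL0 : 0 < L := by norm_num at hL1; linarith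
  have h := zero_free_aux hv (η := 0.464 / L) (by positivity) (by
    rw [div_le_iff₀ hL0]; norm_num at hL1 ⊢; linarith)
  rw [← hd] at h
  have hp : 0 < 0.464 / L + d := by positivity
  have e : 3 / (0.464 / L) + L = 3.464 / 0.464 * L := by field_simp; norm_num
  rw [e, div_le_iff₀ hp] at h
  have e2 : 3.464 / 0.464 * L * (0.464 / L + d) = 3.464 + 3.464 / 0.464 * (L * d) := by
    field_simp
  rw [e2] at h
  rw [div_le_iff₀ hd0]
  norm_num at h ⊢
  nlinarith

end TotientBound

namespace TotientBound

open Complex Metric Set Filter Topology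

lemma mult_mul_nonneg {f : ℂ → ℝ} (hf : ∀ v, xiQ v = 0 → 0 ≤ f v) (v : ℂ) :
    0 ≤ (mult v : ℝ) * f v := by
  by_cases hv : xiQ v = 0
  · exact mul_nonneg (by positivity) (hf v hv)
  · rw [(mult_eq_zero_iff v).2 hv]; simp

lemma mult_mul_le_mult_mul {f g : ℂ → ℝ} (hf : ∀ v, xiQ v = 0 → f v ≤ g v) (v : ℂ) :
    (mult v : ℝ) * f v ≤ (mult v : ℝ) * g v := by
  by_cases hv : xiQ v = 0
  · exact mul_le_mul_of_nonneg_left (hf v hv) (by positivity)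
  · rw [(mult_eq_zero_iff v).2 hv]; simp

lemma one_div_neg_re_le {v : ℂ} (hv : xiQ v = 0) :
    1 / -v.re ≤ 42 / 41 * (-v.re / ‖v‖ ^ 2) := by
  have h1 := neg_re_ge hv
  refine le_trans ?_ (mul_le_mul_of_nonneg_left (one_div_neg_re_add_one_le hv) (by norm_num))
  rw [div_mul_div_comm, div_le_div_iff₀ (by linarith) (by linarith)]
  linarith

lemma summable_mult_div_re : Summable fun v : ℂ => (mult v : ℝ) * (1 / -v.re) := by
  refine Summable.of_nonneg_of_le (mult_mul_nonneg fun v hv => ?_)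
    (fun v => (mult_mul_le_mult_mul (fun v hv => one_div_neg_re_le hv) v).trans_eq ?_)
    (hasSum_mult_div.summable.mul_left (42 / 41))
  · have := neg_re_pos hv
    positivity
  · ring

lemma tsum_mult_div_re_le : ∑' v : ℂ, (mult v : ℝ) * (1 / -v.re) ≤ 0.024 := by
  have h : ∑' v : ℂ, (mult v : ℝ) * (1 / -v.re) ≤
      42 / 41 * ((Real.eulerMascheroniConstant - Real.log (4 * Real.pi)) / 2 + 1) := by
    rw [← hasSum_mult_div.tsum_eq, ← tsum_mul_left]
    refine summable_mult_div_re.tsum_le_tsum (fun v => ?_)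
      (hasSum_mult_div.summable.mul_left (42 / 41))
    exact (mult_mul_le_mult_mul (fun v hv => one_div_neg_re_le hv) v).trans_eq (by ring)
  exact h.trans ((mul_le_mul_of_nonneg_left sum_mult_div_const_le (by norm_num)).trans
    (by norm_num))

/-- An upper bound for the sum over zeros at a real point. -/
lemma re_Zsum_le {s : ℝ} (hs : 1 < s) :
    (Zsum s).re ≤ 1 / (s - 1) + (Real.log (s / 2 + 1) - Real.log Real.pi) / 2 := by
  have h := re_neg_logDeriv_zeta (s := s) (by simpa)
  have h0 : 0 ≤ (-logDeriv riemannZeta s).re := by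
    refine (hasSum_re_neg_logDeriv_zeta (s := s) (by simpa)).nonneg fun n => ?_
    simp only [ofReal_im, zero_mul, Real.cos_zero, mul_one]
    exact mul_nonneg ArithmeticFunction.vonMangoldt_nonneg (by positivity)
  have h1 := re_digamma_ofReal_le_log (x := s / 2 + 1) (by linarith)
  have e1 : ((s / 2 + 1 : ℝ) : ℂ) = (s : ℂ) / 2 + 1 := by push_cast; rfl
  have e2 : (1 / ((s : ℂ) - 1)).re = 1 / (s - 1) := by
    rw [← ofReal_one, ← ofReal_sub, ← ofReal_div, ofReal_re]
  rw [e1] at h1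
  rw [e2] at h
  linarith

lemma le_re_zsum_term {s : ℝ} (hs : 7 ≤ s) {v : ℂ} (hv : xiQ v = 0) :
    (2 * s - 1) / (s * (s - 1) + -v.re) ≤
      169 / 168 * ((2 * (s : ℂ) - 1) / (s * (s - 1) - v)).re := by
  have ha := neg_re_pos hv
  have hi := im_sq_le hv
  set a := -v.re with had
  have hq : 42 ≤ s * (s - 1) := by nlinarith
  set q := s * (s - 1) with hqd
  have e : ((2 * (s : ℂ) - 1) / (s * (s - 1) - v)).re =
      (2 * s - 1) * ((q + a) / ((q + a) ^ 2 + v.im ^ 2)) := by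
    rw [show (2 * (s : ℂ) - 1) = ((2 * s - 1 : ℝ) : ℂ) by push_cast; rfl,
      show (s : ℂ) * (s - 1) = (q : ℂ) by rw [hqd]; push_cast; rfl, div_eq_mul_inv,
      re_ofReal_mul, inv_re, normSq_apply]
    simp [had]
    left; ring
  rw [e, div_eq_mul_inv, mul_left_comm]
  refine mul_le_mul_of_nonneg_left ?_ (by linarith)
  have hp : 0 < (q + a) ^ 2 + v.im ^ 2 := by positivity
  rw [inv_eq_one_div, ← mul_div_assoc, div_le_div_iff₀ (by positivity) hp]
  nlinarith [sq_nonneg (q - a)]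

/-- A majorant for the sums over zeros weighted logarithmically. -/
noncomputable def zeroMajorant (s : ℝ) : ℝ :=
  (Real.log ((s + 2) / (2 * Real.pi)) * Real.log (s / (s - 1)) +
    (1 / 3) * Real.log ((s + 2) / (s - 1))) / 2 + 1 / (s - 1) - Real.log (s / (s - 1))

lemma hasDerivAt_log_div {s c d : ℝ} (hc : 0 < s + c) (hd : 0 < s + d) :
    HasDerivAt (fun s => Real.log ((s + c) / (s + d))) (1 / (s + c) - 1 / (s + d)) s := by
  have h : HasDerivAt (fun s => Real.log (s + c) - Real.log (s + d))
      (1 / (s + c) - 1 / (s + d)) s :=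
    (((hasDerivAt_id s).add_const c).log hc.ne').sub (((hasDerivAt_id s).add_const d).log hd.ne')
  refine h.congr_of_eventuallyEq ?_
  have h1 : ∀ᶠ x in 𝓝 s, 0 < x + c := (continuous_add_const c).continuousAt.eventually_const_lt hc
  have h2 : ∀ᶠ x in 𝓝 s, 0 < x + d := (continuous_add_const d).continuousAt.eventually_const_lt hd
  filter_upwards [h1, h2] with x hx hx'
  exact Real.log_div hx.ne' hx'.ne'

lemma log_div_sub_one_le {s : ℝ} (hs : 1 < s) : Real.log (s / (s - 1)) ≤ 1 / (s - 1) := by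
  have h0 : 0 < s - 1 := by linarith
  refine (Real.log_le_sub_one_of_pos (by positivity)).trans_eq ?_
  field_simp
  ring

lemma hasDerivAt_zeroMajorant {s : ℝ} (hs : 1 < s) :
    HasDerivAt zeroMajorant
      (-(((Real.log (s / 2 + 1) - Real.log Real.pi) / (s * (s - 1)) -
        Real.log (s / (s - 1)) / (s + 2) + 1 / ((s - 1) * (s + 2))) / 2 +
        1 / (s * (s - 1) ^ 2))) s := by
  have h0 : 0 < s - 1 := by linarith
  have hs0 : 0 < s := by linarith
  have h1 : HasDerivAt (fun s : ℝ => Real.log (s / (s - 1))) (1 / s - 1 / (s - 1)) s := by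
    simpa [sub_eq_add_neg] using hasDerivAt_log_div (s := s) (c := 0) (d := -1) (by linarith)
      (by linarith)
  have h2 : HasDerivAt (fun s : ℝ => Real.log ((s + 2) / (s - 1)))
      (1 / (s + 2) - 1 / (s - 1)) s := by
    simpa [sub_eq_add_neg] using hasDerivAt_log_div (s := s) (c := 2) (d := -1) (by linarith)
      (by linarith)
  have h3 : HasDerivAt (fun s : ℝ => Real.log ((s + 2) / (2 * Real.pi)))
      ((1 / (2 * Real.pi)) / ((s + 2) / (2 * Real.pi))) s :=
    (((hasDerivAt_id s).add_const 2).div_const _).log (by positivity)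
  have h4 : HasDerivAt (fun s : ℝ => 1 / (s - 1)) (-1 / (s - 1) ^ 2) s := by
    simpa using ((hasDerivAt_id s).sub_const 1).fun_inv h0.ne'
  have h5 := ((((h3.mul h1).add (h2.const_mul (1 / 3))).div_const 2).add h4).sub h1
  refine h5.congr_deriv ?_
  have e : Real.log ((s + 2) / (2 * Real.pi)) = Real.log (s / 2 + 1) - Real.log Real.pi := by
    rw [← Real.log_div (by positivity) (by positivity)]
    congr 1
    field_simp
  rw [e]
  have := Real.pi_pos
  field_simp
  ring

lemma zeroMajorant_nonneg {s : ℝ} (hs : 7 ≤ s) : 0 ≤ zeroMajorant s := by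
  have h0 : 0 < s - 1 := by linarith
  have h1 : 0 ≤ Real.log (s / (s - 1)) :=
    Real.log_nonneg (by rw [le_div_iff₀ h0]; linarith)
  have h2 : 0 ≤ Real.log ((s + 2) / (s - 1)) :=
    Real.log_nonneg (by rw [le_div_iff₀ h0]; linarith)
  have h3 : 0 ≤ Real.log ((s + 2) / (2 * Real.pi)) :=
    Real.log_nonneg (by rw [le_div_iff₀ (by positivity)]; linarith [Real.pi_lt_four])
  have h4 := log_div_sub_one_le (s := s) (by linarith)
  have h5 := mul_nonneg h3 h1
  rw [zeroMajorant]
  linarith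

lemma zeroMajorant_seven_le : 169 / 168 * zeroMajorant 7 ≤ 0.109 := by
  have h1 := Real.le_log_one_add_of_nonneg (x := 1 / 6) (by norm_num)
  have h2 := log_one_add_le_of_nonneg (x := 1 / 6) (by norm_num)
  have e1 : (7 : ℝ) / (7 - 1) = 1 + 1 / 6 := by norm_num
  have e2 : Real.log ((7 + 2) / (2 * Real.pi)) =
      2 * Real.log 3 - Real.log 2 - Real.log Real.pi := by
    rw [Real.log_div (by norm_num) (by positivity), Real.log_mul (by norm_num) (by positivity),
      show (7 + 2 : ℝ) = 3 ^ 2 by norm_num, Real.log_pow]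
    push_cast; ring
  have e3 : Real.log ((7 + 2) / (7 - 1)) = Real.log 3 - Real.log 2 := by
    rw [← Real.log_div (by norm_num) (by norm_num)]; norm_num
  rw [zeroMajorant, e1, e2, e3]
  have h3 := log_pi_gt
  have h4 := Real.log_two_gt_d9
  have h5 := Real.log_two_lt_d9
  have h6 := Real.log_three_lt_d9
  have h7 : 2 * Real.log 3 - Real.log 2 - Real.log Real.pi ≤ 0.3594 := by
    norm_num at *; linarith
  have h8 : (2 * Real.log 3 - Real.log 2 - Real.log Real.pi) * Real.log (1 + 1 / 6) ≤
      0.3594 * Real.log (1 + 1 / 6) :=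
    mul_le_mul_of_nonneg_right h7 (Real.log_nonneg (by norm_num))
  norm_num at *
  linarith

lemma sum_mult_log_le (F : Finset ℂ) (hF : ∀ v ∈ F, xiQ v = 0) :
    ∑ v ∈ F, (mult v : ℝ) * (Real.log (1 + -v.re / 42) / -v.re) ≤ 0.109 := by
  refine le_trans ?_ zeroMajorant_seven_le
  set f : ℝ → ℝ := fun s => 169 / 168 * zeroMajorant s -
    ∑ v ∈ F, (mult v : ℝ) * (Real.log (1 + -v.re / (s * (s - 1))) / -v.re) with hf
  have hder : ∀ s : ℝ, 1 < s → HasDerivAt f (169 / 168 *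
      (-(((Real.log (s / 2 + 1) - Real.log Real.pi) / (s * (s - 1)) -
        Real.log (s / (s - 1)) / (s + 2) + 1 / ((s - 1) * (s + 2))) / 2 +
        1 / (s * (s - 1) ^ 2))) - ∑ v ∈ F, (mult v : ℝ) *
          (-((2 * s - 1) / ((s * (s - 1)) * (s * (s - 1) + -v.re))))) s := by
    intro s hs
    have h0 : 0 < s - 1 := by linarith
    have hq : 0 < s * (s - 1) := by nlinarith
    refine ((hasDerivAt_zeroMajorant hs).const_mul _).sub (HasDerivAt.fun_sum fun v hv => ?_)
    refine HasDerivAt.const_mul _ ?_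
    have ha := neg_re_pos (hF v hv)
    set a := -v.re
    have h1 : HasDerivAt (fun s : ℝ => s * (s - 1)) (1 * (s - 1) + s * 1) s :=
      (hasDerivAt_id s).mul ((hasDerivAt_id s).sub_const 1)
    have h2 : HasDerivAt (fun s : ℝ => 1 + a / (s * (s - 1)))
        ((0 * (s * (s - 1)) - a * (1 * (s - 1) + s * 1)) / (s * (s - 1)) ^ 2) s :=
      ((hasDerivAt_const s a).div h1 hq.ne').const_add 1
    refine ((h2.log (by positivity)).div_const a).congr_deriv ?_
    have : s * (s - 1) + a ≠ 0 := by positivity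
    field_simp
    ring
  have hanti : AntitoneOn f (Ici 7) := by
    refine antitoneOn_of_hasDerivWithinAt_nonpos (convex_Ici 7)
      (fun s hs => (hder s (by linarith [mem_Ici.1 hs])).continuousAt.continuousWithinAt)
      (fun s hs => (hder s ?_).hasDerivWithinAt) fun s hs => ?_
    · rw [interior_Ici, mem_Ioi] at hs; linarith
    rw [interior_Ici, mem_Ioi] at hs
    have h0 : 0 < s - 1 := by linarith
    have hs0 : 0 < s := by linarith
    have hq : 0 < s * (s - 1) := by nlinarith
    have hsum : ∑ v ∈ F, (mult v : ℝ) * ((2 * s - 1) / (s * (s - 1) + -v.re)) ≤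
        169 / 168 * (Zsum s).re := by
      have h1 := sum_le_hasSum F (fun v _ => re_zsum_term_nonneg (s := s) (by simp; linarith) v)
        (hasSum_re_Zsum (s := s) (by simp; linarith))
      refine le_trans ?_ (mul_le_mul_of_nonneg_left h1 (by norm_num))
      rw [Finset.mul_sum]
      refine Finset.sum_le_sum fun v hv => ?_
      rw [← Complex.ofReal_natCast, Complex.re_ofReal_mul, mul_left_comm]
      exact mul_le_mul_of_nonneg_left (le_re_zsum_term hs.le (hF v hv)) (by positivity)
    have h2 := re_Zsum_le (s := s) (by linarith)
    have h3 : Real.log (s / (s - 1)) / (s + 2) ≤ 1 / ((s - 1) * (s + 2)) := by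
      rw [← div_div]
      exact div_le_div_of_nonneg_right (log_div_sub_one_le (by linarith)) (by linarith)
    have e : ∑ v ∈ F, (mult v : ℝ) * (-((2 * s - 1) / ((s * (s - 1)) * (s * (s - 1) + -v.re)))) =
        -(∑ v ∈ F, (mult v : ℝ) * ((2 * s - 1) / (s * (s - 1) + -v.re))) / (s * (s - 1)) := by
      rw [neg_div, Finset.sum_div, ← Finset.sum_neg_distrib]
      refine Finset.sum_congr rfl fun v hv => ?_
      rw [mul_comm (s * (s - 1)), ← div_div]
      ring
    have h4 : (∑ v ∈ F, (mult v : ℝ) * ((2 * s - 1) / (s * (s - 1) + -v.re))) / (s * (s - 1)) ≤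
        169 / 168 * ((1 / (s - 1) + (Real.log (s / 2 + 1) - Real.log Real.pi) / 2) /
          (s * (s - 1))) := by
      rw [← mul_div_assoc]
      refine div_le_div_of_nonneg_right ?_ hq.le
      linarith
    have e2 : (1 / (s - 1) + (Real.log (s / 2 + 1) - Real.log Real.pi) / 2) / (s * (s - 1)) =
        1 / (s * (s - 1) ^ 2) + (Real.log (s / 2 + 1) - Real.log Real.pi) / (s * (s - 1)) / 2 := by
      field_simp
    rw [e2] at h4
    rw [e, neg_div]
    linarith
  have hlow : ∀ s : ℝ, 7 ≤ s → -((∑ v ∈ F, (mult v : ℝ)) / (s * (s - 1))) ≤ f 7 := by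
    intro s hs
    refine le_trans ?_ (hanti self_mem_Ici hs hs)
    have h1 := zeroMajorant_nonneg hs
    have hq : 0 < s * (s - 1) := by nlinarith
    have h2 : ∑ v ∈ F, (mult v : ℝ) * (Real.log (1 + -v.re / (s * (s - 1))) / -v.re) ≤
        (∑ v ∈ F, (mult v : ℝ)) / (s * (s - 1)) := by
      rw [Finset.sum_div]
      refine Finset.sum_le_sum fun v hv => ?_
      have ha := neg_re_pos (hF v hv)
      rw [div_eq_mul_one_div (mult v : ℝ)]
      refine mul_le_mul_of_nonneg_left ?_ (by positivity)
      rw [div_le_iff₀ ha]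
      have := Real.log_le_sub_one_of_pos (x := 1 + -v.re / (s * (s - 1))) (by positivity)
      refine this.trans_eq ?_
      ring
    simp only [hf]
    linarith
  have hlim : Tendsto (fun s : ℝ => -((∑ v ∈ F, (mult v : ℝ)) / (s * (s - 1)))) atTop (𝓝 0) := by
    rw [← neg_zero]
    refine Tendsto.neg (Tendsto.const_div_atTop ?_ _)
    exact tendsto_id.atTop_mul_atTop₀ (tendsto_atTop_add_const_right _ _ tendsto_id)
  have h := le_of_tendsto hlim (eventually_atTop.2 ⟨7, hlow⟩)
  simp only [hf] at h
  norm_num at h ⊢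
  linarith

lemma mult_log_nonneg (v : ℂ) : 0 ≤ (mult v : ℝ) * (Real.log (1 + -v.re / 42) / -v.re) := by
  refine mult_mul_nonneg (f := fun v => Real.log (1 + -v.re / 42) / -v.re) (fun v hv => ?_) v
  have ha := neg_re_pos hv
  have : 0 ≤ Real.log (1 + -v.re / 42) := Real.log_nonneg (by linarith)
  positivity

lemma sum_mult_log_le' (F : Finset ℂ) :
    ∑ v ∈ F, (mult v : ℝ) * (Real.log (1 + -v.re / 42) / -v.re) ≤ 0.109 := by
  classical
  rw [← Finset.sum_filter_add_sum_filter_not F (fun v => xiQ v = 0),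
    Finset.sum_eq_zero (s := F.filter fun v => ¬ xiQ v = 0), add_zero]
  · exact sum_mult_log_le _ fun v hv => (Finset.mem_filter.1 hv).2
  · intro v hv
    rw [(mult_eq_zero_iff v).2 (Finset.mem_filter.1 hv).2]; simp

/-- The weight of a zero in the error term of the prime number theorem. -/
noncomputable def zeroWeight (v : ℂ) : ℝ :=
  (mult v : ℝ) * ((1 / (1 - (rootOf v).re) + 1 / (rootOf v).re) / -v.re)

lemma zeroWeight_nonneg (v : ℂ) : 0 ≤ zeroWeight v := by
  refine mult_mul_nonneg (f := fun v => (1 / (1 - (rootOf v).re) + 1 / (rootOf v).re) / -v.re)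
    (fun v hv => ?_) v
  have h1 := half_le_re_rootOf v
  have h2 := re_rootOf_lt_one hv
  have h3 := neg_re_pos hv
  have : 0 < 1 - (rootOf v).re := by linarith
  positivity

lemma zeroWeight_le (v : ℂ) : zeroWeight v ≤ 13.93 * (5 / 4) *
    ((mult v : ℝ) * (Real.log (1 + -v.re / 42) / -v.re)) + 2 * ((mult v : ℝ) * (1 / -v.re)) := by
  have := mult_mul_le_mult_mul (f := fun v => (1 / (1 - (rootOf v).re) + 1 / (rootOf v).re) / -v.re)
    (g := fun v => 13.93 * (5 / 4) * (Real.log (1 + -v.re / 42) / -v.re) + 2 * (1 / -v.re))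
    (fun v hv => ?_) v
  · exact this.trans_eq (by ring)
  have h1 := half_le_re_rootOf v
  have h3 := neg_re_pos hv
  have h4 := zero_free hv
  have h5 : 1 / (rootOf v).re ≤ 2 := by rw [div_le_iff₀ (by linarith)]; linarith
  rw [zeroFreeScale] at h4
  rw [mul_one_div, ← mul_div_assoc, ← add_div]
  refine div_le_div_of_nonneg_right ?_ h3.le
  linarith

lemma summable_mult_log :
    Summable fun v : ℂ => (mult v : ℝ) * (Real.log (1 + -v.re / 42) / -v.re) :=
  summable_of_sum_le mult_log_nonneg sum_mult_log_le'

lemma summable_zeroWeight : Summable zeroWeight :=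
  Summable.of_nonneg_of_le zeroWeight_nonneg zeroWeight_le
    ((summable_mult_log.mul_left _).add (summable_mult_div_re.mul_left _))

lemma tsum_zeroWeight_le : ∑' v, zeroWeight v ≤ 1.95 := by
  have h1 := summable_zeroWeight.tsum_le_tsum zeroWeight_le
    ((summable_mult_log.mul_left _).add (summable_mult_div_re.mul_left _))
  rw [(summable_mult_log.mul_left _).tsum_add (summable_mult_div_re.mul_left _),
    tsum_mul_left, tsum_mul_left] at h1
  have h2 := summable_mult_log.tsum_le_of_sum_le sum_mult_log_le'
  have h3 := tsum_mult_div_re_le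
  norm_num at *
  linarith

end TotientBound

namespace TotientBound

open Complex Metric Set Filter Topology MeasureTheory

lemma hasSum_moment {E : Type*} [NormedAddCommGroup E] [NormedSpace ℝ E] {ι : Type*}
    {f : ι → ℝ → E} {u : ι → ℝ} (hu : Summable u) (hc : ∀ i, ContinuousOn (f i) (Icc 0 1))
    (hb : ∀ i, ∀ t ∈ Icc (0 : ℝ) 1, ‖f i t‖ ≤ u i) [CompleteSpace E] (j : ℕ) :
    HasSum (fun i => ∫ t in (0 : ℝ)..1, t ^ j • f i t)
      (∫ t in (0 : ℝ)..1, t ^ j • ∑' i, f i t) := by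
  have h0 : ∀ i ∉ Function.support u, ∀ t ∈ Icc (0 : ℝ) 1, f i t = 0 := by
    intro i hi t ht
    have := hb i t ht
    rw [Function.notMem_support.1 hi] at this
    exact norm_le_zero_iff.1 this
  have hmem : ∀ t, t ∈ uIoc (0 : ℝ) 1 → t ∈ Icc (0 : ℝ) 1 := fun t ht => by
    rw [uIoc_of_le zero_le_one] at ht
    exact Ioc_subset_Icc_self ht
  have hcount : Countable (Function.support u) := hu.countable_support.to_subtype
  have hu' : Summable fun i : Function.support u => u i := hu.comp_injective Subtype.val_injective
  refine (hasSum_subtype_iff_of_support_subset (s := Function.support u) ?_).1 ?_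
  · intro i hi
    by_contra hi'
    refine hi ?_
    change ∫ t in (0 : ℝ)..1, t ^ j • f i t = 0
    rw [intervalIntegral.integral_congr (g := fun _ => 0), intervalIntegral.integral_zero]
    intro t ht
    rw [uIcc_of_le zero_le_one] at ht
    simp [h0 i hi' t ht]
  · refine intervalIntegral.hasSum_integral_of_dominated_convergence
      (F := fun (i : Function.support u) t => t ^ j • f i t) (fun i _ => u i)
      (fun i => ?_) (fun i => ?_) ?_ ?_ ?_
    · have : ContinuousOn (fun t : ℝ => t ^ j • f i t) (Icc 0 1) :=
        (continuous_pow j).continuousOn.smul (hc i)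
      exact (this.mono hmem).aestronglyMeasurable measurableSet_uIoc
    · refine .of_forall fun t ht => ?_
      have h1 := hmem t ht
      rw [norm_smul, Real.norm_of_nonneg (pow_nonneg h1.1 j)]
      exact (mul_le_of_le_one_left (norm_nonneg _) (pow_le_one₀ h1.1 h1.2)).trans (hb i t h1)
    · exact .of_forall fun t _ => hu'
    · exact intervalIntegrable_const
    · refine .of_forall fun t ht => ?_
      have h1 := hmem t ht
      have hs : Summable fun i => f i t := Summable.of_norm_bounded hu fun i => hb i t h1
      refine HasSum.const_smul (t ^ j) ?_
      refine (hasSum_subtype_iff_of_support_subset (s := Function.support u) ?_).2 hs.hasSum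
      intro i hi
      by_contra hi'
      exact hi (h0 i hi' t h1)

/-- A continuous function with vanishing moments is zero. -/
lemma eq_zero_of_moments {g : ℝ → ℝ} (hg : ContinuousOn g (Icc 0 1))
    (hm : ∀ j : ℕ, ∫ t in (0 : ℝ)..1, t ^ j * g t = 0) : ∀ t ∈ Icc (0 : ℝ) 1, g t = 0 := by
  have hi : ∀ f : ℝ → ℝ, ContinuousOn f (Icc 0 1) → IntervalIntegrable f volume 0 1 :=
    fun f hf => ContinuousOn.intervalIntegrable (by rwa [uIcc_of_le zero_le_one])
  have hpoly : ∀ p : Polynomial ℝ, ∫ t in (0 : ℝ)..1, p.eval t * g t = 0 := by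
    intro p
    simp_rw [Polynomial.eval_eq_sum_range, Finset.sum_mul, mul_assoc]
    rw [intervalIntegral.integral_finsetSum]
    · refine Finset.sum_eq_zero fun k _ => ?_
      rw [intervalIntegral.integral_const_mul, hm, mul_zero]
    · exact fun k _ => hi _ (((continuous_pow k).continuousOn.mul hg).const_mul _)
  set A := ∫ t in (0 : ℝ)..1, |g t| with hA
  have hA0 : 0 ≤ A := intervalIntegral.integral_nonneg zero_le_one fun t _ => abs_nonneg _
  have hsq : ∫ t in (0 : ℝ)..1, g t ^ 2 = 0 := by
    refine le_antisymm (le_of_forall_pos_le_add fun ε hε => ?_)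
      (intervalIntegral.integral_nonneg zero_le_one fun t _ => sq_nonneg _)
    obtain ⟨p, hp⟩ := exists_polynomial_near_of_continuousOn 0 1 g hg (ε / (A + 1)) (by positivity)
    have hpc : ContinuousOn (fun t => p.eval t) (Icc 0 1) := p.continuous.continuousOn
    have e : ∫ t in (0 : ℝ)..1, g t ^ 2 = ∫ t in (0 : ℝ)..1, (g t - p.eval t) * g t := by
      have h := intervalIntegral.integral_sub (hi (fun t => g t ^ 2) (hg.pow 2))
        (hi (fun t => p.eval t * g t) (hpc.mul hg))
      rw [hpoly, sub_zero] at h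
      rw [← h]
      congr 1; ext t; ring
    have h1 : ∫ t in (0 : ℝ)..1, (g t - p.eval t) * g t ≤
        ∫ t in (0 : ℝ)..1, ε / (A + 1) * |g t| := by
      refine intervalIntegral.integral_mono_on zero_le_one (hi _ ((hg.sub hpc).mul hg))
        (hi _ (hg.abs.const_mul _)) fun t ht => ?_
      refine (le_abs_self _).trans ?_
      rw [abs_mul, abs_sub_comm]
      exact mul_le_mul_of_nonneg_right (hp t ht).le (abs_nonneg _)
    rw [e, zero_add]
    refine h1.trans ?_
    rw [intervalIntegral.integral_const_mul, ← hA, div_mul_eq_mul_div, div_le_iff₀ (by linarith)]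
    nlinarith
  intro t ht
  by_contra hne
  have hpos : 0 < ∫ t in (0 : ℝ)..1, g t ^ 2 :=
    intervalIntegral.integral_pos zero_lt_one (hg.pow 2) (fun t _ => sq_nonneg _)
      ⟨t, ht, by positivity⟩
  exact hpos.ne' hsq

lemma integral_pow_succ_mul_log (j : ℕ) :
    ∫ t in (0 : ℝ)..1, t ^ j * -(t * Real.log t) = 1 / ((j : ℝ) + 2) ^ 2 := by
  have hp : ((j : ℝ) + 2) ≠ 0 := by positivity
  have hcl : Continuous fun t : ℝ => t * Real.log t := Real.continuous_mul_log
  have hF : ∀ t ∈ Ioo (0 : ℝ) 1, HasDerivAt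
      (fun t : ℝ => t ^ (j + 2) / (j + 2) ^ 2 - t ^ (j + 1) * (t * Real.log t) / (j + 2))
      (t ^ j * -(t * Real.log t)) t := by
    intro t ht
    have h1 : HasDerivAt (fun t : ℝ => t ^ (j + 2)) (((j + 2 : ℕ) : ℝ) * t ^ (j + 1)) t :=
      hasDerivAt_pow (j + 2) t
    have h2 := (h1.div_const (((j : ℝ) + 2) ^ 2)).sub
      ((h1.mul (Real.hasDerivAt_log ht.1.ne')).div_const ((j : ℝ) + 2))
    have h3 : HasDerivAt
        (fun t : ℝ => t ^ (j + 2) / ((j : ℝ) + 2) ^ 2 - t ^ (j + 1) * (t * Real.log t) / (j + 2))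
        _ t := h2.congr_of_eventuallyEq (.of_forall fun x => by simp; ring)
    refine h3.congr_deriv ?_
    have := ht.1.ne'
    push_cast
    field_simp
    ring
  rw [intervalIntegral.integral_eq_sub_of_hasDerivAt_of_le zero_le_one _ hF]
  · simp
  · exact ((continuous_pow j).mul hcl.neg).intervalIntegrable _ _
  · exact (((continuous_pow _).div_const _).sub
      (((continuous_pow _).mul hcl).div_const _)).continuousOn

lemma integral_pow_mul_max (j : ℕ) {a : ℝ} (h0 : 0 ≤ a) (h1 : a ≤ 1) :
    ∫ t in (0 : ℝ)..1, t ^ j * (t * max (a - t) 0) =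
      a ^ (j + 3) / (((j : ℝ) + 3) * (j + 2)) := by
  have hc : Continuous fun t : ℝ => t ^ j * (t * max (a - t) 0) := by fun_prop
  rw [← intervalIntegral.integral_add_adjacent_intervals (b := a)
    (hc.intervalIntegrable _ _) (hc.intervalIntegrable _ _)]
  have e1 : ∫ t in (0 : ℝ)..a, t ^ j * (t * max (a - t) 0) =
      ∫ t in (0 : ℝ)..a, (a * t ^ (j + 1) - t ^ (j + 2)) := by
    refine intervalIntegral.integral_congr fun t ht => ?_
    rw [uIcc_of_le h0] at ht
    rw [max_eq_left (by linarith [ht.2])]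
    ring
  have e2 : ∫ t in a..1, t ^ j * (t * max (a - t) 0) = 0 := by
    rw [intervalIntegral.integral_congr (g := fun _ => 0), intervalIntegral.integral_zero]
    intro t ht
    rw [uIcc_of_le h1] at ht
    beta_reduce
    rw [max_eq_right (by linarith [ht.1])]
    ring
  rw [e1, e2, intervalIntegral.integral_sub, intervalIntegral.integral_const_mul, integral_pow,
    integral_pow]
  · have : ((j : ℝ) + 3) ≠ 0 := by positivity
    have : ((j : ℝ) + 2) ≠ 0 := by positivity
    have : ((j : ℝ) + 1 + 1) ≠ 0 := by positivity
    have : ((j : ℝ) + 2 + 1) ≠ 0 := by positivity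
    push_cast
    field_simp
    ring
  · exact (by fun_prop : Continuous fun t : ℝ => a * t ^ (j + 1)).intervalIntegrable _ _
  · exact (continuous_pow _).intervalIntegrable _ _

/-- The contribution of `n` to the smoothed Chebyshev function in the variable `1 / x`. -/
noncomputable def primeTerm (n : ℕ) (t : ℝ) : ℝ :=
  ArithmeticFunction.vonMangoldt n * (t * max (1 / n - t) 0)

lemma summable_vonMangoldt_div_sq :
    Summable fun n : ℕ => (ArithmeticFunction.vonMangoldt n : ℝ) * (1 / (n : ℝ) ^ 2) := by
  refine (hasSum_re_neg_logDeriv_zeta (s := 2) (by simp)).summable.congr fun n => ?_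
  simp

lemma continuous_primeTerm (n : ℕ) : Continuous (primeTerm n) := by
  unfold primeTerm; fun_prop

lemma norm_primeTerm_le (n : ℕ) {t : ℝ} (ht : t ∈ Icc (0 : ℝ) 1) :
    ‖primeTerm n t‖ ≤ ArithmeticFunction.vonMangoldt n * (1 / (n : ℝ) ^ 2) := by
  have hL : 0 ≤ (ArithmeticFunction.vonMangoldt n : ℝ) := ArithmeticFunction.vonMangoldt_nonneg
  rw [primeTerm, norm_mul, Real.norm_of_nonneg hL]
  refine mul_le_mul_of_nonneg_left ?_ hL
  rw [Real.norm_of_nonneg (mul_nonneg ht.1 (le_max_right _ _))]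
  rcases le_total ((1 : ℝ) / n) t with h | h
  · rw [max_eq_right (by linarith), mul_zero]; positivity
  · rw [max_eq_left (by linarith), ← one_div_pow, sq]
    exact mul_le_mul h (by linarith [ht.1]) (by linarith) (by positivity)

lemma integral_primeTerm (j n : ℕ) :
    ∫ t in (0 : ℝ)..1, t ^ j • primeTerm n t =
      ArithmeticFunction.vonMangoldt n * (n : ℝ) ^ (-((j : ℝ) + 3)) / ((j + 3) * (j + 2)) := by
  rcases Nat.eq_zero_or_pos n with rfl | hn
  · simp [primeTerm]
  have hn' : (1 : ℝ) ≤ n := by exact_mod_cast hn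
  have e : ∀ t : ℝ, t ^ j • primeTerm n t =
      ArithmeticFunction.vonMangoldt n * (t ^ j * (t * max (1 / n - t) 0)) := fun t => by
    rw [primeTerm, smul_eq_mul]; ring
  simp_rw [e]
  rw [intervalIntegral.integral_const_mul, integral_pow_mul_max j (by positivity)
    (by rw [div_le_one (by linarith)]; exact hn'), one_div, inv_pow, ← Real.rpow_natCast,
    Real.rpow_neg (by positivity), mul_div_assoc]
  push_cast
  rfl

/-- The contribution of a trivial zero. -/
noncomputable def trivialTerm (n : ℕ) (t : ℝ) : ℝ :=
  (t - t ^ (2 * n + 4)) / ((2 * n + 2) * (2 * n + 3))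

lemma norm_trivialTerm_le (n : ℕ) {t : ℝ} (ht : t ∈ Icc (0 : ℝ) 1) :
    ‖trivialTerm n t‖ ≤ 1 / ((n : ℝ) + 1) ^ 2 := by
  have h1 : t ^ (2 * n + 4) ≤ t := pow_le_of_le_one ht.1 ht.2 (by omega)
  have h2 : 0 ≤ t ^ (2 * n + 4) := pow_nonneg ht.1 _
  rw [trivialTerm, norm_div, Real.norm_of_nonneg (by linarith),
    Real.norm_of_nonneg (by positivity)]
  refine div_le_div₀ zero_le_one (by linarith [ht.2]) (by positivity) ?_
  have : (0 : ℝ) ≤ n := by positivity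
  nlinarith

lemma integral_trivialTerm (j n : ℕ) :
    ∫ t in (0 : ℝ)..1, t ^ j • trivialTerm n t =
      (digammaTerm n (((j : ℝ) + 3) / 2 + 1 : ℝ)).re / (2 * ((j + 3) * (j + 2))) := by
  have e : ∀ t : ℝ, t ^ j • trivialTerm n t =
      (1 / ((2 * n + 2) * (2 * n + 3))) * (t ^ (j + 1) - t ^ (j + 2 * n + 4)) := fun t => by
    rw [trivialTerm, smul_eq_mul]; ring
  simp_rw [e]
  have hd : (digammaTerm n (((j : ℝ) + 3) / 2 + 1 : ℝ)).re =
      1 / ((n : ℝ) + 1) - 1 / (n + (((j : ℝ) + 3) / 2 + 1)) := by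
    rw [digammaTerm, ← ofReal_re (1 / ((n : ℝ) + 1) - 1 / (n + (((j : ℝ) + 3) / 2 + 1)))]
    push_cast
    rfl
  rw [hd, intervalIntegral.integral_const_mul, intervalIntegral.integral_sub
    ((continuous_pow _).intervalIntegrable _ _) ((continuous_pow _).intervalIntegrable _ _),
    integral_pow, integral_pow]
  have h1 : (n : ℝ) + (((j : ℝ) + 3) / 2 + 1) ≠ 0 := by positivity
  have h2 : ((j : ℝ) + 1 + 1) ≠ 0 := by positivity
  have h3 : ((j : ℝ) + 2 * n + 4 + 1) ≠ 0 := by positivity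
  simp only [one_pow, zero_pow (Nat.succ_ne_zero _), sub_zero]
  push_cast
  field_simp
  ring

end TotientBound

namespace TotientBound

open Complex Metric Set Filter Topology MeasureTheory

/-- The contribution of a zero to the smoothed Chebyshev function in the variable `1 / x`. -/
noncomputable def zeroTerm (v : ℂ) (t : ℝ) : ℂ :=
  (mult v : ℂ) * (1 / v * ((t : ℂ) ^ (2 - rootOf v) + (t : ℂ) ^ (1 + rootOf v) - t - t ^ 2))

lemma zeroTerm_of_ne {v : ℂ} (hv : xiQ v ≠ 0) : zeroTerm v = fun _ => 0 := by
  ext t; rw [zeroTerm, (mult_eq_zero_iff v).2 hv]; simp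

lemma re_two_sub_rootOf_pos {v : ℂ} (hv : xiQ v = 0) : 0 < (2 - rootOf v).re := by
  have := re_rootOf_lt_one hv
  simp; linarith

lemma re_one_add_rootOf_pos (v : ℂ) : 0 < (1 + rootOf v).re := by
  have := half_le_re_rootOf v
  simp; linarith

lemma continuous_zeroTerm (v : ℂ) : Continuous (zeroTerm v) := by
  by_cases hv : xiQ v = 0
  · have h1 := continuous_ofReal_cpow_const (re_two_sub_rootOf_pos hv)
    have h2 := continuous_ofReal_cpow_const (re_one_add_rootOf_pos v)
    exact continuous_const.mul (continuous_const.mul (((h1.add h2).sub continuous_ofReal).sub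
      (continuous_ofReal.pow 2)))
  · rw [zeroTerm_of_ne hv]; exact continuous_const

lemma norm_ofReal_cpow_le_one {t : ℝ} (ht : t ∈ Icc (0 : ℝ) 1) {z : ℂ} (hz : 0 < z.re) :
    ‖(t : ℂ) ^ z‖ ≤ 1 := by
  rw [Complex.norm_cpow_eq_rpow_re_of_nonneg ht.1 hz.ne']
  exact Real.rpow_le_one ht.1 ht.2 hz.le

lemma norm_zeroTerm_le (v : ℂ) {t : ℝ} (ht : t ∈ Icc (0 : ℝ) 1) :
    ‖zeroTerm v t‖ ≤ 4 * ((mult v : ℝ) / ‖v‖) := by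
  by_cases hv : xiQ v = 0
  · have h1 := norm_ofReal_cpow_le_one ht (re_two_sub_rootOf_pos hv)
    have h2 := norm_ofReal_cpow_le_one ht (re_one_add_rootOf_pos v)
    have h3 : ‖(t : ℂ)‖ ≤ 1 := by rw [norm_real, Real.norm_of_nonneg ht.1]; exact ht.2
    have h4 : ‖(t : ℂ) ^ 2‖ ≤ 1 := by rw [norm_pow]; exact pow_le_one₀ (norm_nonneg _) h3
    have h5 : ‖(t : ℂ) ^ (2 - rootOf v) + (t : ℂ) ^ (1 + rootOf v) - t - t ^ 2‖ ≤ 4 := by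
      refine (norm_sub_le _ _).trans ?_
      have := norm_sub_le ((t : ℂ) ^ (2 - rootOf v) + (t : ℂ) ^ (1 + rootOf v)) t
      have := norm_add_le ((t : ℂ) ^ (2 - rootOf v)) ((t : ℂ) ^ (1 + rootOf v))
      linarith
    rw [zeroTerm, norm_mul, norm_mul, norm_natCast, norm_div, norm_one]
    calc (mult v : ℝ) * (1 / ‖v‖ * _) ≤ (mult v : ℝ) * (1 / ‖v‖ * 4) := by gcongr
      _ = _ := by ring
  · rw [zeroTerm_of_ne hv, norm_zero]; positivity

lemma integral_pow_mul_cpow (j : ℕ) {z : ℂ} (hz : 0 < z.re) :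
    ∫ t in (0 : ℝ)..1, (t : ℂ) ^ j * (t : ℂ) ^ z = 1 / (j + z + 1) := by
  have hne : (j : ℂ) + z ≠ 0 := fun h => by
    have := congrArg Complex.re h
    simp at this
    have : (0 : ℝ) ≤ j := by positivity
    linarith
  have hz0 : z ≠ 0 := by rintro rfl; simp at hz
  have e : ∀ t : ℝ, (t : ℂ) ^ j * (t : ℂ) ^ z = (t : ℂ) ^ ((j : ℂ) + z) := by
    intro t
    rcases eq_or_ne t 0 with rfl | ht
    · simp [hne, hz0]
    · rw [cpow_add _ _ (by exact_mod_cast ht), cpow_natCast]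
  simp_rw [e]
  have hre : 0 < ((j : ℂ) + z).re := by simp; positivity
  have hne1 : (j : ℂ) + z + 1 ≠ 0 := fun h => by
    have := congrArg Complex.re h
    simp at this hre
    linarith
  rw [integral_cpow (Or.inl (by linarith))]
  simp [hne1]

lemma integral_zeroTerm (j : ℕ) (v : ℂ) :
    ∫ t in (0 : ℝ)..1, t ^ j • zeroTerm v t =
      (mult v : ℂ) * ((2 * ((j + 3 : ℝ) : ℂ) - 1) /
        (((j + 3 : ℝ) : ℂ) * (((j + 3 : ℝ) : ℂ) - 1) - v)) * (1 / ((j + 3) * (j + 2))) := by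
  by_cases hv : xiQ v = 0
  swap
  · rw [zeroTerm_of_ne hv, (mult_eq_zero_iff v).2 hv]; simp
  have hv0 := ne_zero_of_zero hv
  have h1 := re_two_sub_rootOf_pos hv
  have h2 := re_one_add_rootOf_pos v
  have e : ∀ t : ℝ, t ^ j • zeroTerm v t = (mult v : ℂ) * (1 / v) *
      ((t : ℂ) ^ j * (t : ℂ) ^ (2 - rootOf v) + (t : ℂ) ^ j * (t : ℂ) ^ (1 + rootOf v) -
        (t : ℂ) ^ j * (t : ℂ) ^ (1 : ℂ) - (t : ℂ) ^ j * (t : ℂ) ^ (2 : ℂ)) := fun t => by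
    rw [zeroTerm, real_smul, cpow_one, show (2 : ℂ) = ((2 : ℕ) : ℂ) by rfl, cpow_natCast]
    push_cast
    ring
  have hi : ∀ z : ℂ, 0 < z.re →
      IntervalIntegrable (fun t : ℝ => (t : ℂ) ^ j * (t : ℂ) ^ z) volume 0 1 := fun z hz =>
    ((continuous_ofReal.pow j).mul (continuous_ofReal_cpow_const hz)).intervalIntegrable _ _
  have i3 := hi 1 (by simp)
  have i4 := hi 2 (by simp)
  simp_rw [e]
  rw [intervalIntegral.integral_const_mul, intervalIntegral.integral_sub
    (((hi _ h1).add (hi _ h2)).sub i3) i4, intervalIntegral.integral_sub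
    ((hi _ h1).add (hi _ h2)) i3, intervalIntegral.integral_add (hi _ h1) (hi _ h2),
    integral_pow_mul_cpow j h1, integral_pow_mul_cpow j h2, integral_pow_mul_cpow j (by simp),
    integral_pow_mul_cpow j (by simp)]
  set s : ℂ := ((j + 3 : ℝ) : ℂ) with hs
  have hsre : s.re = j + 3 := by rw [hs, ofReal_re]
  have hj : (0 : ℝ) ≤ j := by positivity
  have hsj : (j : ℂ) = s - 3 := by rw [hs]; push_cast; ring
  have hb1 := half_le_re_rootOf v
  have hb2 := re_rootOf_lt_one hv
  have n1 : s - rootOf v ≠ 0 := fun h => by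
    have := congrArg Complex.re h
    simp [hsre] at this
    linarith
  have n2 : s - (1 - rootOf v) ≠ 0 := fun h => by
    have := congrArg Complex.re h
    simp [hsre] at this
    linarith
  have n3 : s ≠ 0 := fun h => by
    have := congrArg Complex.re h
    simp [hsre] at this
    linarith
  have n4 : s - 1 ≠ 0 := fun h => by
    have := congrArg Complex.re h
    simp [hsre] at this
    linarith
  have key := zsum_term_eq (s := s) (by rw [hsre]; linarith) hv
  have hD : s * (s - 1) - v ≠ 0 := by
    have : s * (s - 1) - v = (s - rootOf v) * (s - (1 - rootOf v)) := by
      linear_combination rootOf_mul v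
    rw [this]
    exact mul_ne_zero n1 n2
  have e2 : 1 / ((j : ℂ) + (2 - rootOf v) + 1) + 1 / ((j : ℂ) + (1 + rootOf v) + 1) =
      (2 * s - 1) / (s * (s - 1) - v) := by
    rw [key, hsj]; congr 2 <;> ring
  rw [e2, hsj, show s - 3 + 1 + 1 = s - 1 by ring, show s - 3 + 2 + 1 = s by ring,
    show s - 3 + 3 = s by ring, show s - 3 + 2 = s - 1 by ring]
  field_simp
  ring

/-- The constant in the explicit formula. -/
noncomputable def explicitConst : ℝ := 1 + Real.log Real.pi / 2 + Real.eulerMascheroniConstant / 2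

lemma summable_bound_zeroTerm : Summable fun v : ℂ => 4 * ((mult v : ℝ) / ‖v‖) :=
  summable_mult_div_norm.mul_left 4

/-- The explicit formula for the smoothed Chebyshev function. -/
theorem explicit_formula {t : ℝ} (ht : t ∈ Icc (0 : ℝ) 1) :
    -(t * Real.log t) - ∑' n, primeTerm n t =
      (∑' v, zeroTerm v t).re + explicitConst * (t - t ^ 2) - ∑' n, trivialTerm n t := by
  set P : ℝ → ℝ := fun t => ∑' n, primeTerm n t with hP
  set Z : ℝ → ℂ := fun t => ∑' v, zeroTerm v t with hZ
  set D : ℝ → ℝ := fun t => ∑' n, trivialTerm n t with hD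
  have cP : ContinuousOn P (Icc 0 1) := continuousOn_tsum
    (fun n => (continuous_primeTerm n).continuousOn) summable_vonMangoldt_div_sq
    fun n t ht => norm_primeTerm_le n ht
  have cZ : ContinuousOn Z (Icc 0 1) := continuousOn_tsum
    (fun v => (continuous_zeroTerm v).continuousOn) summable_bound_zeroTerm
    fun v t ht => norm_zeroTerm_le v ht
  have cT : ∀ n, Continuous (trivialTerm n) := fun n => by unfold trivialTerm; fun_prop
  have cD : ContinuousOn D (Icc 0 1) := continuousOn_tsum
    (fun n => (cT n).continuousOn) summable_one_div_sq_succ fun n t ht => norm_trivialTerm_le n ht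
  have cL : ContinuousOn (fun t : ℝ => -(t * Real.log t)) (Icc 0 1) :=
    Real.continuous_mul_log.neg.continuousOn
  have cK : ContinuousOn (fun t : ℝ => explicitConst * (t - t ^ 2)) (Icc 0 1) := by fun_prop
  have cZr : ContinuousOn (fun t => (Z t).re) (Icc 0 1) := continuous_re.comp_continuousOn cZ
  have hi : ∀ (j : ℕ) (f : ℝ → ℝ), ContinuousOn f (Icc 0 1) →
      IntervalIntegrable (fun t => t ^ j * f t) volume 0 1 :=
    fun j f hf => ContinuousOn.intervalIntegrable
      (by rw [uIcc_of_le zero_le_one]; exact (continuous_pow j).continuousOn.mul hf)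
  have key := eq_zero_of_moments
    (g := fun t => -(t * Real.log t) - P t - (Z t).re - explicitConst * (t - t ^ 2) + D t)
    ((((cL.sub cP).sub cZr).sub cK).add cD) ?_ t ht
  · linarith
  intro j
  have hj : (0 : ℝ) ≤ j := by positivity
  set s : ℝ := (j : ℝ) + 3 with hs
  have hs1 : 1 < (s : ℂ).re := by rw [ofReal_re]; linarith
  have q0 : (0 : ℝ) < s * (j + 2) := by positivity
  have mL : ∫ t in (0 : ℝ)..1, t ^ j * -(t * Real.log t) = 1 / ((j : ℝ) + 2) ^ 2 :=
    integral_pow_succ_mul_log j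
  have mP : ∫ t in (0 : ℝ)..1, t ^ j * P t = (-logDeriv riemannZeta s).re / (s * (j + 2)) := by
    have h1 := hasSum_moment summable_vonMangoldt_div_sq
      (fun n => (continuous_primeTerm n).continuousOn) (fun n t ht => norm_primeTerm_le n ht) j
    have h2 := (hasSum_re_neg_logDeriv_zeta hs1).div_const (s * (j + 2))
    refine h1.unique (h2.congr_fun ?_)
    intro n
    rw [integral_primeTerm, ofReal_re, ofReal_im, zero_mul, Real.cos_zero, mul_one]
  have mD : ∫ t in (0 : ℝ)..1, t ^ j * D t =
      ((digamma (s / 2 + 1)).re + Real.eulerMascheroniConstant) / (2 * (s * (j + 2))) := by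
    have h1 := hasSum_moment summable_one_div_sq_succ
      (fun n => (cT n).continuousOn) (fun n t ht => norm_trivialTerm_le n ht) j
    have h2 := Complex.hasSum_re (hasSum_digamma (z := ((s / 2 + 1 : ℝ) : ℂ)) (by
      rw [ofReal_re]; linarith))
    have h3 := h2.div_const (2 * (s * (j + 2)))
    rw [add_re, ofReal_re] at h3
    rw [show (s : ℂ) / 2 + 1 = ((s / 2 + 1 : ℝ) : ℂ) by push_cast; rfl]
    refine h1.unique (h3.congr_fun ?_)
    intro n
    rw [integral_trivialTerm]
  have mK : ∫ t in (0 : ℝ)..1, t ^ j * (explicitConst * (t - t ^ 2)) =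
      explicitConst / (s * (j + 2)) := by
    have e : ∀ t : ℝ, t ^ j * (explicitConst * (t - t ^ 2)) =
        explicitConst * (t ^ (j + 1) - t ^ (j + 2)) := fun t => by ring
    simp_rw [e]
    rw [intervalIntegral.integral_const_mul, intervalIntegral.integral_sub
      ((continuous_pow _).intervalIntegrable _ _) ((continuous_pow _).intervalIntegrable _ _),
      integral_pow, integral_pow, hs]
    have h1 : ((j : ℝ) + 1 + 1) ≠ 0 := by positivity
    have h2 : ((j : ℝ) + 2 + 1) ≠ 0 := by positivity
    push_cast
    simp only [one_pow, zero_pow (Nat.succ_ne_zero _), sub_zero]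
    field_simp
    ring
  have mZ : ∫ t in (0 : ℝ)..1, t ^ j * (Z t).re = (Zsum s).re / (s * (j + 2)) := by
    have h1 := hasSum_moment summable_bound_zeroTerm
      (fun v => (continuous_zeroTerm v).continuousOn) (fun v t ht => norm_zeroTerm_le v ht) j
    have h2 := hasSum_Zsum (xi_ne_zero hs1)
    rw [← Zsum_eq (xi_ne_zero hs1)] at h2
    have h3 := h1.unique ((h2.mul_right (1 / (((j : ℂ) + 3) * (j + 2)))).congr_fun fun v =>
      integral_zeroTerm j v)
    have hInt : IntervalIntegrable (fun t => t ^ j • Z t) volume 0 1 :=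
      ContinuousOn.intervalIntegrable
        (by rw [uIcc_of_le zero_le_one]; exact (continuous_pow j).continuousOn.smul cZ)
    have h4 := reCLM.intervalIntegral_comp_comm hInt
    rw [h3] at h4
    simp only [reCLM_apply, smul_re, smul_eq_mul] at h4
    rw [h4, show (1 : ℂ) / (((j : ℂ) + 3) * (j + 2)) = ((1 / (s * (j + 2)) : ℝ) : ℂ) by
      rw [hs]; push_cast; rfl, re_mul_ofReal]
    ring
  have hre := re_neg_logDeriv_zeta hs1
  have e2 : (1 / ((s : ℂ) - 1)).re = 1 / ((j : ℝ) + 2) := by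
    rw [← ofReal_one, ← ofReal_sub, ← ofReal_div, ofReal_re, hs]
    congr 1; ring
  rw [e2] at hre
  have i1 := hi j _ cL
  have i2 := hi j _ cP
  have i3 := hi j _ cZr
  have i4 := hi j _ cK
  have i5 := hi j _ cD
  have e : ∀ t : ℝ, t ^ j * (-(t * Real.log t) - P t - (Z t).re - explicitConst * (t - t ^ 2) +
      D t) = t ^ j * -(t * Real.log t) - t ^ j * P t - t ^ j * (Z t).re -
        t ^ j * (explicitConst * (t - t ^ 2)) + t ^ j * D t := fun t => by ring
  simp_rw [e]
  rw [intervalIntegral.integral_add (((i1.sub i2).sub i3).sub i4) i5,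
    intervalIntegral.integral_sub ((i1.sub i2).sub i3) i4,
    intervalIntegral.integral_sub (i1.sub i2) i3, intervalIntegral.integral_sub i1 i2,
    mL, mP, mZ, mK, mD, hre, explicitConst]
  have : (j : ℝ) + 2 ≠ 0 := by positivity
  have : s ≠ 0 := by positivity
  field_simp
  rw [hs]
  ring

end TotientBound

namespace TotientBound

open Complex Metric Set Filter Topology MeasureTheory

/-- The integral of `(t - ψ t) / t ^ 2` over `[1, x]`. -/
noncomputable def smoothed (x : ℝ) : ℝ :=
  Real.log x - ∑' n : ℕ, ArithmeticFunction.vonMangoldt n * max (1 / n - 1 / x) 0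

lemma mul_exp_neg_le (y : ℝ) : y * Real.exp (-y) ≤ Real.exp (-1) := by
  have h := Real.add_one_le_exp (y - 1)
  have e : Real.exp (-1) = Real.exp (y - 1) * Real.exp (-y) := by rw [← Real.exp_add]; ring_nf
  rw [e]
  exact mul_le_mul_of_nonneg_right (by linarith) (Real.exp_pos _).le

lemma rpow_le_exp_neg_one_div {x u : ℝ} (hx : 1 < x) (hu : 0 < u) :
    (1 / x) ^ u ≤ Real.exp (-1) / Real.log x * (1 / u) := by
  have hL := Real.log_pos hx
  have h := mul_exp_neg_le (u * Real.log x)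
  rw [Real.rpow_def_of_pos (by positivity), one_div x, Real.log_inv, mul_one_div,
    div_div (Real.exp (-1)),
    le_div_iff₀ (by positivity)]
  calc _ = u * Real.log x * Real.exp (-(u * Real.log x)) := by ring_nf
    _ ≤ _ := h

/-- The oscillating part of the contribution of a zero. -/
noncomputable def zeroOsc (v : ℂ) (t : ℝ) : ℂ :=
  (mult v : ℂ) * (1 / v * ((t : ℂ) ^ (1 - rootOf v) + (t : ℂ) ^ rootOf v))

lemma norm_zeroOsc_le (v : ℂ) {x : ℝ} (hx : 1 < x) :
    ‖zeroOsc v (1 / x)‖ ≤ Real.exp (-1) / Real.log x * zeroWeight v := by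
  by_cases hv : xiQ v = 0
  swap
  · rw [zeroOsc, (mult_eq_zero_iff v).2 hv]
    have := zeroWeight_nonneg v
    have := Real.log_pos hx
    simp
    positivity
  have hb1 := half_le_re_rootOf v
  have hb2 := re_rootOf_lt_one hv
  have ha := neg_re_pos hv
  have hx0 : 0 < 1 / x := by positivity
  have hva : -v.re ≤ ‖v‖ := (neg_le_abs _).trans (abs_re_le_norm v)
  have h1 := rpow_le_exp_neg_one_div hx (u := 1 - (rootOf v).re) (by linarith)
  have h2 := rpow_le_exp_neg_one_div hx (u := (rootOf v).re) (by linarith)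
  have h3 : ‖((1 / x : ℝ) : ℂ) ^ (1 - rootOf v)‖ = (1 / x) ^ (1 - (rootOf v).re) := by
    rw [norm_cpow_eq_rpow_re_of_pos hx0, sub_re, one_re]
  have h4 : ‖((1 / x : ℝ) : ℂ) ^ rootOf v‖ = (1 / x) ^ (rootOf v).re :=
    norm_cpow_eq_rpow_re_of_pos hx0 _
  rw [zeroOsc, norm_mul, norm_natCast, norm_mul, norm_div, norm_one, zeroWeight,
    mul_left_comm (Real.exp (-1) / Real.log x)]
  refine mul_le_mul_of_nonneg_left ?_ (by positivity)
  rw [one_div ‖v‖, inv_mul_eq_div, ← mul_div_assoc]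
  refine div_le_div₀ (?_ : (0 : ℝ) ≤ _) ((norm_add_le _ _).trans ?_) ha hva
  · have := Real.log_pos hx
    have : 0 < 1 - (rootOf v).re := by linarith
    positivity
  · rw [h3, h4, mul_add]
    exact add_le_add h1 h2

lemma zeroTerm_eq (v : ℂ) {t : ℝ} (ht : 0 < t) :
    zeroTerm v t = t * zeroOsc v t - (t + t ^ 2) * ((mult v : ℂ) * (1 / v)) := by
  have h0 : (t : ℂ) ≠ 0 := by exact_mod_cast ht.ne'
  have e1 : (t : ℂ) ^ (2 - rootOf v) = t * (t : ℂ) ^ (1 - rootOf v) := by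
    rw [show 2 - rootOf v = 1 + (1 - rootOf v) by ring, cpow_add _ _ h0, cpow_one]
  have e2 : (t : ℂ) ^ (1 + rootOf v) = t * (t : ℂ) ^ rootOf v := by
    rw [cpow_add _ _ h0, cpow_one]
  rw [zeroTerm, zeroOsc, e1, e2]
  ring

lemma re_tsum_mult_div :
    (∑' v : ℂ, (mult v : ℂ) * (1 / v)).re =
      -((Real.eulerMascheroniConstant - Real.log (4 * Real.pi)) / 2 + 1) := by
  have h : Summable fun v : ℂ => (mult v : ℂ) * (1 / v) := by
    refine Summable.of_norm (summable_mult_div_norm.congr fun v => ?_)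
    rw [norm_mul, norm_natCast, norm_div, norm_one, mul_one_div]
  refine (Complex.hasSum_re h.hasSum).unique (hasSum_mult_div.neg.congr_fun fun v => ?_)
  rw [← Complex.ofReal_natCast, re_ofReal_mul, one_div, inv_re, normSq_eq_norm_sq]
  ring

lemma trivialTerm_one_div_bounds (n : ℕ) :
    0 ≤ 1 / ((2 * (n : ℝ) + 2) * (2 * n + 3)) ∧
      1 / ((2 * (n : ℝ) + 2) * (2 * n + 3)) ≤ (digammaTerm n (2 : ℝ)).re := by
  refine ⟨by positivity, ?_⟩
  have hd : (digammaTerm n (2 : ℝ)).re = 1 / ((n : ℝ) + 1) - 1 / (n + 2) := by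
    rw [digammaTerm, ← ofReal_re (1 / ((n : ℝ) + 1) - 1 / (n + 2))]
    push_cast
    rfl
  rw [hd, div_sub_div _ _ (by positivity) (by positivity),
    div_le_div_iff₀ (by positivity) (by positivity)]
  have : (0 : ℝ) ≤ n := by positivity
  nlinarith

lemma summable_trivialConst : Summable fun n : ℕ => 1 / ((2 * (n : ℝ) + 2) * (2 * n + 3)) :=
  Summable.of_nonneg_of_le (fun n => (trivialTerm_one_div_bounds n).1)
    (fun n => (trivialTerm_one_div_bounds n).2)
    (Complex.hasSum_re (hasSum_digamma (z := ((2 : ℝ) : ℂ)) (by simp))).summable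

lemma tsum_trivialConst_le : ∑' n : ℕ, 1 / ((2 * (n : ℝ) + 2) * (2 * n + 3)) ≤ 1 := by
  have h := Complex.hasSum_re (hasSum_digamma (z := ((2 : ℝ) : ℂ)) (by simp))
  refine (summable_trivialConst.tsum_le_tsum (fun n => (trivialTerm_one_div_bounds n).2)
    h.summable).trans_eq ?_
  rw [h.tsum_eq, show ((2 : ℝ) : ℂ) = 2 by norm_num, digamma_two]
  simp

/-- The limit of `smoothed`. -/
noncomputable def smoothedLimit : ℝ :=
  (Real.eulerMascheroniConstant - Real.log (4 * Real.pi)) / 2 + 1 + explicitConst -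
    ∑' n : ℕ, 1 / ((2 * (n : ℝ) + 2) * (2 * n + 3))

theorem abs_smoothed_sub_le {x : ℝ} (hx : 1 < x) :
    |smoothed x - smoothedLimit| ≤ Real.exp (-1) * 1.95 / Real.log x + 2 / x := by
  have hx0 : 0 < x := by linarith
  have hL := Real.log_pos hx
  set t : ℝ := 1 / x with ht
  have ht0 : 0 < t := by positivity
  have ht1 : t ≤ 1 := by rw [ht, div_le_one hx0]; exact hx.le
  have hlog : Real.log t = -Real.log x := by rw [ht, one_div, Real.log_inv]
  have h := explicit_formula (t := t) ⟨ht0.le, ht1⟩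
  have eP : ∑' n, primeTerm n t =
      t * ∑' n : ℕ, ArithmeticFunction.vonMangoldt n * max (1 / n - 1 / x) 0 := by
    rw [← tsum_mul_left]
    refine tsum_congr fun n => ?_
    rw [primeTerm, ← ht]; ring
  have hosc : Summable fun v => zeroOsc v t := Summable.of_norm_bounded
    (summable_zeroWeight.mul_left (Real.exp (-1) / Real.log x)) fun v => norm_zeroOsc_le v hx
  have hm : Summable fun v : ℂ => (mult v : ℂ) * (1 / v) := by
    refine Summable.of_norm (summable_mult_div_norm.congr fun v => ?_)
    rw [norm_mul, norm_natCast, norm_div, norm_one, mul_one_div]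
  have eZ : (∑' v, zeroTerm v t).re = t * (∑' v, zeroOsc v t).re +
      (t + t ^ 2) * ((Real.eulerMascheroniConstant - Real.log (4 * Real.pi)) / 2 + 1) := by
    rw [tsum_congr fun v => zeroTerm_eq v ht0, (hosc.mul_left _).tsum_sub (hm.mul_left _),
      tsum_mul_left, tsum_mul_left, sub_re, re_ofReal_mul,
      show (t : ℂ) + t ^ 2 = ((t + t ^ 2 : ℝ) : ℂ) by push_cast; rfl, re_ofReal_mul,
      re_tsum_mult_div]
    ring
  set σ := ∑' n : ℕ, 1 / ((2 * (n : ℝ) + 2) * (2 * n + 3)) with hσ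
  set τ := ∑' n : ℕ, t ^ (2 * n + 2) * (1 / ((2 * (n : ℝ) + 2) * (2 * n + 3))) with hτ
  have hle : ∀ n : ℕ, t ^ (2 * n + 2) * (1 / ((2 * (n : ℝ) + 2) * (2 * n + 3))) ≤
      1 / ((2 * (n : ℝ) + 2) * (2 * n + 3)) := fun n =>
    mul_le_of_le_one_left (trivialTerm_one_div_bounds n).1 (pow_le_one₀ ht0.le ht1)
  have hnn : ∀ n : ℕ, 0 ≤ t ^ (2 * n + 2) * (1 / ((2 * (n : ℝ) + 2) * (2 * n + 3))) := fun n =>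
    mul_nonneg (by positivity) (trivialTerm_one_div_bounds n).1
  have hτs : Summable fun n : ℕ => t ^ (2 * n + 2) * (1 / ((2 * (n : ℝ) + 2) * (2 * n + 3))) :=
    Summable.of_nonneg_of_le hnn hle summable_trivialConst
  have hτ1 : τ ≤ 1 := (hτs.tsum_le_tsum hle summable_trivialConst).trans tsum_trivialConst_le
  have hτ0 : 0 ≤ τ := tsum_nonneg hnn
  have eD : ∑' n, trivialTerm n t = t * (σ - t * τ) := by
    rw [hσ, hτ, ← tsum_mul_left (a := t),
      ← summable_trivialConst.tsum_sub (hτs.mul_left t), ← tsum_mul_left]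
    refine tsum_congr fun n => ?_
    rw [trivialTerm]
    ring
  have hn : ‖∑' v, zeroOsc v t‖ ≤ Real.exp (-1) * 1.95 / Real.log x := by
    refine (tsum_of_norm_bounded (summable_zeroWeight.mul_left
      (Real.exp (-1) / Real.log x)).hasSum fun v => norm_zeroOsc_le v hx).trans ?_
    rw [tsum_mul_left, div_mul_eq_mul_div]
    refine div_le_div_of_nonneg_right ?_ hL.le
    exact mul_le_mul_of_nonneg_left tsum_zeroWeight_le (Real.exp_pos _).le
  have hr := (abs_re_le_norm (∑' v, zeroOsc v t)).trans hn
  have hmain : smoothed x - smoothedLimit = (∑' v, zeroOsc v t).re +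
      t * ((Real.eulerMascheroniConstant - Real.log (4 * Real.pi)) / 2 + 1 - explicitConst + τ) := by
    rw [eP, eZ, eD, hlog] at h
    have h' : t * (smoothed x - smoothedLimit) = t * ((∑' v, zeroOsc v t).re +
      t * ((Real.eulerMascheroniConstant - Real.log (4 * Real.pi)) / 2 + 1 -
        explicitConst + τ)) := by
      rw [smoothed, smoothedLimit]
      linear_combination h
    exact mul_left_cancel₀ ht0.ne' h'
  have hc : |(Real.eulerMascheroniConstant - Real.log (4 * Real.pi)) / 2 + 1 - explicitConst + τ| ≤
      2 := by
    have e : Real.log (4 * Real.pi) = 2 * Real.log 2 + Real.log Real.pi := by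
      rw [Real.log_mul (by norm_num) (by positivity), Real.log_four_eq]
    have h1 : Real.log Real.pi ≤ Real.log 3 + 0.05 := by
      have h5 := Real.log_le_sub_one_of_pos (x := Real.pi / 3) (by positivity)
      rw [Real.log_div (by positivity) (by norm_num)] at h5
      have h6 := Real.pi_lt_d2
      norm_num at h6 ⊢
      linarith
    have h7 := Real.log_three_lt_d9
    have h2 := Real.log_two_lt_d9
    have h3 := log_pi_gt
    have h4 := Real.log_two_gt_d9
    rw [explicitConst, e, abs_le]
    norm_num at *
    constructor <;> linarith
  rw [hmain]
  refine (abs_add_le _ _).trans (add_le_add hr ?_)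
  rw [abs_mul, abs_of_pos ht0, ht, div_mul_eq_mul_div, one_mul]
  exact div_le_div_of_nonneg_right hc hx0.le

end TotientBound

namespace TotientBound

open Set Filter Topology ArithmeticFunction

/-- The kernel `1 / (x log x)`. -/
noncomputable def kernel (x : ℝ) : ℝ := 1 / (x * Real.log x)

/-- The weight `1 / log x + 1 / log² x`. -/
noncomputable def logWeight (x : ℝ) : ℝ := 1 / Real.log x + 1 / Real.log x ^ 2

/-- A smoothed version of the sum of `Λ n / (n log n)` up to `y`. -/
noncomputable def smoothSum (y : ℝ) : ℝ :=
  ∑ m ∈ Finset.Icc 2 ⌊y⌋₊, vonMangoldt m * (kernel m - kernel y) + 1 / Real.log y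

lemma kernel_antitone {x y : ℝ} (hx : 1 < x) (hxy : x ≤ y) : kernel y ≤ kernel x := by
  have hy : 0 ≤ y := by linarith
  have := Real.log_pos hx
  have := Real.log_le_log (by linarith) hxy
  unfold kernel
  gcongr

lemma hasDerivAt_kernel {x : ℝ} (hx : 1 < x) :
    HasDerivAt kernel (-(logWeight x / x ^ 2)) x := by
  have hx0 : x ≠ 0 := by positivity
  have hL := (Real.log_pos hx).ne'
  have h := ((hasDerivAt_id x).mul (Real.hasDerivAt_log hx0)).fun_inv (mul_ne_zero hx0 hL)
  have h2 : HasDerivAt kernel _ x := h.congr_of_eventuallyEq (.of_forall fun t => one_div _)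
  refine h2.congr_deriv ?_
  simp only [id, Pi.mul_apply, logWeight]
  field_simp

lemma hasDerivAt_inv_log {x : ℝ} (hx : 1 < x) :
    HasDerivAt (fun x => 1 / Real.log x) (-(1 / (x * Real.log x ^ 2))) x := by
  have hx0 : x ≠ 0 := by positivity
  have hL := (Real.log_pos hx).ne'
  have h := (Real.hasDerivAt_log hx0).fun_inv hL
  simp only [one_div]
  refine h.congr_deriv ?_
  field_simp

lemma hasDerivAt_logWeight {x : ℝ} (hx : 1 < x) :
    HasDerivAt logWeight (-(1 / (x * Real.log x ^ 2) + 2 / (x * Real.log x ^ 3))) x := by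
  have hx0 : x ≠ 0 := by positivity
  have hL := (Real.log_pos hx).ne'
  have h1 := hasDerivAt_inv_log hx
  have h2 : HasDerivAt logWeight _ x := (h1.add (h1.fun_pow 2)).congr_of_eventuallyEq
    (.of_forall fun t => by simp [logWeight])
  refine h2.congr_deriv ?_
  push_cast
  field_simp
  ring

lemma natCast_le_of_mem {m : ℕ} {x : ℝ} (hx : 0 ≤ x) (h : m ∈ Finset.Icc 2 ⌊x⌋₊) :
    1 < (m : ℝ) ∧ (m : ℝ) ≤ x := by
  obtain ⟨h1, h2⟩ := Finset.mem_Icc.1 h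
  exact ⟨by exact_mod_cast h1, (Nat.le_floor_iff hx).1 h2⟩

lemma sum_mul_max_eq {F : ℝ → ℝ} (hF : ∀ x y : ℝ, 1 < x → x ≤ y → F y ≤ F x) {x : ℝ} (hx : 1 < x)
    {M : ℕ} (hM : ⌊x⌋₊ ≤ M) :
    ∑ m ∈ Finset.Icc 2 M, vonMangoldt m * max (F m - F x) 0 =
      ∑ m ∈ Finset.Icc 2 ⌊x⌋₊, vonMangoldt m * (F m - F x) := by
  symm
  rw [← Finset.sum_subset (Finset.Icc_subset_Icc_right hM)]
  · refine Finset.sum_congr rfl fun m hm => ?_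
    obtain ⟨h1, h2⟩ := natCast_le_of_mem (by linarith) hm
    rw [max_eq_left (by linarith [hF _ _ h1 h2])]
  · intro m hm hm'
    have h1 : 2 ≤ m := (Finset.mem_Icc.1 hm).1
    have h2 : ⌊x⌋₊ < m := by
      by_contra! h
      exact hm' (Finset.mem_Icc.2 ⟨h1, h⟩)
    rw [max_eq_right (by linarith [hF _ _ hx ((Nat.floor_lt (by linarith)).1 h2).le]), mul_zero]

lemma inv_antitone {x y : ℝ} (hx : 1 < x) (hxy : x ≤ y) : 1 / y ≤ 1 / x :=
  one_div_le_one_div_of_le (by linarith) hxy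

lemma smoothed_eq {x : ℝ} (hx : 1 < x) :
    smoothed x =
      Real.log x - ∑ m ∈ Finset.Icc 2 ⌊x⌋₊, vonMangoldt m * (1 / (m : ℝ) - 1 / x) := by
  rw [smoothed, ← sum_mul_max_eq (F := fun x => 1 / x) (fun _ _ => inv_antitone) hx le_rfl,
    tsum_eq_sum]
  intro m hm
  rcases Nat.lt_or_ge m 2 with h | h
  · interval_cases m <;> simp
  · have h2 : ⌊x⌋₊ < m := by
      by_contra! h'
      exact hm (Finset.mem_Icc.2 ⟨h, h'⟩)
    rw [max_eq_right (by
      linarith [inv_antitone hx ((Nat.floor_lt (by linarith)).1 h2).le]), mul_zero]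

/-- `smoothSum` corrected so as to be differentiable. -/
noncomputable def correctedSum (x : ℝ) : ℝ :=
  smoothSum x - Real.log (Real.log x) + logWeight x * (smoothed x - smoothedLimit)

lemma continuousOn_correctedSum {a b : ℝ} (ha : 1 < a) : ContinuousOn correctedSum (Icc a b) := by
  have hlog : ContinuousOn Real.log (Icc a b) := fun x hx =>
    (Real.continuousAt_log (by linarith [hx.1])).continuousWithinAt
  have hpos : ∀ x ∈ Icc a b, Real.log x ≠ 0 := fun x hx => (Real.log_pos (by linarith [hx.1])).ne'
  have hk : ContinuousOn kernel (Icc a b) := fun x hx =>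
    (hasDerivAt_kernel (by linarith [hx.1])).continuousAt.continuousWithinAt
  have hw : ContinuousOn logWeight (Icc a b) := fun x hx =>
    (hasDerivAt_logWeight (by linarith [hx.1])).continuousAt.continuousWithinAt
  have hil : ContinuousOn (fun x => 1 / Real.log x) (Icc a b) := continuousOn_const.div hlog hpos
  have hinv : ContinuousOn (fun x : ℝ => 1 / x) (Icc a b) :=
    continuousOn_const.div continuousOn_id fun x hx => by
      have := hx.1
      exact (show 0 < x by linarith).ne'
  have hfloor : ∀ x ∈ Icc a b, ⌊x⌋₊ ≤ ⌊b⌋₊ := fun x hx => Nat.floor_mono hx.2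
  have c1 : ContinuousOn smoothSum (Icc a b) := by
    have hs : ContinuousOn (fun x => ∑ m ∈ Finset.Icc 2 ⌊b⌋₊, vonMangoldt m *
        max (kernel m - kernel x) 0) (Icc a b) :=
      continuousOn_finsetSum _ fun m _ => continuousOn_const.mul
        (ContinuousOn.sup (f := fun x => kernel m - kernel x) (continuousOn_const.sub hk)
          continuousOn_const)
    have : ContinuousOn (fun x => ∑ m ∈ Finset.Icc 2 ⌊b⌋₊, vonMangoldt m *
        max (kernel m - kernel x) 0 + 1 / Real.log x) (Icc a b) := hs.add hil
    refine this.congr fun x hx => ?_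
    beta_reduce
    rw [sum_mul_max_eq (F := kernel) (fun _ _ => kernel_antitone) (by linarith [hx.1])
      (hfloor x hx), smoothSum]
  have c2 : ContinuousOn smoothed (Icc a b) := by
    have hs : ContinuousOn (fun x => ∑ m ∈ Finset.Icc 2 ⌊b⌋₊, vonMangoldt m *
        max (1 / (m : ℝ) - 1 / x) 0) (Icc a b) :=
      continuousOn_finsetSum _ fun m _ => continuousOn_const.mul
        (ContinuousOn.sup (f := fun x => 1 / (m : ℝ) - 1 / x) (continuousOn_const.sub hinv)
          continuousOn_const)
    have : ContinuousOn (fun x => Real.log x - ∑ m ∈ Finset.Icc 2 ⌊b⌋₊, vonMangoldt m *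
        max (1 / (m : ℝ) - 1 / x) 0) (Icc a b) := hlog.sub hs
    refine this.congr fun x hx => ?_
    beta_reduce
    rw [sum_mul_max_eq (F := fun x => 1 / x) (fun _ _ => inv_antitone) (by linarith [hx.1])
      (hfloor x hx), smoothed_eq (by linarith [hx.1])]
  exact (c1.sub (hlog.log hpos)).add (hw.mul (c2.sub continuousOn_const))

lemma hasDerivWithinAt_correctedSum {x : ℝ} (hx : 1 < x) :
    HasDerivWithinAt correctedSum
      (-(1 / (x * Real.log x ^ 2) + 2 / (x * Real.log x ^ 3)) * (smoothed x - smoothedLimit))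
      (Ici x) x := by
  have hx0 : x ≠ 0 := by positivity
  have hL := (Real.log_pos hx).ne'
  set S := Finset.Icc 2 ⌊x⌋₊ with hS
  have hk := hasDerivAt_kernel hx
  have hw := hasDerivAt_logWeight hx
  have hil := hasDerivAt_inv_log hx
  have hlog := Real.hasDerivAt_log hx0
  have hll := hlog.log hL
  have hinv : HasDerivAt (fun x : ℝ => 1 / x) (-1 / x ^ 2) x := by
    simpa using (hasDerivAt_id x).fun_inv hx0
  have h1 : HasDerivAt (fun t => ∑ m ∈ S, vonMangoldt m * (kernel m - kernel t))
      (∑ m ∈ S, vonMangoldt m * (logWeight x / x ^ 2)) x :=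
    HasDerivAt.fun_sum fun m _ => ((hk.const_sub _).congr_deriv (neg_neg _)).const_mul _
  have h2 : HasDerivAt (fun t => ∑ m ∈ S, vonMangoldt m * (1 / (m : ℝ) - 1 / t))
      (∑ m ∈ S, vonMangoldt m * (1 / x ^ 2)) x :=
    HasDerivAt.fun_sum fun m _ => ((hinv.const_sub _).congr_deriv (by ring)).const_mul _
  have h : HasDerivAt (fun t => ∑ m ∈ S, vonMangoldt m * (kernel m - kernel t) +
      1 / Real.log t - Real.log (Real.log t) + logWeight t * (Real.log t -
        ∑ m ∈ S, vonMangoldt m * (1 / (m : ℝ) - 1 / t) - smoothedLimit)) _ x :=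
    ((h1.add hil).sub hll).add (hw.mul ((hlog.sub h2).sub_const smoothedLimit))
  have heq : ∀ t ∈ Ico x (⌊x⌋₊ + 1), correctedSum t =
      ∑ m ∈ S, vonMangoldt m * (kernel m - kernel t) + 1 / Real.log t - Real.log (Real.log t) +
        logWeight t * (Real.log t - ∑ m ∈ S, vonMangoldt m * (1 / (m : ℝ) - 1 / t) -
          smoothedLimit) := by
    intro t ht
    have hf : ⌊t⌋₊ = ⌊x⌋₊ :=
      (Nat.floor_eq_iff (by linarith [ht.1])).2
        ⟨(Nat.floor_le (by linarith)).trans ht.1, ht.2⟩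
    rw [correctedSum, smoothSum, smoothed_eq (by linarith [ht.1]), hf]
  have hmem : x ∈ Ico x (⌊x⌋₊ + 1 : ℝ) := ⟨le_rfl, Nat.lt_floor_add_one x⟩
  have hev : ∀ᶠ t in 𝓝[≥] x, t ∈ Ico x (⌊x⌋₊ + 1 : ℝ) :=
    Ico_mem_nhdsGE (Nat.lt_floor_add_one x)
  have h' := (h.hasDerivWithinAt (s := Ici x)).congr_of_eventuallyEq
    (f₁ := correctedSum) (hev.mono fun t ht => heq t ht) (heq x hmem)
  refine h'.congr_deriv ?_
  rw [smoothed_eq hx, ← Finset.sum_mul, ← Finset.sum_mul]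
  rw [logWeight]
  field_simp
  ring

/-- The bound for the tail of the prime sums. -/
noncomputable def tailBound (x : ℝ) : ℝ :=
  Real.exp (-1) * 1.95 * (1 / (2 * Real.log x ^ 2) + 2 / (3 * Real.log x ^ 3)) +
    2 * logWeight x / x

lemma hasDerivAt_tailBound {x : ℝ} (hx : 1 < x) :
    HasDerivAt tailBound (-((1 / (x * Real.log x ^ 2) + 2 / (x * Real.log x ^ 3)) *
      (Real.exp (-1) * 1.95 / Real.log x + 2 / x) + 2 * logWeight x / x ^ 2)) x := by
  have hx0 : x ≠ 0 := by positivity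
  have hL := (Real.log_pos hx).ne'
  have h1 := hasDerivAt_inv_log hx
  have h2 := ((((h1.fun_pow 2).const_mul (1 / 2)).add ((h1.fun_pow 3).const_mul (2 / 3))).const_mul
    (Real.exp (-1) * 1.95)).add
    (((hasDerivAt_logWeight hx).const_mul 2).div (hasDerivAt_id x) hx0)
  have h3 : HasDerivAt tailBound _ x := h2.congr_of_eventuallyEq (.of_forall fun t => by
    simp only [tailBound, Pi.add_apply, Pi.div_apply, id]
    ring)
  refine h3.congr_deriv ?_
  simp only [id]
  push_cast
  field_simp
  ring

lemma logWeight_nonneg {x : ℝ} (hx : 1 < x) : 0 ≤ logWeight x := by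
  have := Real.log_pos hx
  unfold logWeight
  positivity

lemma tailBound_nonneg {x : ℝ} (hx : 1 < x) : 0 ≤ tailBound x := by
  have := Real.log_pos hx
  have := logWeight_nonneg hx
  unfold tailBound
  positivity

lemma abs_correctedSum_sub_le {y Y : ℝ} (hy : 1 < y) (hY : y ≤ Y) :
    |correctedSum Y - correctedSum y| ≤ tailBound y := by
  have h := image_norm_le_of_norm_deriv_right_le_deriv_boundary'
    (f := fun x => correctedSum x - correctedSum y) (a := y) (b := Y)
    (B := fun x => tailBound y - tailBound x)
    ((continuousOn_correctedSum hy).sub continuousOn_const)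
    (fun x hx => (hasDerivWithinAt_correctedSum (by linarith [hx.1])).sub_const _)
    (by simp)
    (fun x hx => ((hasDerivAt_tailBound (by linarith [hx.1])).const_sub
      _).continuousAt.continuousWithinAt)
    (fun x hx => ((hasDerivAt_tailBound (by linarith [hx.1])).const_sub _).hasDerivWithinAt)
    (fun x hx => ?_) ⟨hY, le_rfl⟩
  · have := tailBound_nonneg (x := Y) (by linarith)
    rw [Real.norm_eq_abs] at h
    linarith
  · have hx1 : 1 < x := by linarith [hx.1]
    have hL := Real.log_pos hx1
    have hw := logWeight_nonneg hx1
    have hA : 0 ≤ 1 / (x * Real.log x ^ 2) + 2 / (x * Real.log x ^ 3) := by positivity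
    rw [norm_mul, norm_neg, Real.norm_of_nonneg hA, neg_neg, Real.norm_eq_abs]
    refine (mul_le_mul_of_nonneg_left (abs_smoothed_sub_le hx1) hA).trans ?_
    have : 0 ≤ 2 * logWeight x / x ^ 2 := by positivity
    linarith

end TotientBound

namespace TotientBound

open Set Filter Topology ArithmeticFunction MeasureTheory

/-- The summand `Λ n / (n log n)`. -/
noncomputable def primePowerWeight (n : ℕ) : ℝ := vonMangoldt n * kernel n

lemma primePowerWeight_nonneg (n : ℕ) : 0 ≤ primePowerWeight n :=
  mul_nonneg vonMangoldt_nonneg (by unfold kernel; positivity)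

/-- The sum of `Λ n / (n log n)` over `log n ≤ u`. -/
noncomputable def primePowerSum (u : ℝ) : ℝ := ∑ n ∈ Finset.Icc 2 ⌊Real.exp u⌋₊, primePowerWeight n

lemma primePowerSum_nonneg (u : ℝ) : 0 ≤ primePowerSum u :=
  Finset.sum_nonneg fun n _ => primePowerWeight_nonneg n

lemma primePowerSum_mono : Monotone primePowerSum := fun _ _ h =>
  Finset.sum_le_sum_of_subset_of_nonneg
    (Finset.Icc_subset_Icc_right (Nat.floor_mono (Real.exp_le_exp.2 h)))
    fun n _ _ => primePowerWeight_nonneg n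

lemma hasSum_primePowerSum (u : ℝ) :
    HasSum (fun n : ℕ => if Real.log n ≤ u then primePowerWeight n else 0) (primePowerSum u) := by
  have h : primePowerSum u = ∑ n ∈ Finset.Icc 2 ⌊Real.exp u⌋₊,
      if Real.log n ≤ u then primePowerWeight n else 0 := by
    refine Finset.sum_congr rfl fun n hn => ?_
    obtain ⟨h1, h2⟩ := natCast_le_of_mem (Real.exp_pos u).le hn
    rw [if_pos ((Real.log_le_iff_le_exp (by linarith)).2 h2)]
  rw [h]
  refine hasSum_sum_of_ne_finset_zero fun n hn => ?_
  rcases Nat.lt_or_ge n 2 with h2 | h2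
  · interval_cases n <;> simp [primePowerWeight]
  · rw [if_neg]
    intro h3
    refine hn (Finset.mem_Icc.2 ⟨h2, Nat.le_floor ?_⟩)
    exact (Real.log_le_iff_le_exp (by positivity)).1 h3

lemma summable_primePowerWeight_mul {δ : ℝ} (hδ : 0 < δ) :
    Summable fun n : ℕ => primePowerWeight n * Real.exp (-(δ * Real.log n)) := by
  refine Summable.of_nonneg_of_le
    (fun n => mul_nonneg (primePowerWeight_nonneg n) (Real.exp_pos _).le) (fun n => ?_)
    (Real.summable_nat_rpow.2 (show -(1 + δ) < -1 by linarith))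
  rcases Nat.lt_or_ge n 2 with h2 | h2
  · interval_cases n <;> simp [primePowerWeight]; positivity
  have hn : (1 : ℝ) < n := by exact_mod_cast h2
  have hn0 : (0 : ℝ) < n := by linarith
  have hL := Real.log_pos hn
  have h1 : primePowerWeight n ≤ (n : ℝ)⁻¹ := by
    rw [primePowerWeight, kernel, mul_one_div, div_le_iff₀ (by positivity)]
    have := vonMangoldt_le_log (n := n)
    field_simp
    exact this
  calc _ ≤ (n : ℝ)⁻¹ * Real.exp (-(δ * Real.log n)) := by gcongr
    _ = _ := by
      rw [Real.rpow_def_of_pos hn0]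
      nth_rw 1 [← Real.exp_log hn0]
      rw [← Real.exp_neg, ← Real.exp_add]
      congr 1; ring

lemma tsum_primePowerWeight_mul {δ : ℝ} (hδ : 0 < δ) :
    ∑' n : ℕ, primePowerWeight n * Real.exp (-(δ * Real.log n)) =
      Real.log (riemannZeta ((1 + δ : ℝ) : ℂ)).re := by
  rw [log_riemannZeta_eq (by linarith)]
  refine tsum_congr fun n => ?_
  rcases Nat.eq_zero_or_pos n with rfl | hn
  · simp [primePowerWeight]
  have hn0 : (0 : ℝ) < n := by exact_mod_cast hn
  rw [primePowerWeight, kernel, Real.rpow_add hn0, Real.rpow_one, Real.rpow_def_of_pos hn0,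
    mul_comm δ, Real.exp_neg]
  have := (Real.exp_pos (Real.log n * δ)).ne'
  field_simp

lemma integral_primePowerSum {δ : ℝ} (hδ : 0 < δ) :
    ∫ v in Ioi (0 : ℝ), Real.exp (-v) * primePowerSum (v / δ) =
      Real.log (riemannZeta ((1 + δ : ℝ) : ℂ)).re := by
  rw [← tsum_primePowerWeight_mul hδ]
  have hset : ∀ n : ℕ, (Ioi (0 : ℝ) ∩ Ici (δ * Real.log n) : Set ℝ) =ᵐ[volume]
      Ioi (δ * Real.log n) := by
    intro n
    have h0 : 0 ≤ δ * Real.log n := mul_nonneg hδ.le (Real.log_natCast_nonneg n)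
    have : Ioi (0 : ℝ) ∩ Ioi (δ * Real.log n) = Ioi (δ * Real.log n) :=
      inter_eq_right.2 (Ioi_subset_Ioi h0)
    exact (ae_eq_set_inter (ae_eq_refl _) Ioi_ae_eq_Ici.symm).trans (.of_eq this)
  set F : ℕ → ℝ → ℝ := fun n => (Ici (δ * Real.log n)).indicator
    (fun v => primePowerWeight n * Real.exp (-v)) with hF
  have hInt : ∀ n, Integrable (F n) (volume.restrict (Ioi 0)) := fun n =>
    ((integrableOn_exp_neg_Ioi 0).const_mul _).indicator measurableSet_Ici
  have hval : ∀ n, ∫ v in Ioi 0, F n v = primePowerWeight n * Real.exp (-(δ * Real.log n)) := by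
    intro n
    rw [hF, setIntegral_indicator measurableSet_Ici, setIntegral_congr_set (hset n),
      integral_const_mul, integral_exp_neg_Ioi]
  have hnn : ∀ n v, 0 ≤ F n v := fun n v => indicator_nonneg
    (fun v _ => mul_nonneg (primePowerWeight_nonneg n) (Real.exp_pos _).le) _
  have h := hasSum_integral_of_summable_integral_norm hInt (by
    simp only [Real.norm_of_nonneg (hnn _ _), hval]
    exact summable_primePowerWeight_mul hδ)
  rw [tsum_congr fun n => (hval n).symm, h.tsum_eq]
  refine setIntegral_congr_fun measurableSet_Ioi fun v hv => ?_
  rw [← ((hasSum_primePowerSum (v / δ)).mul_left (Real.exp (-v))).tsum_eq]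
  refine tsum_congr fun n => ?_
  simp only [hF, indicator, mem_Ici, le_div_iff₀ hδ, mul_comm δ]
  split_ifs <;> ring

lemma integral_exp_mul_log :
    IntegrableOn (fun v => Real.exp (-v) * Real.log v) (Ioi 0) ∧
      ∫ v in Ioi (0 : ℝ), Real.exp (-v) * Real.log v = -Real.eulerMascheroniConstant := by
  have hc : Continuous fun v : ℝ => Real.exp (-v) := by fun_prop
  have h := mellin_hasDerivAt_of_isBigO_rpow (E := ℂ) (a := 2) (b := 0) (s := 1)
    (f := fun v : ℝ => (Real.exp (-v) : ℂ))
    ((Complex.continuous_ofReal.comp hc).continuousOn.locallyIntegrableOn measurableSet_Ioi)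
    (by
      rw [← Asymptotics.isBigO_norm_left]
      simp_rw [Complex.norm_real, Asymptotics.isBigO_norm_left]
      simpa only [neg_one_mul] using (isLittleO_exp_neg_mul_rpow_atTop zero_lt_one _).isBigO)
    (by norm_num)
    (by
      simp_rw [neg_zero, Real.rpow_zero]
      refine Asymptotics.isBigO_const_of_tendsto (?_ : Tendsto _ _ (𝓝 (1 : ℂ))) one_ne_zero
      rw [(by simp : (1 : ℂ) = Real.exp (-0))]
      exact (Complex.continuous_ofReal.comp hc).continuousWithinAt)
    (by norm_num)
  have hfun : ∀ v : ℝ, ((v : ℂ) ^ ((1 : ℂ) - 1) • (Real.log v • (Real.exp (-v) : ℂ))) =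
      ((Real.exp (-v) * Real.log v : ℝ) : ℂ) := by
    intro v
    simp only [sub_self, Complex.cpow_zero, one_smul, Complex.real_smul]
    push_cast; ring
  have hi : IntegrableOn (fun v => Real.exp (-v) * Real.log v) (Ioi 0) := by
    have := h.1
    unfold MellinConvergent at this
    simp only [hfun] at this
    simpa only [RCLike.re_to_complex, Complex.ofReal_re, IntegrableOn] using this.re
  refine ⟨hi, ?_⟩
  have h1 := Complex.hasDerivAt_GammaIntegral (s := 1) (by simp)
  have h2 := Complex.hasDerivAt_Gamma_one
  have h3 : Complex.Gamma =ᶠ[𝓝 1] Complex.GammaIntegral := by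
    have : IsOpen {s : ℂ | 0 < s.re} := isOpen_lt continuous_const Complex.continuous_re
    filter_upwards [this.mem_nhds (by simp : (1 : ℂ) ∈ {s : ℂ | 0 < s.re})] with s hs
      using Complex.Gamma_eq_integral hs
  have h4 := h1.unique (h2.congr_of_eventuallyEq h3.symm)
  have h5 : ∀ v : ℝ, ((v : ℂ) ^ ((1 : ℂ) - 1) * ((Real.log v : ℂ) * (Real.exp (-v) : ℂ))) =
      ((Real.exp (-v) * Real.log v : ℝ) : ℂ) := by
    intro v
    simp only [sub_self, Complex.cpow_zero]
    push_cast; ring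
  simp only [h5] at h4
  rw [integral_complex_ofReal] at h4
  exact_mod_cast h4

lemma eq_eulerMascheroni_of_tendsto {c : ℝ}
    (hT : Tendsto (fun u => primePowerSum u - Real.log u) atTop (𝓝 c)) :
    c = Real.eulerMascheroniConstant := by
  obtain ⟨hlogi, hlog⟩ := integral_exp_mul_log
  obtain ⟨C, hC0, hC⟩ : ∃ C, 0 ≤ C ∧ ∀ u, 0 < u →
      |primePowerSum u - Real.log u| ≤ C + |Real.log (min u 1)| := by
    have h1 : ∀ᶠ u in atTop, |primePowerSum u - Real.log u| ≤ |c| + 1 :=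
      (hT.abs.eventually (Iio_mem_nhds (lt_add_one |c|))).mono fun u hu => le_of_lt hu
    obtain ⟨U, hU⟩ := eventually_atTop.1 h1
    set V := max U 1
    have hV : 1 ≤ V := le_max_right _ _
    have hV2 := Real.log_nonneg hV
    have hV3 := primePowerSum_nonneg V
    have := abs_nonneg c
    refine ⟨|c| + 1 + primePowerSum V + Real.log V, by positivity, fun u hu => ?_⟩
    have := abs_nonneg (Real.log (min u 1))
    rcases le_or_gt V u with h | h
    · linarith [hU u ((le_max_left _ _).trans h)]
    · have h2 := primePowerSum_mono h.le
      have h3 := primePowerSum_nonneg u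
      rcases le_or_gt 1 u with h4 | h4
      · have h5 := Real.log_nonneg h4
        have h6 := Real.log_le_log hu h.le
        rw [abs_le]; constructor <;> linarith
      · rw [min_eq_left h4.le] at *
        have h5 := abs_sub (primePowerSum u) (Real.log u)
        rw [abs_of_nonneg h3] at h5
        linarith
  set G : ℕ → ℝ → ℝ := fun k v => Real.exp (-v) *
    (primePowerSum (v / (1 / (k + 1 : ℝ))) - Real.log (v / (1 / (k + 1 : ℝ)))) with hG
  have hGm : ∀ k, Measurable (G k) := fun k => by
    have := primePowerSum_mono.measurable
    simp only [hG]
    fun_prop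
  have hbi : IntegrableOn (fun v => Real.exp (-v) * C + ‖Real.exp (-v) * Real.log v‖) (Ioi 0) :=
    ((integrableOn_exp_neg_Ioi 0).mul_const C).add hlogi.norm
  have hbound : ∀ k, ∀ᵐ v ∂(volume.restrict (Ioi (0 : ℝ))),
      ‖G k v‖ ≤ Real.exp (-v) * C + ‖Real.exp (-v) * Real.log v‖ := by
    intro k
    filter_upwards [ae_restrict_mem measurableSet_Ioi] with v hv
    have hv0 : (0 : ℝ) < v := hv
    have hk : (0 : ℝ) ≤ k := Nat.cast_nonneg k
    have hvk : v ≤ v / (1 / (k + 1 : ℝ)) := by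
      rw [div_div_eq_mul_div, div_one]; nlinarith
    have h := hC (v / (1 / (k + 1 : ℝ))) (by positivity)
    have h2 : |Real.log (min (v / (1 / (k + 1 : ℝ))) 1)| ≤ |Real.log v| := by
      rcases le_or_gt 1 (v / (1 / (k + 1 : ℝ))) with h4 | h4
      · rw [min_eq_right h4]; simp
      · rw [min_eq_left h4.le, abs_of_neg (Real.log_neg (by positivity) h4),
          abs_of_neg (Real.log_neg hv0 (hvk.trans_lt h4))]
        linarith [Real.log_le_log hv0 hvk]
    simp only [hG, norm_mul, Real.norm_eq_abs, abs_of_pos (Real.exp_pos (-v))]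
    rw [← mul_add]
    exact mul_le_mul_of_nonneg_left (h.trans (by linarith)) (Real.exp_pos _).le
  have hlim : ∀ᵐ v ∂(volume.restrict (Ioi (0 : ℝ))),
      Tendsto (fun k => G k v) atTop (𝓝 (Real.exp (-v) * c)) := by
    filter_upwards [ae_restrict_mem measurableSet_Ioi] with v hv
    refine Tendsto.const_mul _ (hT.comp ?_)
    have : (fun k : ℕ => v / (1 / (k + 1 : ℝ))) = fun k : ℕ => v * ((k : ℝ) + 1) := by
      ext k; rw [div_div_eq_mul_div, div_one]
    rw [this]
    exact Tendsto.const_mul_atTop hv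
      (tendsto_atTop_add_const_right _ _ tendsto_natCast_atTop_atTop)
  have hdct := tendsto_integral_of_dominated_convergence _
    (fun k => (hGm k).aestronglyMeasurable) hbi hbound hlim
  rw [integral_mul_const, integral_exp_neg_Ioi_zero, one_mul] at hdct
  have hval : ∀ k : ℕ, ∫ v in Ioi (0 : ℝ), G k v =
      Real.log (riemannZeta ((1 + 1 / (k + 1 : ℝ) : ℝ) : ℂ)).re + Real.log (1 / (k + 1 : ℝ)) +
        Real.eulerMascheroniConstant := by
    intro k
    have hk : (0 : ℝ) < 1 / (k + 1 : ℝ) := by positivity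
    have i1 : IntegrableOn (G k) (Ioi 0) :=
      Integrable.mono' hbi (hGm k).aestronglyMeasurable (hbound k)
    have i2 : IntegrableOn (fun v => Real.exp (-v) * Real.log v -
        Real.exp (-v) * Real.log (1 / (k + 1 : ℝ))) (Ioi 0) :=
      hlogi.sub ((integrableOn_exp_neg_Ioi 0).mul_const _)
    have heq : ∫ v in Ioi (0 : ℝ), Real.exp (-v) * primePowerSum (v / (1 / (k + 1 : ℝ))) =
        ∫ v in Ioi (0 : ℝ), (G k v + (Real.exp (-v) * Real.log v -
          Real.exp (-v) * Real.log (1 / (k + 1 : ℝ)))) := by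
      refine setIntegral_congr_fun measurableSet_Ioi fun v hv => ?_
      have hv0 : v ≠ 0 := ne_of_gt hv
      simp only [hG]
      rw [Real.log_div hv0 hk.ne']
      ring
    rw [integral_primePowerSum hk, integral_add i1 i2,
      integral_sub hlogi ((integrableOn_exp_neg_Ioi 0).mul_const _), hlog, integral_mul_const,
      integral_exp_neg_Ioi_zero] at heq
    linarith
  simp only [hval] at hdct
  have hz := (Asymptotics.isLittleO_one_iff ℝ).1 log_riemannZeta_add_log_sub_isLittleO_ofReal
  have hs : Tendsto (fun k : ℕ => 1 + 1 / (k + 1 : ℝ)) atTop (𝓝[>] 1) := by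
    refine tendsto_nhdsWithin_iff.2 ⟨?_, .of_forall fun k => ?_⟩
    · simpa using tendsto_one_div_add_atTop_nhds_zero_nat.const_add (1 : ℝ)
    · have : (0 : ℝ) < 1 / (k + 1 : ℝ) := by positivity
      exact lt_add_of_pos_right _ this
  have h1 := (hz.comp hs).add_const Real.eulerMascheroniConstant
  rw [zero_add] at h1
  refine tendsto_nhds_unique hdct (h1.congr fun k => ?_)
  simp

lemma tendsto_inv_log_pow (k : ℕ) (hk : k ≠ 0) :
    Tendsto (fun x => 1 / Real.log x ^ k) atTop (𝓝 0) := by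
  simp only [one_div]
  exact ((tendsto_pow_atTop hk).comp Real.tendsto_log_atTop).inv_tendsto_atTop

lemma tendsto_logWeight : Tendsto logWeight atTop (𝓝 0) := by
  have h := (tendsto_inv_log_pow 1 one_ne_zero).add (tendsto_inv_log_pow 2 two_ne_zero)
  simp only [pow_one, add_zero] at h
  exact h

lemma tendsto_tailBound : Tendsto tailBound atTop (𝓝 0) := by
  have h1 := (((tendsto_inv_log_pow 2 two_ne_zero).const_mul (1 / 2)).add
    ((tendsto_inv_log_pow 3 three_ne_zero).const_mul (2 / 3))).const_mul (Real.exp (-1) * 1.95)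
  have h2 := (tendsto_logWeight.const_mul 2).mul tendsto_inv_atTop_zero
  have h := h1.add h2
  simp only [mul_zero, add_zero] at h
  refine h.congr fun x => ?_
  rw [tailBound]
  ring

lemma smoothSum_eq {y : ℝ} (hy : 1 < y) :
    smoothSum y = primePowerSum (Real.log y) - kernel y * Chebyshev.psi y + 1 / Real.log y := by
  rw [smoothSum, primePowerSum, Real.exp_log (by linarith), Chebyshev.psi_eq_sum_Icc,
    Finset.mul_sum]
  have h : ∑ n ∈ Finset.Icc 0 ⌊y⌋₊, kernel y * vonMangoldt n =
      ∑ n ∈ Finset.Icc 2 ⌊y⌋₊, kernel y * vonMangoldt n := by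
    symm
    refine Finset.sum_subset (Finset.Icc_subset_Icc_left (by norm_num)) fun n hn hn' => ?_
    have : n < 2 := by
      by_contra! h
      exact hn' (Finset.mem_Icc.2 ⟨h, (Finset.mem_Icc.1 hn).2⟩)
    interval_cases n <;> simp
  rw [h, ← Finset.sum_sub_distrib]
  congr 1
  refine Finset.sum_congr rfl fun n _ => ?_
  rw [primePowerWeight]
  ring

lemma tendsto_kernel_mul_psi : Tendsto (fun y => kernel y * Chebyshev.psi y) atTop (𝓝 0) := by
  have h := (tendsto_inv_log_pow 1 one_ne_zero).const_mul (Real.log 4 + 4)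
  rw [mul_zero] at h
  refine squeeze_zero' ?_ ?_ h
  · filter_upwards [eventually_gt_atTop 1] with y hy
    have := Real.log_pos hy
    have := Chebyshev.psi_nonneg y
    unfold kernel
    positivity
  · filter_upwards [eventually_gt_atTop 1] with y hy
    have hL := Real.log_pos hy
    have h1 := Chebyshev.psi_le_const_mul_self (x := y) (by linarith)
    rw [kernel, pow_one, one_div_mul_eq_div, mul_one_div,
      div_le_div_iff₀ (by positivity) hL]
    calc _ ≤ ((Real.log 4 + 4) * y) * Real.log y := by gcongr
      _ = _ := by ring

lemma tendsto_correctedSum :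
    Tendsto correctedSum atTop (𝓝 Real.eulerMascheroniConstant) := by
  have hcau : CauchySeq correctedSum := by
    refine Metric.cauchySeq_iff'.2 fun ε hε => ?_
    obtain ⟨y, h1, h2⟩ := ((eventually_gt_atTop 1).and
      (tendsto_tailBound.eventually (Iio_mem_nhds hε))).exists
    exact ⟨y, fun Y hY => (abs_correctedSum_sub_le h1 hY).trans_lt h2⟩
  obtain ⟨c, hc⟩ := cauchySeq_tendsto_of_complete hcau
  have hw : Tendsto (fun x => logWeight x * (smoothed x - smoothedLimit)) atTop (𝓝 0) := by
    have h0 : Tendsto (fun x => logWeight x *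
        (Real.exp (-1) * 1.95 * (1 / Real.log x ^ 1) + 2 * x⁻¹)) atTop (𝓝 0) := by
      simpa using tendsto_logWeight.mul (((tendsto_inv_log_pow 1 one_ne_zero).const_mul
        (Real.exp (-1) * 1.95)).add (tendsto_inv_atTop_zero.const_mul 2))
    refine squeeze_zero_norm' ?_ h0
    filter_upwards [eventually_gt_atTop 1] with x hx
    rw [norm_mul, Real.norm_of_nonneg (logWeight_nonneg hx), Real.norm_eq_abs]
    refine mul_le_mul_of_nonneg_left ((abs_smoothed_sub_le hx).trans_eq ?_) (logWeight_nonneg hx)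
    ring
  have hS : Tendsto (fun u => primePowerSum u - Real.log u) atTop (𝓝 c) := by
    have h1 := (((hc.sub hw).add tendsto_kernel_mul_psi).sub
      (tendsto_inv_log_pow 1 one_ne_zero)).comp Real.tendsto_exp_atTop
    simp only [sub_zero, add_zero] at h1
    refine h1.congr' ?_
    filter_upwards [eventually_gt_atTop 0] with u hu
    have := smoothSum_eq (Real.one_lt_exp_iff.2 hu)
    simp only [Function.comp, correctedSum, Real.log_exp, pow_one] at this ⊢
    linarith
  rwa [eq_eulerMascheroni_of_tendsto hS] at hc

/-- Mertens' theorem with an explicit error term. -/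
theorem abs_smoothSum_sub_le {y : ℝ} (hy : 1 < y) :
    |smoothSum y - Real.log (Real.log y) - Real.eulerMascheroniConstant| ≤
      tailBound y + logWeight y * (Real.exp (-1) * 1.95 / Real.log y + 2 / y) := by
  have h1 : |Real.eulerMascheroniConstant - correctedSum y| ≤ tailBound y :=
    le_of_tendsto (tendsto_correctedSum.sub_const _).abs
      ((eventually_ge_atTop y).mono fun Y hY => abs_correctedSum_sub_le hy hY)
  have h2 : |logWeight y * (smoothed y - smoothedLimit)| ≤
      logWeight y * (Real.exp (-1) * 1.95 / Real.log y + 2 / y) := by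
    rw [abs_mul, abs_of_nonneg (logWeight_nonneg hy)]
    exact mul_le_mul_of_nonneg_left (abs_smoothed_sub_le hy) (logWeight_nonneg hy)
  rw [abs_le] at *
  simp only [correctedSum] at h1
  constructor <;> linarith [h1.1, h1.2, h2.1, h2.2]

end TotientBound

namespace TotientBound

open Set Filter Topology ArithmeticFunction

/-- The logarithm of the factor `t / (t - 1)`. -/
noncomputable def logFactor (t : ℝ) : ℝ := -Real.log (1 - 1 / t)

lemma logFactor_nonneg {t : ℝ} (ht : 1 < t) : 0 ≤ logFactor t := by
  have h1 : 1 / t < 1 := (div_lt_one (by linarith)).2 ht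
  have h2 : 0 < 1 / t := by positivity
  have := Real.log_nonpos (by linarith : 0 ≤ 1 - 1 / t) (by linarith)
  unfold logFactor
  linarith

lemma logFactor_antitone {s t : ℝ} (hs : 1 < s) (h : s ≤ t) : logFactor t ≤ logFactor s := by
  have h1 : 1 / s < 1 := (div_lt_one (by linarith)).2 hs
  have h2 := inv_antitone hs h
  exact neg_le_neg (Real.log_le_log (by linarith) (by linarith))

lemma logFactor_le {t : ℝ} (ht : 1 < t) : logFactor t ≤ 1 / (t - 1) := by
  have h0 : 0 < 1 - 1 / t := by
    have : 1 / t < 1 := (div_lt_one (by linarith)).2 ht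
    linarith
  have h := Real.one_sub_inv_le_log_of_pos h0
  have h1 : (1 - 1 / t)⁻¹ = t / (t - 1) := by
    have : t - 1 ≠ 0 := by linarith
    have : t ≠ 0 := by linarith
    field_simp
  have h2 : t / (t - 1) = 1 + 1 / (t - 1) := by
    have : t - 1 ≠ 0 := by linarith
    field_simp
    ring
  rw [h1, h2] at h
  unfold logFactor
  linarith

/-- The slope `logFactor t / log t`. -/
noncomputable def logSlope (t : ℝ) : ℝ := logFactor t / Real.log t

lemma logSlope_nonneg {t : ℝ} (ht : 1 < t) : 0 ≤ logSlope t :=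
  div_nonneg (logFactor_nonneg ht) (Real.log_pos ht).le

lemma logSlope_antitone {s t : ℝ} (hs : 1 < s) (h : s ≤ t) : logSlope t ≤ logSlope s :=
  div_le_div₀ (logFactor_nonneg hs) (logFactor_antitone hs h) (Real.log_pos hs)
    (Real.log_le_log (by linarith) h)

lemma logFactor_sub_nonneg {s t : ℝ} (hs : 1 < s) (h : s ≤ t) :
    0 ≤ logFactor s - logSlope t * Real.log s := by
  have := (le_div_iff₀ (Real.log_pos hs)).1 (logSlope_antitone hs h)
  linarith

lemma logFactor_sub_nonpos {s t : ℝ} (ht : 1 < t) (h : t ≤ s) :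
    logFactor s - logSlope t * Real.log s ≤ 0 := by
  have := (div_le_iff₀ (Real.log_pos (ht.trans_le h))).1 (logSlope_antitone ht h)
  linarith

lemma log_div_totient {n : ℕ} (hn : n ≠ 0) :
    Real.log (n / n.totient) = ∑ p ∈ n.primeFactors, logFactor p := by
  have hφ : (0 : ℝ) < n.totient := by exact_mod_cast Nat.totient_pos.2 (Nat.pos_of_ne_zero hn)
  have hn0 : (n : ℝ) ≠ 0 := by exact_mod_cast hn
  have h : (n.totient : ℝ) = n * ∏ p ∈ n.primeFactors, (1 - 1 / (p : ℝ)) := by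
    have := congrArg (fun q : ℚ => (q : ℝ)) (Nat.totient_eq_mul_prod_factors n)
    push_cast at this
    simpa [one_div] using this
  have h2 : ∏ p ∈ n.primeFactors, (1 - 1 / (p : ℝ)) ≠ 0 := by
    intro h0
    rw [h0, mul_zero] at h
    exact hφ.ne' h
  rw [h, div_mul_eq_div_div, div_self hn0, Real.log_div one_ne_zero h2, Real.log_one, zero_sub,
    Real.log_prod (fun p hp => Finset.prod_ne_zero_iff.1 h2 p hp), ← Finset.sum_neg_distrib]
  rfl

lemma sum_log_primeFactors_le {n : ℕ} (hn : n ≠ 0) :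
    ∑ p ∈ n.primeFactors, Real.log p ≤ Real.log n := by
  have h1 : ∀ p ∈ n.primeFactors, (p : ℝ) ≠ 0 := fun p hp => by
    exact_mod_cast (Nat.prime_of_mem_primeFactors hp).ne_zero
  rw [← Real.log_prod h1]
  refine Real.log_le_log (Finset.prod_pos fun p hp => ?_) ?_
  · exact_mod_cast (Nat.prime_of_mem_primeFactors hp).pos
  · rw [← Nat.cast_prod]
    exact_mod_cast Nat.le_of_dvd (Nat.pos_of_ne_zero hn) (Nat.prod_primeFactors_dvd n)

/-- A linear programming bound for `n / φ n`. -/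
lemma log_div_totient_le {n : ℕ} (hn : n ≠ 0) {t : ℝ} (ht : 1 < t) (Q : Finset ℕ)
    (hQ : ∀ p : ℕ, p.Prime → (p : ℝ) ≤ t → p ∈ Q) (hQt : ∀ q ∈ Q, 1 < (q : ℝ) ∧ (q : ℝ) ≤ t) :
    Real.log (n / n.totient) ≤
      ∑ q ∈ Q, (logFactor q - logSlope t * Real.log q) + logSlope t * Real.log n := by
  have h1 := mul_le_mul_of_nonneg_left (sum_log_primeFactors_le hn) (logSlope_nonneg ht)
  have h2 : ∑ p ∈ n.primeFactors, (logFactor p - logSlope t * Real.log p) ≤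
      ∑ q ∈ Q, (logFactor q - logSlope t * Real.log q) := by
    rw [← Finset.sum_inter_add_sum_sdiff n.primeFactors Q]
    have h3 : ∑ p ∈ n.primeFactors \ Q, (logFactor p - logSlope t * Real.log p) ≤ 0 := by
      refine Finset.sum_nonpos fun p hp => logFactor_sub_nonpos ht ?_
      obtain ⟨hp1, hp2⟩ := Finset.mem_sdiff.1 hp
      by_contra! h
      exact hp2 (hQ p (Nat.prime_of_mem_primeFactors hp1) h.le)
    have h4 : ∑ p ∈ n.primeFactors ∩ Q, (logFactor p - logSlope t * Real.log p) ≤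
        ∑ q ∈ Q, (logFactor q - logSlope t * Real.log q) :=
      Finset.sum_le_sum_of_subset_of_nonneg Finset.inter_subset_right
        fun q hq _ => logFactor_sub_nonneg (hQt q hq).1 (hQt q hq).2
    linarith
  rw [log_div_totient hn]
  rw [Finset.sum_sub_distrib, ← Finset.mul_sum] at h2
  linarith

lemma logFactor_le_sum_add {p : ℕ} (hp : 2 ≤ p) (n : ℕ) :
    logFactor p ≤ ∑ k ∈ Finset.range n, 1 / (((k : ℝ) + 1) * (p : ℝ) ^ (k + 1)) +
      1 / ((n + 1) * (p : ℝ) ^ (n + 1)) * (p / (p - 1)) := by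
  have hp2 : (2 : ℝ) ≤ p := by exact_mod_cast hp
  set x : ℝ := 1 / p with hx
  have hx0 : 0 < x := by positivity
  have hx1 : x < 1 := (div_lt_one (by linarith)).2 (by linarith)
  have h := Real.hasSum_pow_div_log_of_abs_lt_one (x := x) (by rwa [abs_of_pos hx0])
  have hg := (hasSum_geometric_of_lt_one hx0.le hx1).mul_left (x ^ (n + 1) / (n + 1))
  have h1 := h.summable.sum_add_tsum_nat_add n
  rw [h.tsum_eq] at h1
  have h2 : ∑' k : ℕ, x ^ (k + n + 1) / (((k + n : ℕ) : ℝ) + 1) ≤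
      x ^ (n + 1) / (n + 1) * (1 - x)⁻¹ := by
    rw [← hg.tsum_eq]
    refine Summable.tsum_le_tsum (fun k => ?_)
      ((summable_nat_add_iff n (f := fun k : ℕ => x ^ (k + 1) / ((k : ℝ) + 1))).2 h.summable)
      hg.summable
    rw [show k + n + 1 = (n + 1) + k by ring, pow_add, div_mul_eq_mul_div]
    refine div_le_div_of_nonneg_left (by positivity) (by positivity) ?_
    push_cast
    linarith [Nat.cast_nonneg (α := ℝ) k]
  have h3 : (1 - x)⁻¹ = p / (p - 1) := by
    have : (p : ℝ) - 1 ≠ 0 := by linarith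
    rw [hx]
    field_simp
  rw [h3] at h2
  have h4 : ∀ k : ℕ, 1 / (((k : ℝ) + 1) * (p : ℝ) ^ (k + 1)) = x ^ (k + 1) / (k + 1) := by
    intro k
    rw [hx, one_div_pow]
    field_simp
  simp only [h4]
  unfold logFactor
  linarith

/-- The contribution to the error of a prime `p`. -/
noncomputable def primeError (y : ℝ) (p : ℕ) : ℝ :=
  if (p : ℝ) ^ 2 ≤ y then 3 / (2 * y) else 1 / (2 * (p * ((p : ℝ) - 1)))

lemma logFactor_le_sum_log {y : ℝ} (hy : 8 ≤ y) {p : ℕ} (hp : p.Prime) (hpy : (p : ℝ) ≤ y) :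
    logFactor p - kernel y * Real.log p ≤
      ∑ k ∈ Finset.range (Nat.log p ⌊y⌋₊),
        (1 / (((k : ℝ) + 1) * (p : ℝ) ^ (k + 1)) - kernel y * Real.log p) + primeError y p := by
  have hp2 : (2 : ℝ) ≤ p := by exact_mod_cast hp.two_le
  have hy0 : (0 : ℝ) < y := by linarith
  have hly := Real.log_pos (by linarith : 1 < y)
  have hlp := Real.log_pos (by linarith : 1 < (p : ℝ))
  have hM : ⌊y⌋₊ ≠ 0 := (Nat.floor_pos.2 (by linarith)).ne'
  set n := Nat.log p ⌊y⌋₊ with hn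
  have h := logFactor_le_sum_add hp.two_le n
  have hlt : y < (p : ℝ) ^ (n + 1) := by
    have := Nat.lt_pow_succ_log_self hp.one_lt ⌊y⌋₊
    have := (Nat.floor_lt hy0.le).1 this
    exact_mod_cast this
  have hle : (p : ℝ) ^ n ≤ y := by
    have := Nat.pow_log_le_self p hM
    have := (Nat.le_floor_iff hy0.le).1 this
    exact_mod_cast this
  have hp1 : (0 : ℝ) < (p : ℝ) - 1 := by linarith
  rw [Finset.sum_sub_distrib, Finset.sum_const, Finset.card_range, nsmul_eq_mul]
  unfold primeError
  split_ifs with hc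
  · have hn2 : 2 ≤ n := by
      by_contra! hn2
      have : (p : ℝ) ^ (n + 1) ≤ p ^ 2 := pow_le_pow_right₀ (by linarith) (by lia)
      linarith
    have hn2' : (2 : ℝ) ≤ n := by exact_mod_cast hn2
    have h1 : n * (kernel y * Real.log p) ≤ 1 / y := by
      have : n * Real.log p ≤ Real.log y := by
        rw [← Real.log_pow]
        exact Real.log_le_log (by positivity) hle
      rw [kernel, one_div_mul_eq_div, mul_div_assoc', div_le_div_iff₀ (by positivity) hy0]
      nlinarith
    have h2 : 1 / (((n : ℝ) + 1) * (p : ℝ) ^ (n + 1)) * (p / (p - 1)) ≤ 1 / (2 * y) := by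
      have h3 : 2 * (p : ℝ) ≤ (n + 1) * (p - 1) := by
        rcases hp.eq_two_or_odd' with rfl | hodd
        · have : 3 ≤ n := by
            by_contra! hn3
            have : ((2 : ℕ) : ℝ) ^ (n + 1) ≤ (2 : ℕ) ^ 3 :=
              pow_le_pow_right₀ (by norm_num) (by lia)
            norm_num at this hlt
            linarith
          have : (3 : ℝ) ≤ n := by exact_mod_cast this
          norm_num
          linarith
        · have : 3 ≤ p := by
            have := hp.two_le
            rcases hodd with ⟨j, hj⟩
            lia
          have : (3 : ℝ) ≤ p := by exact_mod_cast this
          nlinarith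
      rw [div_mul_div_comm, one_mul, div_le_div_iff₀ (by positivity) (by positivity)]
      calc (p : ℝ) * (2 * y) = (2 * p) * y := by ring
        _ ≤ ((n + 1) * (p - 1)) * (p : ℝ) ^ (n + 1) := by gcongr
        _ = _ := by ring
    have h5 : 3 / (2 * y) = 1 / y + 1 / (2 * y) := by field_simp; norm_num
    have h6 : 0 ≤ kernel y * Real.log p := mul_nonneg (by unfold kernel; positivity) hlp.le
    linarith
  · have hn1 : n = 1 := by
      have h1 : 1 ≤ n := Nat.log_pos hp.one_lt (Nat.le_floor hpy)
      have h2 : n < 2 := by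
        by_contra! h2
        have : (p : ℝ) ^ 2 ≤ p ^ n := pow_le_pow_right₀ (by linarith) h2
        linarith
      lia
    rw [hn1] at h ⊢
    have : 1 / (((1 : ℕ) + 1 : ℝ) * (p : ℝ) ^ (1 + 1)) * (p / (p - 1)) =
        1 / (2 * (p * ((p : ℝ) - 1))) := by
      push_cast
      field_simp
      ring
    rw [this] at h
    push_cast at h ⊢
    linarith

lemma sum_prime_pow_le_smoothSum {y : ℝ} (hy : 1 < y) :
    ∑ p ∈ Finset.Icc 2 ⌊y⌋₊ with p.Prime, ∑ k ∈ Finset.range (Nat.log p ⌊y⌋₊),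
      (1 / (((k : ℝ) + 1) * (p : ℝ) ^ (k + 1)) - kernel y * Real.log p) + 1 / Real.log y ≤
      smoothSum y := by
  unfold smoothSum
  gcongr
  rw [Finset.sum_sigma']
  set S := (Finset.Icc 2 ⌊y⌋₊ |>.filter Nat.Prime).sigma fun p => Finset.range (Nat.log p ⌊y⌋₊)
  have hM : ⌊y⌋₊ ≠ 0 := (Nat.floor_pos.2 hy.le).ne'
  have hmem : ∀ x ∈ S, x.1.Prime ∧ x.2 < Nat.log x.1 ⌊y⌋₊ := by
    intro x hx
    obtain ⟨h1, h2⟩ := Finset.mem_sigma.1 hx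
    exact ⟨(Finset.mem_filter.1 h1).2, Finset.mem_range.1 h2⟩
  have hinj : Set.InjOn (fun x : (_ : ℕ) × ℕ => x.1 ^ (x.2 + 1)) S := by
    rintro ⟨p, k⟩ hx ⟨q, l⟩ hx' h
    obtain ⟨rfl, h2⟩ := (hmem _ hx).1.pow_inj (hmem _ hx').1 h
    simp_all
  have hsub : S.image (fun x : (_ : ℕ) × ℕ => x.1 ^ (x.2 + 1)) ⊆ Finset.Icc 2 ⌊y⌋₊ := by
    intro m hm
    obtain ⟨x, hx, rfl⟩ := Finset.mem_image.1 hm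
    obtain ⟨hp, hk⟩ := hmem x hx
    refine Finset.mem_Icc.2 ⟨hp.two_le.trans (Nat.le_self_pow (by lia) _), ?_⟩
    exact (Nat.pow_le_pow_right hp.pos hk).trans (Nat.pow_log_le_self _ hM)
  refine le_trans ?_ (Finset.sum_le_sum_of_subset_of_nonneg hsub fun m hm _ => ?_)
  · rw [Finset.sum_image hinj]
    refine le_of_eq (Finset.sum_congr rfl fun x hx => ?_)
    obtain ⟨hp, hk⟩ := hmem x hx
    have hL : Real.log x.1 ≠ 0 := (Real.log_pos (by exact_mod_cast hp.one_lt)).ne'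
    have hp0 : (x.1 : ℝ) ≠ 0 := by exact_mod_cast hp.ne_zero
    rw [vonMangoldt_apply_pow (by lia), vonMangoldt_apply_prime hp, mul_sub, mul_comm (kernel y)]
    congr 1
    rw [kernel]
    push_cast
    rw [Real.log_pow]
    push_cast
    field_simp
  · obtain ⟨h1, h2⟩ := natCast_le_of_mem (by linarith) hm
    exact mul_nonneg vonMangoldt_nonneg (by linarith [kernel_antitone h1 h2])

lemma sum_primeError_small {y : ℝ} (hy : 4 ≤ y) :
    ∑ p ∈ (Finset.Icc 2 ⌊y⌋₊ |>.filter Nat.Prime) with ((p : ℕ) : ℝ) ^ 2 ≤ y, primeError y p ≤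
      (√y + 1) / 2 * (3 / (2 * y)) := by
  have h2 : (2 : ℝ) ≤ √y := Real.le_sqrt_of_sq_le (by linarith)
  set S := (Finset.Icc 2 ⌊y⌋₊ |>.filter Nat.Prime).filter fun p : ℕ => (p : ℝ) ^ 2 ≤ y with hS
  have hmem : ∀ p ∈ S, p.Prime ∧ (p : ℝ) ^ 2 ≤ y := fun p hp => by
    obtain ⟨h1, h2⟩ := Finset.mem_filter.1 hp
    exact ⟨(Finset.mem_filter.1 h1).2, h2⟩
  have h1 : ∑ p ∈ S, primeError y p = S.card * (3 / (2 * y)) := by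
    rw [← nsmul_eq_mul, ← Finset.sum_const]
    exact Finset.sum_congr rfl fun p hp => if_pos (hmem p hp).2
  rw [h1]
  have hinj : Set.InjOn (fun p : ℕ => (p - 1) / 2) S := by
    intro p hp q hq h
    have hp' := (hmem p hp).1
    have hq' := (hmem q hq).1
    have := hp'.two_le
    have := hq'.two_le
    simp only at h
    rcases hp'.eq_two_or_odd with h1 | h1 <;> rcases hq'.eq_two_or_odd with h2 | h2 <;> lia
  have hsub : S.image (fun p : ℕ => (p - 1) / 2) ⊆ Finset.range ((⌊√y⌋₊ - 1) / 2 + 1) := by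
    intro j hj
    obtain ⟨p, hp, rfl⟩ := Finset.mem_image.1 hj
    have : p ≤ ⌊√y⌋₊ := Nat.le_floor (Real.le_sqrt_of_sq_le (hmem p hp).2)
    rw [Finset.mem_range]
    have := Nat.div_le_div_right (c := 2) (Nat.sub_le_sub_right this 1)
    lia
  have hcard := Finset.card_le_card hsub
  rw [Finset.card_image_of_injOn hinj, Finset.card_range] at hcard
  have h3 : 2 ≤ ⌊√y⌋₊ := Nat.le_floor (by exact_mod_cast h2)
  have h4 : 2 * S.card ≤ ⌊√y⌋₊ + 1 := by lia
  have h5 : (2 * S.card : ℝ) ≤ ⌊√y⌋₊ + 1 := by exact_mod_cast h4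
  have h6 := Nat.floor_le (Real.sqrt_nonneg y)
  gcongr
  linarith

lemma sum_inv_mul_le {a : ℝ} (ha : 1 ≤ a) (M : ℕ) :
    ∑ j ∈ Finset.range M with a ≤ ((j : ℕ) : ℝ),
      1 / (2 * ((2 * (j : ℝ) + 1) * (2 * j))) ≤ 1 / (8 * (a - 1 / 4)) := by
  suffices h : ∑ j ∈ Finset.range M with a ≤ ((j : ℕ) : ℝ),
      1 / (2 * ((2 * (j : ℝ) + 1) * (2 * j))) ≤
        1 / (8 * (a - 1 / 4)) - 1 / (8 * (max a M - 1 / 4)) by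
    have : 0 ≤ 1 / (8 * (max a M - 1 / 4)) := by
      have := le_max_left a M
      exact one_div_nonneg.2 (by linarith)
    linarith
  induction M with
  | zero => simp [max_eq_left (by linarith : (0 : ℝ) ≤ a)]
  | succ M ih =>
    rw [Finset.range_add_one, Finset.filter_insert]
    split_ifs with h
    · rw [Finset.sum_insert (by simp)]
      rw [max_eq_right h] at ih
      rw [max_eq_right (by push_cast; linarith)]
      have hM : (1 : ℝ) ≤ M := ha.trans h
      have key : 1 / (2 * ((2 * (M : ℝ) + 1) * (2 * M))) ≤
          1 / (8 * ((M : ℝ) - 1 / 4)) - 1 / (8 * (((M + 1 : ℕ) : ℝ) - 1 / 4)) := by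
        push_cast
        have h1 : (0 : ℝ) < M - 1 / 4 := by linarith
        have h2 : (0 : ℝ) < M + 1 - 1 / 4 := by linarith
        rw [div_sub_div _ _ (by positivity) (by positivity), div_le_div_iff₀ (by positivity)
          (by positivity)]
        nlinarith
      linarith
    · push Not at h
      refine ih.trans ?_
      have h1 : max a (M : ℝ) ≤ max a ((M + 1 : ℕ) : ℝ) :=
        max_le_max le_rfl (by push_cast; linarith)
      have h2 := le_max_left a (M : ℝ)
      have : 1 / (8 * (max a ((M + 1 : ℕ) : ℝ) - 1 / 4)) ≤ 1 / (8 * (max a (M : ℝ) - 1 / 4)) :=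
        one_div_le_one_div_of_le (by linarith) (by linarith)
      linarith

lemma sum_primeError_large {y : ℝ} (hy : 9 ≤ y) :
    ∑ p ∈ (Finset.Icc 2 ⌊y⌋₊ |>.filter Nat.Prime) with ¬ ((p : ℕ) : ℝ) ^ 2 ≤ y, primeError y p ≤
      1 / (4 * √y - 6) := by
  have h3 : (3 : ℝ) ≤ √y := Real.le_sqrt_of_sq_le (by linarith)
  set S := (Finset.Icc 2 ⌊y⌋₊ |>.filter Nat.Prime).filter fun p : ℕ => ¬ (p : ℝ) ^ 2 ≤ y with hS
  have hmem : ∀ p ∈ S, p ≤ ⌊y⌋₊ ∧ 2 * (p / 2) + 1 = p ∧ √y < p ∧ ¬ (p : ℝ) ^ 2 ≤ y := by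
    intro p hp
    obtain ⟨h1, h2⟩ := Finset.mem_filter.1 hp
    obtain ⟨h4, h5⟩ := Finset.mem_filter.1 h1
    have h6 : √y < p := Real.sqrt_lt' (by exact_mod_cast h5.pos) |>.2 (not_le.1 h2)
    refine ⟨(Finset.mem_Icc.1 h4).2, ?_, h6, h2⟩
    rcases h5.eq_two_or_odd with rfl | h7
    · norm_num at h6
      linarith
    · lia
  have hcast : ∀ p ∈ S, (2 * ((p / 2 : ℕ) : ℝ) + 1) = p := fun p hp => by
    exact_mod_cast (hmem p hp).2.1
  have h1 : ∑ p ∈ S, primeError y p =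
      ∑ p ∈ S, 1 / (2 * ((2 * ((p / 2 : ℕ) : ℝ) + 1) * (2 * ((p / 2 : ℕ) : ℝ)))) := by
    refine Finset.sum_congr rfl fun p hp => ?_
    rw [primeError, if_neg (hmem p hp).2.2.2, ← hcast p hp, add_sub_cancel_right]
  have hinj : Set.InjOn (fun p : ℕ => p / 2) S := by
    intro p hp q hq h
    have := (hmem p hp).2.1
    have := (hmem q hq).2.1
    simp only at h
    lia
  rw [h1, ← Finset.sum_image (f := fun j : ℕ => 1 / (2 * ((2 * (j : ℝ) + 1) * (2 * (j : ℝ)))))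
    (g := fun p : ℕ => p / 2) hinj]
  have hsub : S.image (fun p : ℕ => p / 2) ⊆
      (Finset.range (⌊y⌋₊ + 1)).filter fun j : ℕ => (√y - 1) / 2 ≤ (j : ℝ) := by
    intro j hj
    obtain ⟨p, hp, rfl⟩ := Finset.mem_image.1 hj
    have h5 := hcast p hp
    obtain ⟨h6, -, h7, -⟩ := hmem p hp
    refine Finset.mem_filter.2 ⟨Finset.mem_range.2 (by lia), by linarith⟩
  refine (Finset.sum_le_sum_of_subset_of_nonneg hsub fun j _ _ => by positivity).trans ?_
  refine (sum_inv_mul_le (by linarith) _).trans (le_of_eq ?_)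
  congr 1
  ring

/-- The bound for `log (n / φ n)` in terms of the smoothed sum over prime powers. -/
theorem log_div_totient_le_smoothSum {n : ℕ} (hn : n ≠ 0) (hy : 9 ≤ Real.log n) :
    Real.log (n / n.totient) ≤ smoothSum (Real.log n) +
      ((√(Real.log n) + 1) / 2 * (3 / (2 * Real.log n)) + 1 / (4 * √(Real.log n) - 6)) +
        1 / ((Real.log n - 1) * Real.log (Real.log n)) := by
  set y := Real.log n
  have hy1 : 1 < y := by linarith
  have hly := Real.log_pos hy1
  have h := log_div_totient_le hn hy1 (Finset.Icc 2 ⌊y⌋₊ |>.filter Nat.Prime)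
    (fun p hp hpy => Finset.mem_filter.2 ⟨Finset.mem_Icc.2 ⟨hp.two_le, Nat.le_floor hpy⟩, hp⟩)
    (fun q hq => natCast_le_of_mem (by linarith) (Finset.mem_filter.1 hq).1)
  have h1 := sum_prime_pow_le_smoothSum hy1
  have h2 : ∑ p ∈ Finset.Icc 2 ⌊y⌋₊ with p.Prime, (logFactor p - kernel y * Real.log p) ≤
      ∑ p ∈ Finset.Icc 2 ⌊y⌋₊ with p.Prime, (∑ k ∈ Finset.range (Nat.log p ⌊y⌋₊),
        (1 / (((k : ℝ) + 1) * (p : ℝ) ^ (k + 1)) - kernel y * Real.log p) + primeError y p) :=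
    Finset.sum_le_sum fun p hp => logFactor_le_sum_log (by linarith) (Finset.mem_filter.1 hp).2
      (natCast_le_of_mem (by linarith) (Finset.mem_filter.1 hp).1).2
  rw [Finset.sum_add_distrib, ← Finset.sum_filter_add_sum_filter_not _ (fun p : ℕ => (p : ℝ) ^ 2 ≤ y)
    (primeError y)] at h2
  have h3 := sum_primeError_small (y := y) (by linarith)
  have h4 := sum_primeError_large (y := y) hy
  have hk : kernel y ≤ logSlope y := by
    rw [kernel, logSlope, ← div_div]
    gcongr
    have h5 := Real.log_le_sub_one_of_pos (x := 1 - 1 / y) (by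
      have : 1 / y < 1 := (div_lt_one (by linarith)).2 hy1
      linarith)
    unfold logFactor
    linarith
  have h5 : ∑ p ∈ Finset.Icc 2 ⌊y⌋₊ with p.Prime, (logFactor p - logSlope y * Real.log p) ≤
      ∑ p ∈ Finset.Icc 2 ⌊y⌋₊ with p.Prime, (logFactor p - kernel y * Real.log p) := by
    refine Finset.sum_le_sum fun p hp => ?_
    have := Real.log_natCast_nonneg p
    nlinarith
  have h6 : logSlope y * y ≤ 1 / Real.log y + 1 / ((y - 1) * Real.log y) := by
    have h7 := logFactor_le hy1
    have h8 : 1 / Real.log y + 1 / ((y - 1) * Real.log y) = 1 / (y - 1) / Real.log y * y := by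
      have : y - 1 ≠ 0 := by linarith
      field_simp
      ring
    rw [h8, logSlope]
    gcongr
  linarith

end TotientBound

namespace TotientBound

open Real

/-! ### From a linear programming certificate to a bound for `n / φ n` -/

lemma le_exp_eulerMascheroni : 1.7808 ≤ exp eulerMascheroniConstant := by
  have h := Real.sum_le_exp_of_nonneg (x := 0.5771) (by norm_num) 8
  have h1 := Real.exp_le_exp.2 lt_eulerMascheroni.le
  refine le_trans ?_ (h.trans h1)
  simp only [Finset.sum_range_succ, Finset.sum_range_zero, Nat.factorial]
  norm_num

/-- The bound to be proved, in terms of `n / φ n`. -/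
def IsBounded (n : ℕ) : Prop :=
  (n : ℝ) / n.totient <
    exp eulerMascheroniConstant * log (log n) + 3 / log (log n)

lemma logSlope_le {t L : ℝ} (ht : 1 < t) (hL : 0 < L) (hLt : L ≤ log t) :
    logSlope t ≤ (2 * t - 1) / (2 * t * (t - 1) * L) := by
  have ht1 : 0 < t - 1 := by linarith
  have h := log_one_add_le_of_nonneg (x := 1 / (t - 1)) (by positivity)
  have h1 : 1 + 1 / (t - 1) = (1 - 1 / t)⁻¹ := by
    have : t ≠ 0 := by linarith
    field_simp
    ring
  have h2 : 1 / (t - 1) * (1 / (t - 1) + 2) / (2 * (1 / (t - 1) + 1)) =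
      (2 * t - 1) / (2 * t * (t - 1)) := by
    have h3 : 1 / (t - 1) + 1 = t / (t - 1) := by field_simp; ring
    have : t ≠ 0 := by linarith
    rw [h3]
    field_simp
    ring
  rw [h1, h2, log_inv] at h
  rw [logSlope, ← div_div]
  have h4 : 0 ≤ (2 * t - 1) / (2 * t * (t - 1)) := by
    have : 0 ≤ 2 * t - 1 := by linarith
    positivity
  unfold logFactor
  gcongr

lemma log_div_totient_le_of_certificate {n p : ℕ} (hn : n ≠ 0) (hp : 1 < p) (Q : Finset ℕ)
    (hQ : ∀ q : ℕ, q.Prime → q ≤ p → q ∈ Q) (hQp : ∀ q ∈ Q, 1 < q ∧ q ≤ p) {X T L D : ℝ}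
    (hX : ∏ q ∈ Q, (q : ℝ) / (q - 1) ≤ X) (hT : T ≤ ∑ q ∈ Q, log q) (hL : 0 < L)
    (hLp : L ≤ log p) (hD : 0 ≤ D) (hnD : log n - T ≤ D) :
    log (n / n.totient) ≤ log X + D * ((2 * p - 1) / (2 * p * (p - 1) * L)) := by
  have hp' : (1 : ℝ) < p := by exact_mod_cast hp
  have h := log_div_totient_le hn hp' Q (fun q hq hqp => hQ q hq (by exact_mod_cast hqp))
    fun q hq => by exact_mod_cast hQp q hq
  have hpos : ∀ q ∈ Q, 0 < (q : ℝ) / (q - 1) := fun q hq => by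
    have : (1 : ℝ) < q := by exact_mod_cast (hQp q hq).1
    exact div_pos (by linarith) (by linarith)
  have h1 : ∑ q ∈ Q, logFactor q = log (∏ q ∈ Q, (q : ℝ) / (q - 1)) := by
    rw [log_prod fun q hq => (hpos q hq).ne']
    refine Finset.sum_congr rfl fun q hq => ?_
    have : (1 : ℝ) < q := by exact_mod_cast (hQp q hq).1
    rw [logFactor, ← log_inv]
    congr 1
    have : (q : ℝ) - 1 ≠ 0 := by linarith
    have : (q : ℝ) ≠ 0 := by linarith
    field_simp
  have h2 := log_le_log (Finset.prod_pos hpos) hX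
  rw [Finset.sum_sub_distrib, ← Finset.mul_sum, h1] at h
  have h3 := logSlope_le hp' hL hLp
  have h4 := logSlope_nonneg hp'
  have h5 : logSlope p * (log n - ∑ q ∈ Q, log q) ≤ logSlope p * D :=
    mul_le_mul_of_nonneg_left (by linarith) h4
  have h6 := mul_le_mul_of_nonneg_left h3 hD
  linarith

lemma lt_of_log_le_log_add {a X ε R : ℝ} (ha : 0 < a) (hX : 0 < X) (hε : 0 ≤ ε) (hε2 : ε < 2)
    (h : log a ≤ log X + ε) (hR : X * (2 + ε) < R * (2 - ε)) : a < R := by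
  have h1 := Real.le_log_one_add_of_nonneg (x := 2 * ε / (2 - ε))
    (div_nonneg (by linarith) (by linarith))
  have h2 : (2 - ε) ≠ 0 := by linarith
  have e1 : 1 + 2 * ε / (2 - ε) = (2 + ε) / (2 - ε) := by field_simp; ring
  have e2 : 2 * (2 * ε / (2 - ε)) / (2 * ε / (2 - ε) + 2) = ε := by
    have : 2 * ε / (2 - ε) + 2 = 4 / (2 - ε) := by field_simp; ring
    rw [this]
    field_simp
    ring
  rw [e1, e2] at h1
  have h3 : 0 < (2 + ε) / (2 - ε) := div_pos (by linarith) (by linarith)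
  have h4 : log a ≤ log (X * ((2 + ε) / (2 - ε))) := by
    rw [log_mul hX.ne' h3.ne']
    linarith
  have h5 := (log_le_log_iff ha (by positivity)).1 h4
  refine h5.trans_lt ?_
  rw [← mul_div_assoc, div_lt_iff₀ (by linarith)]
  exact hR

lemma div_totient_pos {n : ℕ} (hn : n ≠ 0) : 0 < (n : ℝ) / n.totient := by
  have := Nat.totient_pos.2 (Nat.pos_of_ne_zero hn)
  have := Nat.pos_of_ne_zero hn
  positivity

lemma one_lt_log_natCast {n : ℕ} (hn : 3 ≤ n) : 1 < log n := by
  have h : (3 : ℝ) ≤ n := by exact_mod_cast hn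
  rw [lt_log_iff_exp_lt (by linarith)]
  linarith [exp_one_lt_d9]

lemma isBounded_of_small {n : ℕ} (hn : 3 ≤ n) (h : log (log n) < 3 / 2) : IsBounded n := by
  have h1 := one_lt_log_natCast hn
  have hl := log_pos h1
  have hy : log n ≤ 4.482 := by
    refine ((log_lt_iff_lt_exp (by linarith)).1 h).le.trans ?_
    have := exp_one_lt_d9
    have h2 : exp (3 / 2) ^ 2 = exp 1 ^ 3 := by
      rw [← exp_nat_mul, ← exp_nat_mul]
      norm_num
    have h3 : exp 1 ^ 3 ≤ 2.7182818286 ^ 3 := by gcongr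
    refine le_of_sq_le_sq ?_ (by norm_num)
    rw [h2]
    refine h3.trans (by norm_num)
  have h2 := log_two_gt_d9
  have h3 := log_three_gt_d9
  have h5 := log_five_gt_d9
  have hc := log_div_totient_le_of_certificate (n := n) (p := 5) (X := 15 / 4) (T := 3.4)
    (L := 1.609) (D := 1.082) (by lia) (by norm_num) {2, 3, 5}
    (fun q hq hq5 => by
      have := hq.two_le
      interval_cases q <;> simp_all
      exact absurd hq (by norm_num))
    (by simp) (by norm_num) (by norm_num at *; linarith) (by norm_num)
    (by norm_num at *; linarith) (by norm_num) (by linarith)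
  have h4 := lt_of_log_le_log_add (R := 4.5) (div_totient_pos (by lia)) (by norm_num) (by norm_num)
    (by norm_num) hc (by norm_num)
  refine h4.trans_le ?_
  have h6 := mul_le_mul_of_nonneg_right le_exp_eulerMascheroni hl.le
  refine le_trans ?_ (add_le_add_left h6 _)
  rw [← sub_nonneg]
  have h7 : 1.7808 * log (log n) + 3 / log (log n) - 4.5 =
      (1.7808 * log (log n) ^ 2 - 4.5 * log (log n) + 3) / log (log n) := by
    field_simp
    ring
  rw [h7]
  exact div_nonneg (by nlinarith [sq_nonneg (log (log n) - 1.2635)]) hl.le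

/-! ### A sieve checking the bound in the range `log (log n) < 23 / 2` -/

/-- Evaluates `n` before applying `f`, which keeps kernel computations call-by-value. -/
def force {α : Type*} (n : ℕ) (f : ℕ → α) : α :=
  Nat.rec (f 0) (fun k _ => f (Nat.succ k)) n

lemma force_eq {α : Type*} (n : ℕ) (f : ℕ → α) : force n f = f n := by
  cases n <;> rfl

/-- A sieve over the odd integers up to `z`: `P` is the product of the small primes, `p` the last
prime, and `L / 10 ^ 6`, `X / 2 ^ 40`, `T / 10 ^ 6`, `B / 10 ^ 6` are bounds for `log p`,
`∏ q / (q - 1)`, `∑ log q` and `exp ((i + 1) / 64)`. Everything below `exp (i / 64)` has been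
treated. -/
structure SieveState where
  z : ℕ
  P : ℕ
  p : ℕ
  L : ℕ
  X : ℕ
  T : ℕ
  i : ℕ
  B : ℕ

namespace SieveState

/-- The inequality certifying the bound for `i / 64 ≤ log (log n) ≤ (i + 1) / 64`. -/
def check (p L X T i B : ℕ) : Bool :=
  force ((B - T) * (2 * p - 1)) fun N =>
    force (2 * p * (p - 1) * L) fun M =>
      Nat.blt (X * (2 * M + N) * (640000 * i))
        (1099511627776 * (17808 * (i * i) + 122880000) * (2 * M - N))

def advance (z P p L X T : ℕ) : ℕ → ℕ → ℕ → SieveState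
  | 0, i, B => ⟨z, P, p, L, X, T, i, B⟩
  | k + 1, i, B => bif check p L X T i B then
      force (i + 1) fun i => force (B * 129 / 127 + 1) fun B => advance z P p L X T k i B
    else ⟨z, P, p, L, X, T, i, B⟩

def step : SieveState → SieveState
  | ⟨z, P, p, L, X, T, i, B⟩ => force (z + 2) fun m =>
    bif Nat.beq (Nat.gcd m P) 1 then
      force (bif Nat.ble m 256 then P * m else P) fun P =>
      force (L + 2000000 * (m - p) / (m + p)) fun L =>
      force (X * m / (m - 1) + 1) fun X =>
      force (T + L) fun T => advance m P m L X T 30 i B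
    else ⟨m, P, p, L, X, T, i, B⟩

def bind (f : SieveState → SieveState) : SieveState → SieveState
  | ⟨z, P, p, L, X, T, i, B⟩ => f ⟨z, P, p, L, X, T, i, B⟩

/-- `2 ^ k` sieve steps. -/
def iterate (k : ℕ) : SieveState → SieveState :=
  Nat.rec step (fun _ f s => bind f (f s)) k

def initial : SieveState := ⟨3, 6, 3, 1098612, 3 * 2 ^ 40, 1791759, 96, 4552406⟩

lemma le_iterate_initial : 736 ≤ (iterate 15 initial).i := by
  decide +kernel

end SieveState

end TotientBound

namespace TotientBound

open Real

/-- The meaning of the fields `p, L, X, T` of the sieve. -/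
structure Certificate (z p L X T : ℕ) (Q : Finset ℕ) : Prop where
  mem : ∀ q : ℕ, q.Prime → q ≤ z → q ∈ Q
  bound : ∀ q ∈ Q, 1 < q ∧ q ≤ p
  le : p ≤ z
  three_le : 3 ≤ p
  prod_le : ∏ q ∈ Q, (q : ℝ) / (q - 1) ≤ X / 2 ^ 40
  le_sum : (T : ℝ) / 10 ^ 6 ≤ ∑ q ∈ Q, log q
  pos : 0 < L
  le_log : (L : ℝ) / 10 ^ 6 ≤ log p

/-- The meaning of the fields `i, B` of the sieve. -/
structure Treated (i B : ℕ) : Prop where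
  le : 96 ≤ i
  exp_le : exp (((i : ℝ) + 1) / 64) ≤ B / 10 ^ 6
  isBounded : ∀ n : ℕ, 3 ≤ n → log (log n) < i / 64 → IsBounded n

lemma cast_div_lt (a b : ℕ) : (a : ℝ) / b < ((a / b : ℕ) : ℝ) + 1 := by
  rw [← Nat.floor_div_eq_div (K := ℝ)]
  exact Nat.lt_floor_add_one _

lemma exp_one_div_le : exp (1 / 64) ≤ 129 / 127 := by
  have h := Real.le_log_one_add_of_nonneg (x := 2 / 127) (by norm_num)
  rw [← le_log_iff_exp_le (by norm_num)]
  norm_num at h ⊢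
  exact h

lemma Certificate.isBounded {z p L X T i B : ℕ} {Q : Finset ℕ} (h : Certificate z p L X T Q)
    (hi : Treated i B) (hc : SieveState.check p L X T i B = true) {n : ℕ} (hn : 3 ≤ n)
    (hn1 : (i : ℝ) / 64 ≤ log (log n)) (hn2 : log (log n) < ((i : ℝ) + 1) / 64) :
    IsBounded n := by
  set l := log (log n)
  have hi96 : (96 : ℝ) ≤ i := by exact_mod_cast hi.le
  have h1 := one_lt_log_natCast hn
  simp only [SieveState.check, force_eq, Nat.blt_eq] at hc
  set N := (B - T) * (2 * p - 1) with hN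
  set M := 2 * p * (p - 1) * L with hM
  have h3 := h.three_le
  have hp3 : (3 : ℝ) ≤ p := by exact_mod_cast h3
  have hp : ((2 * p - 1 : ℕ) : ℝ) = 2 * p - 1 := by
    rw [Nat.cast_sub (by lia)]
    push_cast
    ring
  have hM' : (M : ℝ) = 2 * p * (p - 1) * L := by
    rw [hM]
    push_cast [Nat.cast_sub (show 1 ≤ p by lia)]
    ring
  have hN' : (N : ℝ) = ((B - T : ℕ) : ℝ) * (2 * p - 1) := by
    rw [hN, Nat.cast_mul, hp]
  have hL : (0 : ℝ) < L := by exact_mod_cast h.pos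
  have hM0 : (0 : ℝ) < M := by
    rw [hM']
    have : (0 : ℝ) < p - 1 := by linarith
    positivity
  have hNM : N < 2 * M := by
    by_contra! hcon
    rw [Nat.sub_eq_zero_of_le hcon, mul_zero] at hc
    exact absurd hc (Nat.not_lt_zero _)
  have hc' : (X : ℝ) * (2 * M + N) * (640000 * i) <
      1099511627776 * (17808 * (i * i) + 122880000) * (2 * M - N) := by
    have : ((2 * M - N : ℕ) : ℝ) = 2 * M - N := by
      rw [Nat.cast_sub hNM.le]
      push_cast
      ring
    rw [← this]
    exact_mod_cast hc
  have hlog : log n ≤ B / 10 ^ 6 :=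
    ((log_lt_iff_lt_exp (by linarith)).1 hn2).le.trans hi.exp_le
  have hcert := log_div_totient_le_of_certificate (n := n) (p := p) (X := X / 2 ^ 40)
    (T := T / 10 ^ 6) (L := L / 10 ^ 6) (D := ((B - T : ℕ) : ℝ) / 10 ^ 6) (by lia) (by lia) Q
    (fun q hq hqp => h.mem q hq (hqp.trans h.le)) h.bound h.prod_le h.le_sum (by positivity)
    h.le_log (by positivity) (by
      have : (B : ℝ) ≤ ((B - T : ℕ) : ℝ) + T := by exact_mod_cast (by lia : B ≤ B - T + T)
      linarith)
  have hε : ((B - T : ℕ) : ℝ) / 10 ^ 6 * ((2 * p - 1) / (2 * p * (p - 1) * (L / 10 ^ 6))) =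
      N / M := by
    rw [hN', hM']
    have : (p : ℝ) - 1 ≠ 0 := by linarith
    field_simp
  rw [hε] at hcert
  have hX : (0 : ℝ) < X / 2 ^ 40 := by
    refine lt_of_lt_of_le (Finset.prod_pos fun q hq => ?_) h.prod_le
    have : (1 : ℝ) < q := by exact_mod_cast (h.bound q hq).1
    exact div_pos (by linarith) (by linarith)
  have hlt := lt_of_log_le_log_add (R := 1.7808 * (i / 64) + 3 / (i / 64))
    (div_totient_pos (by lia)) hX (by positivity)
    ((div_lt_iff₀ hM0).2 (by exact_mod_cast hNM)) hcert (by
      have e1 : (X : ℝ) / 2 ^ 40 * (2 + N / M) =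
          X * (2 * M + N) * (640000 * i) / (2 ^ 40 * M * (640000 * i)) := by
        field_simp
      have e2 : (1.7808 * (i / 64) + 3 / (i / 64) : ℝ) * (2 - N / M) =
          1099511627776 * (17808 * (i * i) + 122880000) * (2 * M - N) /
            (2 ^ 40 * M * (640000 * i)) := by
        field_simp
        ring
      rw [e1, e2]
      gcongr)
  refine hlt.trans_le ?_
  have hi0 : (3 / 2 : ℝ) ≤ i / 64 := by linarith
  have hl : 0 < l := by linarith
  have h6 := mul_le_mul_of_nonneg_right le_exp_eulerMascheroni hl.le
  refine le_trans ?_ (add_le_add_left h6 _)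
  set a := (i : ℝ) / 64
  have e : 1.7808 * l + 3 / l - (1.7808 * a + 3 / a) = (l - a) * (1.7808 - 3 / (a * l)) := by
    field_simp
    ring
  have h7 : 3 / (a * l) ≤ 1.7808 := by
    rw [div_le_iff₀ (by positivity)]
    nlinarith
  nlinarith [mul_nonneg (sub_nonneg.2 hn1) (sub_nonneg.2 h7)]

lemma Treated.succ {z p L X T i B : ℕ} {Q : Finset ℕ} (h : Certificate z p L X T Q)
    (hi : Treated i B) (hc : SieveState.check p L X T i B = true) :
    Treated (i + 1) (B * 129 / 127 + 1) where
  le := by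
    have := hi.le
    lia
  exp_le := by
    have h1 : ((B * 129 : ℕ) : ℝ) / (127 : ℕ) < ((B * 129 / 127 : ℕ) : ℝ) + 1 :=
      cast_div_lt _ _
    push_cast at h1 ⊢
    rw [show ((i : ℝ) + 1 + 1) / 64 = (i + 1) / 64 + 1 / 64 by ring, exp_add]
    calc exp (((i : ℝ) + 1) / 64) * exp (1 / 64) ≤ B / 10 ^ 6 * (129 / 127) :=
          mul_le_mul hi.exp_le exp_one_div_le (exp_pos _).le (by positivity)
      _ = (B * 129 / 127) / 10 ^ 6 := by ring
      _ ≤ _ := by gcongr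
  isBounded n hn hl := by
    push_cast at hl
    by_cases h1 : log (log n) < i / 64
    · exact hi.isBounded n hn h1
    · exact h.isBounded hi hc hn (not_lt.1 h1) hl

namespace SieveState

/-- The invariant of the sieve. -/
structure Valid (s : SieveState) : Prop where
  certificate : ∃ Q, Certificate s.z s.p s.L s.X s.T Q
  treated : Treated s.i s.B
  odd : Odd s.z
  le : ∀ q : ℕ, q.Prime → q ∣ s.P → q ≤ s.z

lemma valid_advance {z P p L X T : ℕ} {Q : Finset ℕ} (h : Certificate z p L X T Q) (hz : Odd z)
    (hP : ∀ q : ℕ, q.Prime → q ∣ P → q ≤ z) (k : ℕ) {i B : ℕ} (hi : Treated i B) :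
    (advance z P p L X T k i B).Valid := by
  induction k generalizing i B with
  | zero => exact ⟨⟨Q, h⟩, hi, hz, hP⟩
  | succ k ih =>
    rw [advance]
    cases hc : check p L X T i B with
    | false => exact ⟨⟨Q, h⟩, hi, hz, hP⟩
    | true =>
      simp only [cond_true, force_eq]
      exact ih (hi.succ h hc)

lemma eq_of_prime_of_le_add_two {q z : ℕ} (hq : q.Prime) (hz : Odd z) (hz2 : 2 ≤ z)
    (h : q ≤ z + 2) : q ≤ z ∨ q = z + 2 := by
  rcases hq.eq_two_or_odd with h2 | h2
  · lia
  · obtain ⟨k, hk⟩ := hz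
    lia

lemma Valid.step {s : SieveState} (h : s.Valid) : s.step.Valid := by
  obtain ⟨z, P, p, L, X, T, i, B⟩ := s
  obtain ⟨⟨Q, hQ⟩, hi, hz, hP⟩ := h
  simp only at hQ hi hz hP
  have hp3 := hQ.three_le
  have hpz := hQ.le
  have hz' : Odd (z + 2) := by
    obtain ⟨k, rfl⟩ := hz
    exact ⟨k + 1, by ring⟩
  simp only [SieveState.step, force_eq]
  cases hc : Nat.beq (Nat.gcd (z + 2) P) 1 with
  | false =>
    refine ⟨⟨Q, { hQ with mem := fun q hq hqz => ?_, le := by lia }⟩, hi, hz',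
      fun q hq hqP => (hP q hq hqP).trans (by lia)⟩
    rcases eq_of_prime_of_le_add_two hq hz (by lia) hqz with h1 | rfl
    · exact hQ.mem q hq h1
    · have h2 : Nat.gcd (z + 2) P = 1 := (Nat.Prime.coprime_iff_not_dvd hq).2 fun hd => by
        have := hP _ hq hd
        lia
      simp [h2] at hc
  | true =>
    have hnot : z + 2 ∉ Q := fun hmem => by
      have := (hQ.bound _ hmem).2
      lia
    have hp3' : (3 : ℝ) ≤ p := by exact_mod_cast hp3
    have hpz' : (p : ℝ) < ((z + 2 : ℕ) : ℝ) := by exact_mod_cast (by lia : p < z + 2)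
    have hlog : ((L + 2000000 * (z + 2 - p) / (z + 2 + p) : ℕ) : ℝ) / 10 ^ 6 ≤
        log (z + 2 : ℕ) := by
      have h1 := Real.le_log_one_add_of_nonneg (x := ((z + 2 : ℕ) : ℝ) / p - 1) (by
        rw [sub_nonneg, one_le_div (by linarith)]
        exact hpz'.le)
      rw [add_sub_cancel, log_div (by linarith) (by linarith)] at h1
      have h2 : ((2000000 * (z + 2 - p) / (z + 2 + p) : ℕ) : ℝ) ≤
          ((2000000 * (z + 2 - p) : ℕ) : ℝ) / ((z + 2 + p : ℕ) : ℝ) := Nat.cast_div_le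
      have h3 : ((2000000 * (z + 2 - p) : ℕ) : ℝ) / ((z + 2 + p : ℕ) : ℝ) =
          10 ^ 6 * (2 * (((z + 2 : ℕ) : ℝ) / p - 1) / (((z + 2 : ℕ) : ℝ) / p - 1 + 2)) := by
        have h4 : ((z + 2 : ℕ) : ℝ) / p - 1 + 2 = ((z + 2 : ℕ) + p) / p := by
          field_simp
          ring
        rw [h4]
        push_cast [Nat.cast_sub (show p ≤ z + 2 by lia)]
        field_simp
        ring
      rw [h3] at h2
      have h4 := hQ.le_log
      rw [Nat.cast_add, div_le_iff₀ (by norm_num)]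
      rw [div_le_iff₀ (by norm_num)] at h4
      linarith
    have hcert : Certificate (z + 2) (z + 2) (L + 2000000 * (z + 2 - p) / (z + 2 + p))
        (X * (z + 2) / (z + 2 - 1) + 1) (T + (L + 2000000 * (z + 2 - p) / (z + 2 + p)))
        (insert (z + 2) Q) := by
      refine ⟨fun q hq hqz => ?_, fun q hq => ?_, le_rfl, by lia, ?_, ?_, ?_, hlog⟩
      · rcases eq_of_prime_of_le_add_two hq hz (by lia) hqz with h1 | rfl
        · exact Finset.mem_insert_of_mem (hQ.mem q hq h1)
        · exact Finset.mem_insert_self _ _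
      · rcases Finset.mem_insert.1 hq with rfl | hq
        · lia
        · exact ⟨(hQ.bound q hq).1, (hQ.bound q hq).2.trans (by lia)⟩
      · rw [Finset.prod_insert hnot]
        have h1 : ((X * (z + 2) : ℕ) : ℝ) / ((z + 2 - 1 : ℕ) : ℝ) <
            ((X * (z + 2) / (z + 2 - 1) : ℕ) : ℝ) + 1 := cast_div_lt _ _
        have h2 : ((z + 2 - 1 : ℕ) : ℝ) = ((z + 2 : ℕ) : ℝ) - 1 := by
          rw [Nat.cast_sub (by lia)]
          simp
        rw [h2] at h1
        have h3 : (0 : ℝ) < ((z + 2 : ℕ) : ℝ) - 1 := by linarith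
        calc ((z + 2 : ℕ) : ℝ) / ((z + 2 : ℕ) - 1) * ∏ q ∈ Q, (q : ℝ) / (q - 1)
            ≤ ((z + 2 : ℕ) : ℝ) / ((z + 2 : ℕ) - 1) * (X / 2 ^ 40) := by
              gcongr
              exact hQ.prod_le
          _ = ((X * (z + 2) : ℕ) : ℝ) / (((z + 2 : ℕ) : ℝ) - 1) / 2 ^ 40 := by
              push_cast
              ring
          _ ≤ _ := by
              rw [Nat.cast_add_one (X * (z + 2) / (z + 2 - 1))]
              gcongr
      · rw [Finset.sum_insert hnot, Nat.cast_add, add_div, add_comm]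
        exact add_le_add hlog hQ.le_sum
      · have := hQ.pos
        lia
    refine valid_advance hcert hz' (fun q hq hqP => ?_) 30 hi
    cases h256 : Nat.ble (z + 2) 256 with
    | false =>
      rw [h256] at hqP
      exact (hP q hq hqP).trans (by lia)
    | true =>
      rw [h256] at hqP
      rcases hq.dvd_mul.1 hqP with h1 | h1
      · exact (hP q hq h1).trans (by lia)
      · exact Nat.le_of_dvd (by lia) h1

lemma Valid.iterate (k : ℕ) {s : SieveState} (h : s.Valid) : (iterate k s).Valid := by
  induction k generalizing s with
  | zero => exact h.step
  | succ k ih => exact ih (ih h)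

lemma valid_initial : initial.Valid := by
  refine ⟨⟨{2, 3}, ⟨fun q hq hq3 => ?_, by simp [initial], le_rfl, le_rfl, ?_, ?_, by norm_num [initial],
    ?_⟩⟩, ⟨le_rfl, ?_, ?_⟩,
    ⟨1, rfl⟩, fun q hq hq6 => ?_⟩
  · simp only [initial] at hq3
    have := hq.two_le
    interval_cases q <;> simp
  · norm_num [initial]
  · have h2 := log_two_gt_d9
    have h3 := log_three_gt_d9
    norm_num [initial] at *
    linarith
  · have h3 := log_three_gt_d9
    norm_num [initial] at *
    linarith
  · simp only [initial]
    have h : exp (((96 : ℕ) + 1 : ℝ) / 64) = exp (1 / 64) ^ 97 := by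
      rw [← exp_nat_mul]
      norm_num
    rw [h]
    refine (pow_le_pow_left₀ (exp_pos _).le exp_one_div_le 97).trans ?_
    norm_num
  · intro n hn hl
    simp only [initial] at hl
    exact isBounded_of_small hn (by norm_num at hl ⊢; exact hl)
  · have h1 : q ∣ 2 * 3 := hq6
    rcases hq.dvd_mul.1 h1 with h | h
    · exact (Nat.le_of_dvd (by norm_num) h).trans (by simp [initial])
    · exact (Nat.le_of_dvd (by norm_num) h).trans (by simp [initial])

end SieveState

theorem isBounded_of_lt {n : ℕ} (hn : 3 ≤ n) (h : log (log n) < 23 / 2) : IsBounded n := by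
  refine (SieveState.valid_initial.iterate 15).treated.isBounded n hn (h.trans_le ?_)
  have h1 : ((736 : ℕ) : ℝ) ≤ ((SieveState.iterate 15 SieveState.initial).i : ℝ) :=
    Nat.cast_le.2 SieveState.le_iterate_initial
  rw [le_div_iff₀ (by norm_num)]
  norm_num at h1 ⊢
  exact h1

end TotientBound

namespace TotientBound

open Real

lemma exp_eulerMascheroni_le : exp eulerMascheroniConstant ≤ 1 / 0.56 := by
  have h := Real.le_log_one_add_of_nonneg (x := 0.1556) (by norm_num)
  have h1 : exp (eulerMascheroniConstant / 4) ≤ 1.1556 := by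
    rw [← le_log_iff_exp_le (by norm_num)]
    have := eulerMascheroni_lt
    norm_num at h this ⊢
    linarith
  have h2 : exp eulerMascheroniConstant = exp (eulerMascheroniConstant / 4) ^ 4 := by
    rw [← exp_nat_mul]
    push_cast
    congr 1
    ring
  rw [h2]
  refine (pow_le_pow_left₀ (exp_pos _).le h1 4).trans (by norm_num)

lemma log_add_le_log {l : ℝ} (hl : 0 < l) :
    eulerMascheroniConstant + log l + 1.68 / (l ^ 2 + 0.84) ≤
      log (exp eulerMascheroniConstant * l + 3 / l) := by
  have h0 := exp_pos eulerMascheroniConstant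
  have e : exp eulerMascheroniConstant * l + 3 / l =
      exp eulerMascheroniConstant * l * (1 + 3 / exp eulerMascheroniConstant / l ^ 2) := by
    field_simp
  have h1 : 1.68 / l ^ 2 ≤ 3 / exp eulerMascheroniConstant / l ^ 2 := by
    gcongr
    rw [le_div_iff₀ h0]
    linarith [exp_eulerMascheroni_le]
  have h2 := Real.le_log_one_add_of_nonneg (x := 1.68 / l ^ 2) (by positivity)
  have h3 : 2 * (1.68 / l ^ 2) / (1.68 / l ^ 2 + 2) = 1.68 / (l ^ 2 + 0.84) := by
    field_simp
    ring
  rw [e, log_mul (by positivity) (by positivity), log_mul h0.ne' hl.ne', log_exp]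
  have h4 := log_le_log (by positivity) (add_le_add_right h1 1)
  linarith

lemma le_exp_half {l : ℝ} (hl : 23 / 2 ≤ l) : 2.3 * l ^ 2 ≤ exp (l / 2) := by
  set t := (l - 23 / 2) / 2 with ht
  have ht0 : 0 ≤ t := by linarith
  have h1 := Real.quadratic_le_exp_of_nonneg ht0
  have h3 := exp_one_gt_d9
  have h4 : 305 ≤ exp (23 / 4) := by
    have e : exp (23 / 4) = exp 1 ^ 4 * exp (1 / 4) ^ 7 := by
      rw [← exp_nat_mul, ← exp_nat_mul, ← exp_add]
      norm_num
    have h5 := Real.quadratic_le_exp_of_nonneg (x := 1 / 4) (by norm_num)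
    have h6 : (2.7182818283 : ℝ) ^ 4 ≤ exp 1 ^ 4 := by gcongr
    have h7 : (1 + 1 / 4 + (1 / 4) ^ 2 / 2 : ℝ) ^ 7 ≤ exp (1 / 4) ^ 7 := by gcongr
    rw [e]
    refine le_trans ?_ (mul_le_mul h6 h7 (by positivity) (by positivity))
    norm_num
  have e : exp (l / 2) = exp (23 / 4) * exp t := by
    rw [← exp_add]
    congr 1
    rw [ht]
    ring
  have hl2 : l = 23 / 2 + 2 * t := by rw [ht]; ring
  rw [e, hl2]
  calc 2.3 * (23 / 2 + 2 * t) ^ 2 ≤ 305 * (1 + t + t ^ 2 / 2) := by nlinarith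
    _ ≤ _ := mul_le_mul h4 h1 (by positivity) (exp_pos _).le

lemma polynomial_error_lt {a u v E F : ℝ} (ha : a ≤ 0.7174) (hu0 : 0 < u)
    (hu1 : u ≤ 2 / 23) (hv0 : 0 ≤ v) (hv1 : v ≤ 1 / 300) (hvu : 2.3 * v ≤ u ^ 2)
    (hE : E ≤ 0.252 * v) (hF : F ≤ 1.01 * v ^ 2 * u) :
    a * (u ^ 2 / 2 + 2 / 3 * u ^ 3) + 2 * (u + u ^ 2) * v ^ 2 +
      (u + u ^ 2) * (a * u + 2 * v ^ 2) + (3 / 4 * (v + v ^ 2) + E) + F < 1.66 * u ^ 2 := by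
  have h1 : a * (3 / 2 * u ^ 2 + 5 / 3 * u ^ 3) ≤ 0.7174 * (3 / 2 + 5 / 3 * (2 / 23)) * u ^ 2 := by
    have : 3 / 2 * u ^ 2 + 5 / 3 * u ^ 3 ≤ (3 / 2 + 5 / 3 * (2 / 23)) * u ^ 2 := by
      linarith [mul_le_mul_of_nonneg_left hu1 (sq_nonneg u)]
    calc _ ≤ 0.7174 * ((3 / 2 + 5 / 3 * (2 / 23)) * u ^ 2) := by gcongr
      _ = _ := by ring
  have h2 : (4 * (u + u ^ 2) + 3 / 4 + 1.01 * u) * v ^ 2 ≤ 0.005 * v := by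
    have h3 : 4 * (u + u ^ 2) + 3 / 4 + 1.01 * u ≤ 1.5 := by nlinarith
    calc _ ≤ 1.5 * v ^ 2 := by gcongr
      _ = 1.5 * v * v := by ring
      _ ≤ 1.5 * (1 / 300) * v := by nlinarith
      _ = _ := by ring
  have hu2 : 0 < u ^ 2 := by positivity
  calc _ ≤ a * (3 / 2 * u ^ 2 + 5 / 3 * u ^ 3) +
        (4 * (u + u ^ 2) + 3 / 4 + 1.01 * u) * v ^ 2 + 1.002 * v := by linarith
    _ < 1.66 * u ^ 2 := by linarith

lemma error_lt {y l s : ℝ} (hy : y = s ^ 2) (hl : 23 / 2 ≤ l) (hs : 2.3 * l ^ 2 ≤ s) {a : ℝ}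
    (ha : a ≤ 0.7174) :
    a * (1 / (2 * l ^ 2) + 2 / (3 * l ^ 3)) + 2 * (1 / l + 1 / l ^ 2) / y +
      (1 / l + 1 / l ^ 2) * (a / l + 2 / y) +
      ((s + 1) / 2 * (3 / (2 * y)) + 1 / (4 * s - 6)) + 1 / ((y - 1) * l) <
      1.68 / (l ^ 2 + 0.84) := by
  have hs0 : 300 ≤ s := by nlinarith
  set u := 1 / l with hu
  set v := 1 / s with hv
  have hl0 : l ≠ 0 := by linarith
  have hs1 : s ≠ 0 := by linarith
  have hu0 : 0 < u := by positivity
  have hv0 : 0 < v := by positivity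
  have hu1 : u ≤ 2 / 23 := by
    rw [hu, div_le_div_iff₀ (by linarith) (by norm_num)]
    linarith
  have hv1 : v ≤ 1 / 300 := by
    rw [hv, div_le_div_iff₀ (by linarith) (by norm_num)]
    linarith
  have hvu : 2.3 * v ≤ u ^ 2 := by
    rw [hv, hu, div_pow, mul_one_div, one_pow, div_le_div_iff₀ (by linarith) (by positivity)]
    linarith
  have e1 : 1 / (2 * l ^ 2) + 2 / (3 * l ^ 3) = u ^ 2 / 2 + 2 / 3 * u ^ 3 := by
    rw [hu]
    field_simp
  have e2 : 2 * (u + 1 / l ^ 2) / y = 2 * (u + u ^ 2) * v ^ 2 := by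
    rw [hu, hv, hy]
    field_simp
  have e3 : (u + 1 / l ^ 2) * (a / l + 2 / y) = (u + u ^ 2) * (a * u + 2 * v ^ 2) := by
    rw [hu, hv, hy]
    field_simp
  have e4 : (s + 1) / 2 * (3 / (2 * y)) = 3 / 4 * (v + v ^ 2) := by
    rw [hv, hy]
    field_simp
    ring
  have e5 : 1 / (4 * s - 6) ≤ 0.252 * v := by
    rw [hv, mul_one_div, div_le_div_iff₀ (by linarith) (by linarith)]
    linarith
  have e6 : 1 / ((y - 1) * l) ≤ 1.01 * v ^ 2 * u := by
    have : 1.01 * v ^ 2 * u = 1.01 / (s ^ 2 * l) := by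
      rw [hu, hv]
      field_simp
    have h1 : 1 ≤ s ^ 2 / 300 := by nlinarith
    have h2 : 0 < s ^ 2 - 1 := by nlinarith
    have h3 : 0 < (s ^ 2 - 1) * l := by positivity
    rw [this, hy, div_le_div_iff₀ h3 (by positivity), one_mul]
    calc s ^ 2 * l ≤ 1.01 * (s ^ 2 - 1) * l := by
          gcongr
          linarith
      _ = _ := by ring
  have e7 : 1.68 / (l ^ 2 + 0.84) = 1.68 * u ^ 2 / (1 + 0.84 * u ^ 2) := by
    rw [hu]
    field_simp
  have e8 : 1.66 * u ^ 2 ≤ 1.68 / (l ^ 2 + 0.84) := by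
    rw [e7, le_div_iff₀ (by positivity)]
    have : u ^ 2 ≤ (2 / 23) ^ 2 := by gcongr
    nlinarith [sq_nonneg u]
  refine lt_of_lt_of_le ?_ e8
  rw [e1, e2, e3, e4]
  exact polynomial_error_lt ha hu0 hu1 hv0.le hv1 hvu e5 e6

theorem isBounded_of_le {n : ℕ} (hn : 3 ≤ n) (h : 23 / 2 ≤ log (log n)) : IsBounded n := by
  have h1 := one_lt_log_natCast hn
  have hl0 : 0 < log (log n) := by linarith
  have hs : √(log n) = exp (log (log n) / 2) := by
    rw [exp_half, exp_log (by linarith)]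
  have hs2 := le_exp_half h
  rw [← hs] at hs2
  have hy : log n = √(log n) ^ 2 := (sq_sqrt (by linarith)).symm
  have hK := log_div_totient_le_smoothSum (n := n) (by lia) (by
    have : 9 ≤ √(log n) := by nlinarith
    rw [hy]
    exact this.trans (by nlinarith))
  have hM := (abs_le.1 (abs_smoothSum_sub_le h1)).2
  have hE := error_lt hy h hs2 (a := exp (-1) * 1.95)
    (by linarith [exp_neg_one_lt_d9])
  have hR := log_add_le_log hl0
  rw [tailBound, logWeight] at hM
  refine (log_lt_log_iff (div_totient_pos (by lia)) (by positivity)).1 ?_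
  linarith

end TotientBound

/-- For every integer `m ≥ 3`, `φ(m) > m · log log m / (e^γ (log log m)² + 3)`,
where `γ` is the Euler–Mascheroni constant. -/
theorem totient_lower_bound (m : ℕ) (hm : 3 ≤ m) :
    (m : ℝ) * Real.log (Real.log m) /
        (Real.exp Real.eulerMascheroniConstant * (Real.log (Real.log m)) ^ 2 + 3) <
      (Nat.totient m : ℝ) := by
  have h : TotientBound.IsBounded m := by
    by_cases h : Real.log (Real.log m) < 23 / 2
    · exact TotientBound.isBounded_of_lt hm h
    · exact TotientBound.isBounded_of_le hm (not_lt.1 h)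
  have hl := Real.log_pos (TotientBound.one_lt_log_natCast hm)
  have hφ : (0 : ℝ) < m.totient := by exact_mod_cast Nat.totient_pos.2 (by lia)
  rw [TotientBound.IsBounded, div_lt_iff₀ hφ] at h
  rw [div_lt_iff₀ (by positivity)]
  calc (m : ℝ) * Real.log (Real.log m)
      < (Real.exp Real.eulerMascheroniConstant * Real.log (Real.log m) +
          3 / Real.log (Real.log m)) * m.totient * Real.log (Real.log m) := by gcongr
    _ = _ := by field_simp
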